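/- Let p and q be primes satisfying conditions (1) or conditions (2). Then the 2-class group of the triquadratic field L_pq = Q(√2, √(pq), i) is isomorphic to Z/2Z × Z/2Z. -/

import Mathlib

noncomputable section

open IntermediateField NumberField

/-- Conditions (1). -/
def Cond1 (p q : ℕ) : Prop :=
  p.Prime ∧ q.Prime ∧ p % 4 = 1 ∧ q % 4 = 3 ∧
    jacobiSym 2 p = -1 ∧ jacobiSym 2 q = 1 ∧ jacobiSym (p : ℤ) q = -1

/-- Conditions (2). -/
def Cond2 (p q : ℕ) : Prop :=
  p.Prime ∧ q.Prime ∧ p % 4 = 3 ∧ q % 4 = 3 ∧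
    jacobiSym 2 p = -1 ∧ jacobiSym 2 q = 1 ∧ jacobiSym (p : ℤ) q = -1

/-- The triquadratic field `L_pq = ℚ(√2, √(pq), i)` as a subfield of `ℂ`. -/
def Lf (p q : ℕ) : IntermediateField ℚ ℂ :=
  adjoin ℚ {((Real.sqrt 2 : ℝ) : ℂ), ((Real.sqrt (p * q) : ℝ) : ℂ), Complex.I}

/-- `s` is the conjugation of a quadratic extension `S` of `R`. -/
structure QuadConj (R : Type*) {S : Type*} [CommRing R] [CommRing S] [Algebra R S]
    (s : S ≃ₐ[R] S) : Prop where
  inj : Function.Injective (algebraMap R S)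
  invol : ∀ x, s (s x) = x
  fixed : ∀ x, s x = x → ∃ r, algebraMap R S r = x
  nontriv : ∃ x, s x ≠ x

namespace QuadConj

variable {R S : Type*} [CommRing R] [CommRing S] [Algebra R S] {s : S ≃ₐ[R] S}

lemma exists_norm (h : QuadConj R s) (x : S) : ∃ r, algebraMap R S r = x * s x :=
  h.fixed _ (by rw [map_mul, h.invol, mul_comm])

lemma exists_trace (h : QuadConj R s) (x : S) : ∃ r, algebraMap R S r = x + s x :=
  h.fixed _ (by rw [map_add, h.invol, add_comm])

lemma mem_map (h : QuadConj R s) {I : Ideal S} {x : S} : x ∈ I.map s ↔ s x ∈ I := by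
  rw [Ideal.mem_map_iff_of_surjective s s.surjective]
  constructor
  · rintro ⟨y, hy, rfl⟩
    rwa [h.invol]
  · intro hx
    exact ⟨_, hx, h.invol x⟩

lemma map_map (h : QuadConj R s) (I : Ideal S) : (I.map s).map s = I := by
  ext x
  rw [h.mem_map, h.mem_map, h.invol]

lemma map_span_singleton (x : S) : (Ideal.span {x}).map s = Ideal.span {s x} := by
  rw [Ideal.map_span, Set.image_singleton]

lemma map_ne_bot (h : QuadConj R s) {I : Ideal S} (hI : I ≠ ⊥) : I.map s ≠ ⊥ := by
  intro h0
  apply hI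
  rw [← h.map_map I, h0, Ideal.map_bot]

lemma map_isPrime (I : Ideal S) [hI : I.IsPrime] : (I.map s).IsPrime :=
  Ideal.map_isPrime_of_equiv s

/-- The ideal of the base ring generated by the norms of the elements of an ideal. -/
def normIdeal (s : S ≃ₐ[R] S) (I : Ideal S) : Ideal R :=
  Ideal.span {n : R | ∃ x ∈ I, algebraMap R S n = x * s x}

lemma mul_map_eq [IsDedekindDomain S] (h : QuadConj R s) (I : Ideal S) :
    I * I.map s = (normIdeal s I).map (algebraMap R S) := by
  apply le_antisymm
  · rw [Ideal.mul_le]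
    intro x hx y' hy'
    obtain ⟨y, hy, rfl⟩ : ∃ y ∈ I, s y = y' := ⟨s y', h.mem_map.1 hy', h.invol _⟩
    have key : ∀ z ∈ I, ∀ n, algebraMap R S n = z * s z → n ∈ normIdeal s I :=
      fun z hz n hn => Ideal.subset_span ⟨z, hz, hn⟩
    obtain ⟨n1, hn1⟩ := h.exists_norm x
    obtain ⟨n2, hn2⟩ := h.exists_norm y
    obtain ⟨n3, hn3⟩ := h.exists_norm (x + y)
    set t := x * s y with ht
    set C := (normIdeal s I).map (algebraMap R S) with hC
    have hmem : ∀ n ∈ normIdeal s I, algebraMap R S n ∈ C :=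
      fun n hn => Ideal.mem_map_of_mem _ hn
    have hT : algebraMap R S (n3 - n1 - n2) ∈ C :=
      hmem _ (sub_mem (sub_mem (key _ (add_mem hx hy) _ hn3) (key _ hx _ hn1)) (key _ hy _ hn2))
    have hquad : t * t = algebraMap R S (n3 - n1 - n2) * t -
        algebraMap R S n1 * algebraMap R S n2 := by
      simp only [map_sub, hn1, hn2, hn3, map_add, ht]
      ring
    by_cases ht0 : t = 0
    · rw [ht0]; exact zero_mem _
    set J := C ⊔ Ideal.span {t} with hJ
    have htJ : t ∈ J := Ideal.mem_sup_right (Ideal.mem_span_singleton_self t)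
    have hCJ : C ≤ J := le_sup_left
    have hJ0 : J ≠ ⊥ := fun h0 => ht0 (by rw [h0] at htJ; simpa using htJ)
    have hle : J * J ≤ C * J := by
      have hexp : J * J = C * C ⊔ C * Ideal.span {t} ⊔
          (Ideal.span {t} * C ⊔ Ideal.span {t} * Ideal.span {t}) := by
        rw [hJ, Ideal.sup_mul, Ideal.mul_sup, Ideal.mul_sup]
      rw [hexp]
      refine sup_le (sup_le (Ideal.mul_mono_right hCJ) ?_) (sup_le ?_ ?_)
      · exact Ideal.mul_mono_right le_sup_right
      · rw [mul_comm]
        exact Ideal.mul_mono_right le_sup_right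
      · rw [Ideal.span_singleton_mul_span_singleton, Ideal.span_singleton_le_iff_mem, hquad]
        exact sub_mem (Ideal.mul_mem_mul hT htJ)
          (Ideal.mul_mem_mul (hmem _ (key _ hx _ hn1)) (hCJ (hmem _ (key _ hy _ hn2))))
    have hdvd := Ideal.dvd_iff_le.2 hle
    have := Ideal.dvd_iff_le.1 ((mul_dvd_mul_iff_right hJ0).1 hdvd)
    exact this htJ
  · rw [Ideal.map_le_iff_le_comap, normIdeal, Ideal.span_le]
    rintro n ⟨x, hx, hn⟩
    simp only [SetLike.mem_coe, Ideal.mem_comap, hn]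
    exact Ideal.mul_mem_mul hx (h.mem_map.2 (by rwa [h.invol]))

lemma exists_mul_map_eq_span [IsDedekindDomain S] [IsPrincipalIdealRing R] (h : QuadConj R s)
    (I : Ideal S) : ∃ n : R, I * I.map s = Ideal.span {algebraMap R S n} := by
  obtain ⟨n, hn⟩ := IsPrincipalIdealRing.principal (normIdeal s I)
  refine ⟨n, ?_⟩
  rw [h.mul_map_eq, hn, Ideal.submodule_span_eq, Ideal.map_span, Set.image_singleton]

lemma exists_anti (h : QuadConj R s) : ∃ w, w ≠ 0 ∧ s w = -w := by
  obtain ⟨x, hx⟩ := h.nontriv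
  exact ⟨s x - x, sub_ne_zero.2 hx, by rw [map_sub, h.invol]; ring⟩

/-- Hilbert's Theorem 90. -/
lemma hilbert90 [IsDomain S] (h : QuadConj R s) {x y : S} (hy : y ≠ 0)
    (hxy : x * s x = y * s y) : ∃ z, z ≠ 0 ∧ x * s z = y * z := by
  by_cases hz : x + y = 0
  · obtain ⟨w, hw, hw'⟩ := h.exists_anti
    refine ⟨w, hw, ?_⟩
    rw [hw', eq_neg_of_add_eq_zero_left hz]
    ring
  · refine ⟨(x + y) * s y, mul_ne_zero hz ((map_ne_zero_iff s s.injective).2 hy), ?_⟩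
    rw [map_mul, map_add, h.invol]
    linear_combination y * hxy

end QuadConj

section

section ClassOfIdeal

variable {S : Type*} [CommRing S] [IsDedekindDomain S]

open Classical in
/-- The class of an ideal; the zero ideal is sent to `1`. -/
noncomputable def idealClass (I : Ideal S) : ClassGroup S :=
  if h : I ≠ ⊥ then ClassGroup.mk0 ⟨I, mem_nonZeroDivisors_of_ne_zero h⟩ else 1

lemma idealClass_of_ne {I : Ideal S} (h : I ≠ ⊥) :
    idealClass I = ClassGroup.mk0 ⟨I, mem_nonZeroDivisors_of_ne_zero h⟩ := dif_pos h

lemma exists_idealClass_eq (c : ClassGroup S) : ∃ I : Ideal S, I ≠ ⊥ ∧ idealClass I = c := by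
  obtain ⟨⟨I, hI⟩, rfl⟩ := ClassGroup.mk0_surjective c
  have : I ≠ ⊥ := nonZeroDivisors.ne_zero hI
  exact ⟨I, this, idealClass_of_ne this⟩

lemma idealClass_mul {I J : Ideal S} (hI : I ≠ ⊥) (hJ : J ≠ ⊥) :
    idealClass (I * J) = idealClass I * idealClass J := by
  rw [idealClass_of_ne hI, idealClass_of_ne hJ, idealClass_of_ne (mul_ne_zero hI hJ), ← map_mul]
  rfl

lemma idealClass_eq_iff {I J : Ideal S} (hI : I ≠ ⊥) (hJ : J ≠ ⊥) :
    idealClass I = idealClass J ↔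
      ∃ x y : S, x ≠ 0 ∧ y ≠ 0 ∧ Ideal.span {x} * I = Ideal.span {y} * J := by
  rw [idealClass_of_ne hI, idealClass_of_ne hJ, ClassGroup.mk0_eq_mk0_iff]
  simp only [exists_prop]

lemma idealClass_eq_one_iff {I : Ideal S} (hI : I ≠ ⊥) :
    idealClass I = 1 ↔ ∃ x : S, x ≠ 0 ∧ I = Ideal.span {x} := by
  rw [idealClass_of_ne hI, ClassGroup.mk0_eq_one_iff]
  constructor
  · intro h
    obtain ⟨x, hx⟩ := h.principal
    refine ⟨x, ?_, hx⟩
    rintro rfl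
    exact hI (by simpa using hx)
  · rintro ⟨x, -, hx⟩
    exact ⟨⟨x, hx⟩⟩

lemma idealClass_span {x : S} (hx : x ≠ 0) : idealClass (Ideal.span {x}) = 1 :=
  (idealClass_eq_one_iff (by simpa using hx)).2 ⟨x, hx, rfl⟩

lemma idealClass_top : idealClass (⊤ : Ideal S) = 1 := by
  rw [← Ideal.span_singleton_one]
  exact idealClass_span one_ne_zero

lemma idealClass_pow {I : Ideal S} (hI : I ≠ ⊥) (n : ℕ) :
    idealClass (I ^ n) = idealClass I ^ n := by
  induction n with
  | zero => rw [pow_zero, pow_zero, Ideal.one_eq_top, idealClass_top]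
  | succ n ih => rw [pow_succ, pow_succ, idealClass_mul (pow_ne_zero n hI) hI, ih]

lemma idealClass_prod {ι : Type*} (T : Finset ι) {I : ι → Ideal S} (hI : ∀ i, I i ≠ ⊥) :
    idealClass (∏ i ∈ T, I i) = ∏ i ∈ T, idealClass (I i) := by
  classical
  induction T using Finset.induction_on with
  | empty => rw [Finset.prod_empty, Finset.prod_empty, Ideal.one_eq_top, idealClass_top]
  | insert a T ha ih =>
    rw [Finset.prod_insert ha, Finset.prod_insert ha,
      idealClass_mul (hI a) (Finset.prod_ne_zero_iff.2 fun i _ => hI i), ih]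

end ClassOfIdeal

/-- A map on a group that separates the cosets of `H` bounds the index of `H`. -/
lemma Subgroup.index_le_card_of_separates {G Q : Type*} [Group G] [Finite Q] (H : Subgroup G)
    (f : G → Q) (hf : ∀ a b, f a = f b → a⁻¹ * b ∈ H) : H.index ≤ Nat.card Q := by
  rw [Subgroup.index]
  refine Nat.card_le_card_of_injective (fun c : G ⧸ H => f c.out) ?_
  intro a b hab
  have := QuotientGroup.eq.2 (hf _ _ hab)
  simpa using this

/-- The homomorphism from `(ℤ/2)^ι` attached to a family of elements of order dividing two. -/
noncomputable def twoTorsionHom {ι G : Type*} [Fintype ι] [CommGroup G] (P : ι → G)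
    (hP : ∀ i, P i ^ 2 = 1) : Multiplicative (ι → ZMod 2) →* G where
  toFun e := ∏ i, P i ^ (e.toAdd i).val
  map_one' := by simp
  map_mul' a b := by
    rw [← Finset.prod_mul_distrib]
    refine Finset.prod_congr rfl fun i _ => ?_
    rw [← pow_add, toAdd_mul, Pi.add_apply, ZMod.val_add, ← pow_eq_pow_mod _ (hP i)]

lemma twoTorsionHom_apply {ι G : Type*} [Fintype ι] [CommGroup G] (P : ι → G)
    (hP : ∀ i, P i ^ 2 = 1) (e : ι → ℕ) :
    twoTorsionHom P hP (Multiplicative.ofAdd fun i => (e i : ZMod 2)) = ∏ i, P i ^ e i := by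
  refine Finset.prod_congr rfl fun i _ => ?_
  rw [toAdd_ofAdd, ZMod.val_natCast, ← pow_eq_pow_mod _ (hP i)]

namespace QuadConj

variable {R S : Type*} [CommRing R] [CommRing S] [Algebra R S] {s : S ≃ₐ[R] S}

section

variable [IsDedekindDomain S]

/-- An element `x - s x` lies in every ramified prime. -/
lemma sub_mem_of_ramified (h : QuadConj R s) {P : Ideal S} [hP : P.IsPrime] {π : R}
    (hP0 : P ≠ ⊥) (hsq : P ^ 2 = Ideal.span {algebraMap R S π})
    (hcomap : ∀ r, algebraMap R S r ∈ P → π ∣ r) (hinv : P.map s = P) (z : S) :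
    z - s z ∈ P := by
  have hne : ¬ P ≤ P ^ 2 := by
    intro hle
    have h1 : P * 1 = P * P := by
      rw [mul_one, ← pow_two]
      exact le_antisymm hle (Ideal.pow_le_self two_ne_zero)
    have := mul_left_cancel₀ hP0 h1
    exact hP.ne_top (by rw [← this, Ideal.one_eq_top])
  obtain ⟨x, hx, hx2⟩ := SetLike.not_le_iff_exists.1 hne
  have hsP : ∀ y ∈ P, s y ∈ P := fun y hy => h.mem_map.1 (by rwa [hinv])
  have htr : ∀ y ∈ P, y + s y ∈ P ^ 2 := by
    intro y hy
    obtain ⟨r, hr⟩ := h.exists_trace y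
    rw [hsq, ← hr, Ideal.mem_span_singleton]
    exact map_dvd _ (hcomap r (by rw [hr]; exact add_mem hy (hsP y hy)))
  have hmem : (z - s z) * x ∈ P ^ 2 := by
    have h1 := htr (z * x) (P.mul_mem_left z hx)
    have h2 := (P ^ 2).mul_mem_left (s z) (htr x hx)
    have := sub_mem h1 h2
    rw [map_mul] at this
    convert this using 1
    ring
  by_contra hz
  have hcop : P ⊔ Ideal.span {z - s z} = ⊤ := by
    have hmax : P.IsMaximal := hP.isMaximal hP0
    by_contra hne
    have hle : P ≤ P ⊔ Ideal.span {z - s z} := le_sup_left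
    have := hmax.eq_of_le hne hle
    exact hz (this ▸ Ideal.mem_sup_right (Ideal.mem_span_singleton_self _))
  apply hx2
  have h1 : (1 : S) ∈ P ⊔ Ideal.span {z - s z} := by rw [hcop]; trivial
  obtain ⟨a, ha, b, hb, hab⟩ := Submodule.mem_sup.1 h1
  obtain ⟨c, rfl⟩ := Ideal.mem_span_singleton'.1 hb
  have : x = a * x + c * ((z - s z) * x) := by linear_combination (-x) * hab
  rw [this]
  exact add_mem (by rw [pow_two]; exact Ideal.mul_mem_mul ha hx) ((P ^ 2).mul_mem_left _ hmem)

variable [IsDomain R] [IsPrincipalIdealRing R]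

variable {ι : Type*} {π : ι → R} {P : ι → Ideal S} {z : S}

/-- Invariant primes come from the base or are the given ramified ones. -/
lemma invariant_prime (h : QuadConj R s) (hπ : ∀ i, Prime (π i))
    (hP : ∀ i, P i ^ 2 = Ideal.span {algebraMap R S (π i)})
    (hz : ∀ Q : Ideal S, Q.IsPrime → z - s z ∈ Q → ∃ i, algebraMap R S (π i) ∈ Q)
    (Q : Ideal S) [hQ : Q.IsPrime] (hQ0 : Q ≠ ⊥) (hinv : Q.map s = Q) :
    (∃ b : R, b ≠ 0 ∧ Q = Ideal.span {algebraMap R S b}) ∨ ∃ i, Q = P i := by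
  have hinj0 : ∀ {b : R}, algebraMap R S b ≠ 0 → b ≠ 0 := by
    rintro b hb rfl
    exact hb (map_zero _)
  obtain ⟨n, hn⟩ := h.exists_mul_map_eq_span Q
  rw [hinv] at hn
  have hn0 : algebraMap R S n ≠ 0 := by
    intro h0
    rw [h0, Ideal.span_singleton_eq_bot.2 rfl] at hn
    exact mul_ne_zero hQ0 hQ0 hn
  obtain ⟨p, hp⟩ := IsPrincipalIdealRing.principal (Q.comap (algebraMap R S))
  rw [Ideal.submodule_span_eq] at hp
  have hcomap : ∀ r, algebraMap R S r ∈ Q → p ∣ r := by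
    intro r hr
    rw [← Ideal.mem_span_singleton, ← hp]
    exact hr
  have hpQ : algebraMap R S p ∈ Q := by
    have : p ∈ Q.comap (algebraMap R S) := by rw [hp]; exact Ideal.mem_span_singleton_self p
    exact this
  have hpn : p ∣ n := hcomap n (Ideal.mul_le_left (hn ▸ Ideal.mem_span_singleton_self _ :
    algebraMap R S n ∈ Q * Q))
  have hp0 : algebraMap R S p ≠ 0 := fun h0 => hn0 (by
    obtain ⟨c, rfl⟩ := hpn
    rw [map_mul, h0, zero_mul])
  obtain ⟨J, hJ⟩ := Ideal.dvd_iff_le.2 ((Ideal.span_singleton_le_iff_mem _).2 hpQ)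
  have hJQ : J ∣ Q := by
    have : Q * J ∣ Q * Q := by
      rw [← hJ, hn, Ideal.dvd_iff_le, Ideal.span_singleton_le_span_singleton]
      exact map_dvd _ hpn
    exact (mul_dvd_mul_iff_left hQ0).1 this
  have hQprime : Prime Q := Ideal.prime_of_isPrime hQ0 hQ
  rcases (hQprime.irreducible.dvd_iff).1 hJQ with hJu | hJa
  · left
    refine ⟨p, hinj0 hp0, ?_⟩
    rw [hJ, Ideal.isUnit_iff.1 hJu, Ideal.mul_top]
  · right
    rw [← associated_iff_eq.1 hJa, ← pow_two] at hJ
    have hmem := sub_mem_of_ramified h hQ0 hJ.symm hcomap hinv z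
    obtain ⟨i, hi⟩ := hz Q hQ hmem
    refine ⟨i, ?_⟩
    have hass : Associated p (π i) := by
      have hpd := hcomap _ hi
      rcases ((hπ i).irreducible.dvd_iff).1 hpd with hu | ha
      · exact absurd (Ideal.eq_top_of_isUnit_mem _ hpQ (hu.map _)) hQ.ne_top
      · exact ha.symm
    have hsq : Q ^ 2 = P i ^ 2 := by
      rw [hP, ← hJ, Ideal.span_singleton_eq_span_singleton]
      exact hass.map (algebraMap R S)
    have hdvd : Q ∣ P i := hQprime.dvd_of_dvd_pow (hsq ▸ dvd_pow_self Q two_ne_zero)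
    obtain ⟨I, hI⟩ := hdvd
    rw [hI, mul_pow] at hsq
    have h1 : I ^ 2 = 1 := by
      apply mul_left_cancel₀ (pow_ne_zero 2 hQ0)
      rw [← hsq, mul_one]
    have h2 : I = 1 := isUnit_iff_eq_one.1 (IsUnit.of_mul_eq_one I (by rw [← pow_two, h1]))
    rw [hI, h2, mul_one]

/-- Structure of the invariant ideals. -/
lemma invariant_ideal [Fintype ι] (h : QuadConj R s) (hπ : ∀ i, Prime (π i))
    (hP : ∀ i, P i ^ 2 = Ideal.span {algebraMap R S (π i)})
    (hz : ∀ Q : Ideal S, Q.IsPrime → z - s z ∈ Q → ∃ i, algebraMap R S (π i) ∈ Q)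
    (I : Ideal S) (hI0 : I ≠ ⊥) (hinv : I.map s = I) :
    ∃ (b : R) (e : ι → ℕ), b ≠ 0 ∧ I = Ideal.span {algebraMap R S b} * ∏ i, P i ^ e i := by
  classical
  refine WellFounded.induction (C := fun I : Ideal S => I ≠ ⊥ → I.map s = I →
    ∃ (b : R) (e : ι → ℕ), b ≠ 0 ∧ I = Ideal.span {algebraMap R S b} * ∏ i, P i ^ e i)
    wellFounded_dvdNotUnit I ?_ hI0 hinv
  clear hinv hI0 I
  intro I ih hI0 hinv
  by_cases htop : I = ⊤
  · exact ⟨1, 0, one_ne_zero, by simp [htop, ← Ideal.one_eq_top]⟩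
  have step : ∀ A J : Ideal S, I = A * J → A ≠ ⊤ → A.map s = A →
      ∃ (b : R) (e : ι → ℕ), b ≠ 0 ∧ J = Ideal.span {algebraMap R S b} * ∏ i, P i ^ e i := by
    intro A J hAJ hA hAi
    have hA0 : A ≠ 0 := by rintro rfl; exact hI0 (by rw [hAJ, zero_mul]; rfl)
    have hJ0 : J ≠ ⊥ := by rintro rfl; exact hI0 (by rw [hAJ, Ideal.mul_bot])
    refine ih J ⟨hJ0, A, ?_, by rw [hAJ, mul_comm]⟩ hJ0 ?_
    · rwa [Ideal.isUnit_iff]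
    · apply mul_left_cancel₀ hA0
      rw [← hAJ, ← hinv]
      conv_rhs => rw [hAJ, Ideal.map_mul, hAi]
  obtain ⟨Q, hQm, hIQ⟩ := Ideal.exists_le_maximal I htop
  have hQ : Q.IsPrime := hQm.isPrime
  have hQ0 : Q ≠ ⊥ := by
    rintro rfl
    exact hI0 (le_bot_iff.1 hIQ)
  obtain ⟨J, hJ⟩ := Ideal.dvd_iff_le.2 hIQ
  by_cases hQi : Q.map s = Q
  · obtain ⟨b, e, hb, he⟩ := step Q J hJ hQ.ne_top hQi
    rcases invariant_prime h hπ hP hz Q hQ0 hQi with ⟨c, hc, hQc⟩ | ⟨i, rfl⟩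
    · refine ⟨c * b, e, mul_ne_zero hc hb, ?_⟩
      rw [hJ, he, hQc, ← mul_assoc, Ideal.span_singleton_mul_span_singleton, ← map_mul]
    · refine ⟨b, e + Pi.single i 1, hb, ?_⟩
      have : ∏ j, P j ^ (e + Pi.single i 1 : ι → ℕ) j = (∏ j, P j ^ e j) * P i := by
        simp only [Pi.add_apply, pow_add, Finset.prod_mul_distrib]
        congr 1
        rw [Finset.prod_eq_single i]
        · simp
        · intro j _ hj
          simp [hj]
        · simp
      rw [this, hJ, he]
      ring
  · have hsQ : (Q.map s).IsPrime := map_isPrime Q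
    have hsQ0 := h.map_ne_bot hQ0
    have hdvd : Q.map s ∣ Q * J := by
      rw [← hJ, ← hinv, hJ, Ideal.map_mul]
      exact dvd_mul_right _ _
    have hQp : Prime (Q.map s) := Ideal.prime_of_isPrime hsQ0 hsQ
    rcases hQp.dvd_or_dvd hdvd with h1 | h1
    · have := (Ring.DimensionLEOne.maximalOfPrime hsQ0 hsQ)
      exact absurd (hQm.eq_of_le hsQ.ne_top (Ideal.dvd_iff_le.1 h1)).symm hQi
    · obtain ⟨J', hJ'⟩ := h1
      obtain ⟨n, hn⟩ := h.exists_mul_map_eq_span Q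
      have hI : I = Ideal.span {algebraMap R S n} * J' := by
        rw [hJ, hJ', ← hn, mul_assoc]
      have hn0 : n ≠ 0 := by
        rintro rfl
        rw [map_zero, Ideal.span_singleton_eq_bot.2 rfl] at hn
        exact mul_ne_zero hQ0 hsQ0 hn
      obtain ⟨b, e, hb, he⟩ := step _ J' hI (by
        rw [← hn]
        intro ht
        exact hQ.ne_top (top_le_iff.1 (ht ▸ Ideal.mul_le_left))) (by
        rw [map_span_singleton, s.commutes])
      refine ⟨n * b, e, mul_ne_zero hn0 hb, ?_⟩
      rw [hI, he, ← mul_assoc, Ideal.span_singleton_mul_span_singleton, ← map_mul]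

end

end QuadConj

end

namespace QuadConj

variable {R S : Type*} [CommRing R] [CommRing S] [Algebra R S] {s : S ≃ₐ[R] S}

/-- The norm `v * s v` on units. -/
def unitNorm (s : S ≃ₐ[R] S) : Sˣ →* Sˣ := MonoidHom.id _ * Units.map (s : S →* S)

/-- The map `v / s v` on units. -/
def unitQuot (s : S ≃ₐ[R] S) : Sˣ →* Sˣ := MonoidHom.id _ / Units.map (s : S →* S)

lemma coe_unitNorm (v : Sˣ) : (unitNorm s v : S) = v * s v := rfl

lemma unitQuot_mul (v : Sˣ) : (unitQuot s v : S) * s v = v :=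
  congrArg Units.val (div_mul_cancel v (Units.map (s : S →* S) v))

lemma mem_ker_unitQuot {v : Sˣ} : v ∈ (unitQuot s).ker ↔ s (v : S) = v := by
  rw [MonoidHom.mem_ker, unitQuot, MonoidHom.div_apply, div_eq_one, Units.ext_iff, eq_comm]
  rfl

lemma mem_ker_unitNorm {v : Sˣ} : v ∈ (unitNorm s).ker ↔ (v : S) * s (v : S) = 1 := by
  rw [MonoidHom.mem_ker, Units.ext_iff]
  rfl

lemma mem_range_unitQuot {v : Sˣ} : v ∈ (unitQuot s).range ↔ ∃ u : Sˣ, (v : S) * s u = u := by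
  constructor
  · rintro ⟨u, rfl⟩
    exact ⟨u, unitQuot_mul u⟩
  · rintro ⟨u, hu⟩
    refine ⟨u, ?_⟩
    apply mul_right_cancel (b := Units.map (s : S →* S) u)
    rw [Units.ext_iff]
    exact (unitQuot_mul u).trans hu.symm

variable [IsDomain S]

/-- The invariant units which are norms of field elements. -/
def normicUnits (s : S ≃ₐ[R] S) : Subgroup Sˣ where
  carrier := {e | s (e : S) = e ∧ ∃ x y : S, x ≠ 0 ∧ y ≠ 0 ∧ x * s x = e * (y * s y)}
  one_mem' := ⟨by simp, 1, 1, one_ne_zero, one_ne_zero, by simp⟩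
  mul_mem' := by
    rintro a b ⟨ha, x, y, hx, hy, h1⟩ ⟨hb, x', y', hx', hy', h2⟩
    refine ⟨by rw [Units.val_mul, map_mul, ha, hb], x * x', y * y', mul_ne_zero hx hx',
      mul_ne_zero hy hy', ?_⟩
    simp only [map_mul, Units.val_mul]
    linear_combination h1 * (x' * s x') + a * (y * s y) * h2
  inv_mem' := by
    rintro a ⟨ha, x, y, hx, hy, h1⟩
    refine ⟨?_, y, x, hy, hx, ?_⟩
    · have : s ((a : S) * (a⁻¹ : Sˣ)) = 1 := by rw [Units.mul_inv, map_one]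
      rw [map_mul, ha] at this
      exact a.isUnit.mul_left_cancel (this.trans (Units.mul_inv a).symm)
    · rw [h1, ← mul_assoc, Units.inv_mul, one_mul]

lemma range_unitNorm_le (h : QuadConj R s) : (unitNorm s).range ≤ normicUnits s := by
  rintro _ ⟨v, rfl⟩
  refine ⟨by rw [coe_unitNorm, map_mul, h.invol, mul_comm], v, 1, v.ne_zero, one_ne_zero, ?_⟩
  rw [coe_unitNorm, map_one, mul_one, mul_one]

lemma normicUnits_le : normicUnits s ≤ (unitQuot s).ker := fun _ he => mem_ker_unitQuot.2 he.1

lemma two_mul_relIndex_le (h : QuadConj R s) (u : Sˣ) (hu : s (u : S) = u)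
    (hnn : ∀ x y : S, y ≠ 0 → x * s x ≠ u * (y * s y))
    (hfin : (unitNorm s).range.relIndex (unitQuot s).ker ≠ 0) :
    2 * (unitNorm s).range.relIndex (normicUnits s) ≤
      (unitNorm s).range.relIndex (unitQuot s).ker := by
  have hmul := Subgroup.relIndex_mul_relIndex _ _ _ (range_unitNorm_le h)
      (normicUnits_le (s := s))
  rw [← hmul, mul_comm]
  refine Nat.mul_le_mul_left _ ?_
  have h0 : (normicUnits s).relIndex (unitQuot s).ker ≠ 0 := fun h0 =>
      hfin (by rw [← hmul, h0, mul_zero])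
  have h1 : (normicUnits s).relIndex (unitQuot s).ker ≠ 1 := by
    intro h1
    obtain ⟨-, x, y, -, hy, hxy⟩ := Subgroup.relIndex_eq_one.1 h1 (mem_ker_unitQuot.2 hu)
    exact hnn x y hy hxy
  omega

end QuadConj

namespace QuadConj

variable {R S : Type*} [CommRing R] [CommRing S] [Algebra R S] {s : S ≃ₐ[R] S}
  [IsDedekindDomain S]

/-- An ideal whose class has order two gives rise to a normic unit. -/
lemma exists_normic [IsPrincipalIdealRing R] (h : QuadConj R s) {c : ClassGroup S}
    (hc : c ^ 2 = 1) :
    ∃ (e : normicUnits s) (I : Ideal S) (x y : S), I ≠ ⊥ ∧ x ≠ 0 ∧ y ≠ 0 ∧ idealClass I = c ∧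
      Ideal.span {x} * I = Ideal.span {y} * I.map s ∧ x * s x = (e : Sˣ) * (y * s y) := by
  obtain ⟨I, hI, rfl⟩ := exists_idealClass_eq c
  have hsI := h.map_ne_bot hI
  obtain ⟨n, hn⟩ := h.exists_mul_map_eq_span I
  have hn0 : algebraMap R S n ≠ 0 := by
    intro h0
    rw [h0, Ideal.span_singleton_eq_bot.2 rfl] at hn
    exact mul_ne_zero hI hsI hn
  have hcl : idealClass I = idealClass (I.map s) := by
    apply mul_left_cancel (a := idealClass I)
    rw [← pow_two, hc, ← idealClass_mul hI hsI, hn, idealClass_span hn0]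
  obtain ⟨x, y, hx, hy, hxy⟩ := (idealClass_eq_iff hI hsI).1 hcl
  have h2 := congrArg (Ideal.map s) hxy
  simp only [Ideal.map_mul, map_span_singleton, h.map_map] at h2
  have h3 : Ideal.span {x * s x} * (I * I.map s) = Ideal.span {y * s y} * (I * I.map s) := by
    simp only [← Ideal.span_singleton_mul_span_singleton]
    calc _ = (Ideal.span {x} * I) * (Ideal.span {s x} * I.map s) := by ring
      _ = _ := by rw [hxy, h2]; ring
  have h4 := mul_right_cancel₀ (mul_ne_zero hI hsI) h3
  obtain ⟨e, he⟩ := (Ideal.span_singleton_eq_span_singleton.1 h4).symm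
  have hsy : s y ≠ 0 := (map_ne_zero_iff s s.injective).2 hy
  have hxe : x * s x = e * (y * s y) := by rw [← he, mul_comm]
  refine ⟨⟨e, ?_, x, y, hx, hy, hxe⟩, I, x, y, hI, hx, hy, rfl, hxy, hxe⟩
  apply mul_right_cancel₀ (mul_ne_zero hy hsy)
  rw [← hxe]
  have := congrArg s hxe
  simp only [map_mul, h.invol] at this
  linear_combination -this

/-- If two normic units differ by the norm of a unit, the product of the classes contains an
invariant ideal. -/
lemma exists_invariant (h : QuadConj R s) {I I' : Ideal S} (hI : I ≠ ⊥) (hI' : I' ≠ ⊥)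
    {x y x' y' : S} {e e' : Sˣ} (hx : x ≠ 0) (hy : y ≠ 0) (hx' : x' ≠ 0) (hy' : y' ≠ 0)
    (h1 : Ideal.span {x} * I = Ideal.span {y} * I.map s)
    (h1' : Ideal.span {x'} * I' = Ideal.span {y'} * I'.map s)
    (h2 : x * s x = e * (y * s y)) (h2' : x' * s x' = e' * (y' * s y'))
    (hee : e⁻¹ * e' ∈ (unitNorm s).range) :
    ∃ J : Ideal S, J ≠ ⊥ ∧ J.map s = J ∧ idealClass J = idealClass I * idealClass I' := by
  obtain ⟨v, hv⟩ := hee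
  have hv' : (e' : S) = e * (v * s v) := by
    rw [← coe_unitNorm, hv, ← Units.val_mul, mul_inv_cancel_left]
  have hsI' := h.map_ne_bot hI'
  -- `(v x y') I s(I') = (y x') s(I) I'`
  have hN : (v * x * y') * s (v * x * y') = (y * x') * s (y * x') := by
    simp only [map_mul]
    rw [hv'] at h2'
    linear_combination (v * s v) * (y' * s y') * h2 - (y * s y) * h2'
  obtain ⟨z, hz, hzz⟩ := h.hilbert90 (mul_ne_zero hy hx') hN
  have hmain : Ideal.span {v * x * y'} * (I * I'.map s) =
      Ideal.span {y * x'} * (I.map s * I') := by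
    have : Ideal.span {v * x * y'} = Ideal.span {x} * Ideal.span {y'} := by
      rw [Ideal.span_singleton_mul_span_singleton, Ideal.span_singleton_eq_span_singleton]
      exact ⟨v⁻¹, by rw [mul_assoc (v : S), mul_comm (v : S), mul_assoc, Units.mul_inv, mul_one]⟩
    rw [this, ← Ideal.span_singleton_mul_span_singleton]
    calc _ = (Ideal.span {x} * I) * (Ideal.span {y'} * I'.map s) := by ring
      _ = _ := by rw [h1, ← h1']; ring
  have hX : v * x * y' ≠ 0 := mul_ne_zero (mul_ne_zero v.ne_zero hx) hy'
  refine ⟨Ideal.span {z} * (I * I'.map s), mul_ne_zero (by simpa using hz)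
    (mul_ne_zero hI hsI'), ?_, ?_⟩
  · rw [Ideal.map_mul, Ideal.map_mul, map_span_singleton, h.map_map]
    apply mul_left_cancel₀ (a := Ideal.span {v * x * y'})
      (fun h0 => hX (Ideal.span_singleton_eq_bot.1 h0))
    rw [← mul_assoc, Ideal.span_singleton_mul_span_singleton, hzz,
      ← Ideal.span_singleton_mul_span_singleton]
    calc _ = Ideal.span {z} * (Ideal.span {y * x'} * (I.map s * I')) := by ring
      _ = _ := by rw [← hmain]; ring
  · rw [idealClass_mul (by simpa using hz) (mul_ne_zero hI hsI'), idealClass_span hz,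
      one_mul, idealClass_mul hI hsI']
    congr 1
    symm
    exact (idealClass_eq_iff hI' hsI').2 ⟨x', y', hx', hy', h1'⟩

/-- The genus-theoretic bound for the two-torsion of the class group of a quadratic extension of a
principal ideal domain. -/
theorem four_mul_card_le [IsDomain R] [IsPrincipalIdealRing R] {ι : Type*} [Fintype ι]
    [Finite (ClassGroup S)] (h : QuadConj R s) {π : ι → R} {P : ι → Ideal S} {z : S}
    (hπ : ∀ i, Prime (π i)) (hP : ∀ i, P i ^ 2 = Ideal.span {algebraMap R S (π i)})
    (hz : ∀ Q : Ideal S, Q.IsPrime → z - s z ∈ Q → ∃ i, algebraMap R S (π i) ∈ Q)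
    (u : Sˣ) (hu : s (u : S) = u) (hnn : ∀ x y : S, y ≠ 0 → x * s x ≠ u * (y * s y))
    (hfin : (unitNorm s).range.relIndex (unitQuot s).ker ≠ 0)
    (hherb : 2 * (unitNorm s).range.relIndex (unitQuot s).ker ≤
      (unitQuot s).range.relIndex (unitNorm s).ker) :
    4 * Nat.card (powMonoidHom 2 : ClassGroup S →* ClassGroup S).ker ≤ 2 ^ Fintype.card ι := by
  have hπ0 : ∀ i, algebraMap R S (π i) ≠ 0 := fun i =>
    (map_ne_zero_iff _ h.inj).2 (hπ i).ne_zero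
  have hP0 : ∀ i, P i ≠ ⊥ := by
    intro i h0
    have := hP i
    rw [h0, Ideal.bot_pow two_ne_zero, eq_comm, Ideal.span_singleton_eq_bot] at this
    exact hπ0 i this
  have hPc : ∀ i, idealClass (P i) ^ 2 = 1 := fun i => by
    rw [← idealClass_pow (hP0 i), hP, idealClass_span (hπ0 i)]
  set ψ := twoTorsionHom (fun i => idealClass (P i)) hPc with hψ
  have hclass : ∀ (b : R) (e : ι → ℕ), b ≠ 0 →
      idealClass (Ideal.span {algebraMap R S b} * ∏ i, P i ^ e i) =
        ψ (Multiplicative.ofAdd fun i => (e i : ZMod 2)) := by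
    intro b e hb
    have hb' : algebraMap R S b ≠ 0 := (map_ne_zero_iff _ h.inj).2 hb
    rw [idealClass_mul (by simpa using hb') (Finset.prod_ne_zero_iff.2 fun i _ =>
      pow_ne_zero _ (hP0 i)), idealClass_span hb', one_mul,
      idealClass_prod _ fun i => pow_ne_zero _ (hP0 i), hψ, twoTorsionHom_apply]
    simp only [idealClass_pow (hP0 _)]
  -- units and the kernel of `ψ`
  have hker : (unitQuot s).range.relIndex (unitNorm s).ker ≤ Nat.card ψ.ker := by
    have hex : ∀ v : (unitNorm s).ker, ∃ (w : S) (b : R) (e : ι → ℕ), w ≠ 0 ∧ b ≠ 0 ∧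
        ((v : Sˣ) : S) * s w = w ∧
        Ideal.span {w} = Ideal.span {algebraMap R S b} * ∏ i, P i ^ e i := by
      rintro ⟨v, hv⟩
      have hv1 := mem_ker_unitNorm.1 hv
      obtain ⟨w, hw, hvw⟩ := h.hilbert90 (x := (v : S)) (y := 1) one_ne_zero (by simpa using hv1)
      rw [one_mul] at hvw
      have hinv : (Ideal.span {w}).map s = Ideal.span {w} := by
        rw [map_span_singleton, Ideal.span_singleton_eq_span_singleton]
        exact ⟨v, by rw [mul_comm, hvw]⟩
      obtain ⟨b, e, hb, he⟩ := invariant_ideal h hπ hP hz _ (by simpa using hw) hinv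
      exact ⟨w, b, e, hw, hb, hvw, he⟩
    choose w b e hw hb hvw he using hex
    refine Subgroup.index_le_card_of_separates _ (fun v => (⟨Multiplicative.ofAdd
      fun i => (e v i : ZMod 2), ?_⟩ : ψ.ker)) ?_
    · rw [MonoidHom.mem_ker, ← hclass _ _ (hb v), ← he, idealClass_span (hw v)]
    · intro v v' hvv
      rw [Subtype.mk.injEq, Multiplicative.ofAdd.apply_eq_iff_eq] at hvv
      have hpar : ∀ i, ∃ k, e v i + e v' i = 2 * k := by
        intro i
        have := congrFun hvv i
        rw [ZMod.natCast_eq_natCast_iff'] at this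
        exact ⟨(e v i + e v' i) / 2, by omega⟩
      choose k hk using hpar
      have hspan : Ideal.span {w v * w v'} =
          Ideal.span {algebraMap R S (b v * b v' * ∏ i, π i ^ k i)} := by
        rw [← Ideal.span_singleton_mul_span_singleton, he, he, map_mul, map_mul, map_prod,
          ← Ideal.span_singleton_mul_span_singleton, ← Ideal.span_singleton_mul_span_singleton,
          ← Ideal.prod_span_singleton]
        simp only [map_pow, ← Ideal.span_singleton_pow, ← hP, ← pow_mul, ← hk, pow_add,
          Finset.prod_mul_distrib]
        ring
      obtain ⟨u', hu'⟩ := (Ideal.span_singleton_eq_span_singleton.1 hspan).symm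
      rw [Subgroup.mem_subgroupOf]
      have hmem : (v : Sˣ) * v' ∈ (unitQuot s).range := by
        rw [mem_range_unitQuot]
        refine ⟨u', ?_⟩
        have h1 := congrArg s hu'
        rw [map_mul s, s.commutes, map_mul s (w v)] at h1
        have h0 : algebraMap R S (b v * b v' * ∏ i, π i ^ k i) ≠ 0 := by
          intro h0
          rw [h0, zero_mul] at hu'
          exact mul_ne_zero (hw v) (hw v') hu'.symm
        apply mul_left_cancel₀ h0
        rw [hu', mul_left_comm, h1, Units.val_mul]
        nth_rewrite 2 [← hvw v, ← hvw v']
        ring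
      have hsq : (v : Sˣ) * v ∈ (unitQuot s).range := by
        rw [mem_range_unitQuot]
        refine ⟨v, ?_⟩
        rw [Units.val_mul, mul_assoc, mem_ker_unitNorm.1 v.2, mul_one]
      have : ((v⁻¹ * v' : (unitNorm s).ker) : Sˣ) = ((v : Sˣ) * v)⁻¹ * (v * v') := by
        push_cast
        group
      rw [this]
      exact mul_mem (inv_mem hsq) hmem
  -- classes of order two and normic units
  have hX := two_mul_relIndex_le h u hu hnn hfin
  have hXfin : (unitNorm s).range.relIndex (normicUnits s) ≠ 0 := by
    intro h0
    have hmul := Subgroup.relIndex_mul_relIndex _ _ _ (range_unitNorm_le h)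
      (normicUnits_le (s := s))
    rw [h0, zero_mul] at hmul
    exact hfin hmul.symm
  have hCl : Nat.card (powMonoidHom 2 : ClassGroup S →* ClassGroup S).ker ≤
      (unitNorm s).range.relIndex (normicUnits s) * Nat.card ψ.range := by
    have hex := fun c : (powMonoidHom 2 : ClassGroup S →* ClassGroup S).ker =>
      exists_normic h (c := c) c.2
    choose e I x y hI hx hy hIc h1 h2 using hex
    have : Finite (normicUnits s ⧸ (unitNorm s).range.subgroupOf (normicUnits s)) :=
      Nat.finite_of_card_ne_zero hXfin
    have hidx := Subgroup.index_le_card_of_separates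
      (ψ.range.subgroupOf (powMonoidHom 2 : ClassGroup S →* ClassGroup S).ker)
      (fun c => (QuotientGroup.mk (e c) :
        normicUnits s ⧸ (unitNorm s).range.subgroupOf (normicUnits s))) (by
        intro c c' hcc
        have hcc' := QuotientGroup.eq.1 hcc
        rw [Subgroup.mem_subgroupOf] at hcc' ⊢
        obtain ⟨J, hJ, hJs, hJc⟩ := exists_invariant h (hI c) (hI c') (hx c) (hy c) (hx c')
          (hy c') (h1 c) (h1 c') (h2 c) (h2 c') hcc'
        obtain ⟨b, k, hb, hk⟩ := invariant_ideal h hπ hP hz J hJ hJs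
        rw [hk, hclass b k hb, hIc, hIc] at hJc
        have hinv : ((c : ClassGroup S))⁻¹ = c := by
          rw [inv_eq_iff_mul_eq_one, ← pow_two]
          exact c.2
        exact ⟨_, by rw [hJc, Subgroup.coe_mul, Subgroup.coe_inv, hinv]⟩)
    rw [← Subgroup.index_mul_card
      (ψ.range.subgroupOf (powMonoidHom 2 : ClassGroup S →* ClassGroup S).ker)]
    refine Nat.mul_le_mul hidx ?_
    exact Nat.card_le_card_of_injective
      (fun a => (⟨a.1.1, Subgroup.mem_subgroupOf.1 a.2⟩ : ψ.range)) (by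
      intro a b hab
      simp only [Subtype.mk.injEq] at hab
      exact Subtype.ext (Subtype.ext hab))
  have hcount : Nat.card ψ.range * Nat.card ψ.ker = 2 ^ Fintype.card ι := by
    have h1 := Subgroup.index_mul_card ψ.ker
    rw [Subgroup.index_ker] at h1
    rw [h1, Nat.card_congr Multiplicative.toAdd, Nat.card_fun, Nat.card_zmod,
      Nat.card_eq_fintype_card]
  calc 4 * Nat.card (powMonoidHom 2 : ClassGroup S →* ClassGroup S).ker
      ≤ 4 * ((unitNorm s).range.relIndex (normicUnits s) * Nat.card ψ.range) :=
        Nat.mul_le_mul_left _ hCl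
    _ = (2 * (2 * (unitNorm s).range.relIndex (normicUnits s))) * Nat.card ψ.range := by ring
    _ ≤ Nat.card ψ.ker * Nat.card ψ.range :=
        Nat.mul_le_mul_right _ (((Nat.mul_le_mul_left 2 hX).trans hherb).trans hker)
    _ = _ := by rw [← hcount, mul_comm]

end QuadConj

section TwoIndex

lemma Int.finrank_eq_zero_of_torsion {A : Type*} [AddCommGroup A]
    (h : ∀ x : A, ∃ n : ℤ, n ≠ 0 ∧ n • x = 0) : Module.finrank ℤ A = 0 :=
  Module.finrank_eq_zero_of_rank_eq_zero (rank_eq_zero_iff.2 h)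

lemma Int.finrank_range_add_finrank_ker {A B : Type*} [AddCommGroup A] [AddCommGroup B]
    [Module.Finite ℤ A] (f : A →ₗ[ℤ] B) :
    Module.finrank ℤ (LinearMap.range f) + Module.finrank ℤ (LinearMap.ker f) =
      Module.finrank ℤ A := by
  rw [← f.quotKerEquivRange.finrank_eq]
  exact Submodule.finrank_quotient_add_finrank _

lemma AddSubgroup.index_range_nsmul_congr {A B : Type*} [AddCommGroup A] [AddCommGroup B]
    (e : A ≃+ B) (n : ℕ) : (nsmulAddMonoidHom n : A →+ A).range.index =
      (nsmulAddMonoidHom n : B →+ B).range.index := by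
  rw [← AddSubgroup.index_map_equiv _ e]
  congr 1
  ext x
  simp only [AddSubgroup.mem_map, AddMonoidHom.mem_range, nsmulAddMonoidHom_apply]
  constructor
  · rintro ⟨_, ⟨y, rfl⟩, rfl⟩
    exact ⟨e y, by simp⟩
  · rintro ⟨y, rfl⟩
    exact ⟨n • e.symm y, ⟨_, rfl⟩, by simp⟩

lemma AddSubgroup.card_ker_nsmul_congr {A B : Type*} [AddCommGroup A] [AddCommGroup B]
    (e : A ≃+ B) (n : ℕ) : Nat.card (nsmulAddMonoidHom n : A →+ A).ker =
      Nat.card (nsmulAddMonoidHom n : B →+ B).ker := by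
  refine Nat.card_congr (e.toEquiv.subtypeEquiv fun a => ?_)
  change n • a = 0 ↔ n • e a = 0
  rw [← map_nsmul, map_eq_zero_iff e e.injective]

lemma AddSubgroup.index_range_nsmul_prod (A B : Type*) [AddCommGroup A] [AddCommGroup B] (n : ℕ) :
    (nsmulAddMonoidHom n : A × B →+ A × B).range.index =
      (nsmulAddMonoidHom n : A →+ A).range.index * (nsmulAddMonoidHom n : B →+ B).range.index := by
  rw [← AddSubgroup.index_prod]
  congr 1
  ext ⟨x, y⟩
  simp only [AddSubgroup.mem_prod, AddMonoidHom.mem_range, nsmulAddMonoidHom_apply]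
  constructor
  · rintro ⟨⟨a, b⟩, h⟩
    exact ⟨⟨a, congrArg Prod.fst h⟩, ⟨b, congrArg Prod.snd h⟩⟩
  · rintro ⟨⟨a, ha⟩, ⟨b, hb⟩⟩
    exact ⟨(a, b), Prod.ext ha hb⟩

lemma AddSubgroup.card_ker_nsmul_prod (A B : Type*) [AddCommGroup A] [AddCommGroup B] (n : ℕ) :
    Nat.card (nsmulAddMonoidHom n : A × B →+ A × B).ker =
      Nat.card (nsmulAddMonoidHom n : A →+ A).ker *
        Nat.card (nsmulAddMonoidHom n : B →+ B).ker := by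
  rw [← Nat.card_prod]
  refine Nat.card_congr ⟨fun x => (⟨x.1.1, congrArg Prod.fst x.2⟩, ⟨x.1.2, congrArg Prod.snd x.2⟩),
    fun x => ⟨(x.1.1, x.2.1), Prod.ext x.1.2 x.2.2⟩, fun _ => rfl, fun _ => rfl⟩

lemma AddSubgroup.index_range_nsmul_free (A : Type*) [AddCommGroup A] [Module.Free ℤ A]
    [Module.Finite ℤ A] (n : ℕ) [NeZero n] :
    (nsmulAddMonoidHom n : A →+ A).range.index = n ^ Module.finrank ℤ A := by
  rw [← ModN.natCard_eq]
  rw [AddSubgroup.index]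
  refine Nat.card_congr (QuotientAddGroup.quotientAddEquivOfEq ?_).toEquiv
  ext x
  simp

lemma AddSubgroup.index_range_nsmul_finite (A : Type*) [AddCommGroup A] [Finite A] (n : ℕ) :
    (nsmulAddMonoidHom n : A →+ A).range.index = Nat.card (nsmulAddMonoidHom n : A →+ A).ker := by
  have h1 := AddSubgroup.index_mul_card (nsmulAddMonoidHom n : A →+ A).ker
  have h2 := AddSubgroup.index_mul_card (nsmulAddMonoidHom n : A →+ A).range
  rw [AddSubgroup.index_ker, mul_comm] at h1
  exact Nat.eq_of_mul_eq_mul_right Nat.card_pos (h2.trans h1.symm)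

/-- The index of `2 • A` in a finitely generated abelian group `A`. -/
lemma AddSubgroup.index_range_two_nsmul (A : Type*) [AddCommGroup A] [Module.Finite ℤ A] :
    (nsmulAddMonoidHom 2 : A →+ A).range.index =
      2 ^ Module.finrank ℤ A * Nat.card (nsmulAddMonoidHom 2 : A →+ A).ker := by
  have : AddGroup.FG A := Module.Finite.iff_addGroup_fg.1 inferInstance
  obtain ⟨n, ι, _, p, hp, e, ⟨f⟩⟩ := AddCommGroup.equiv_free_prod_directSum_zmod A
  have : ∀ i, NeZero (p i ^ e i) := fun i => ⟨pow_ne_zero _ (hp i).ne_zero⟩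
  let f' := f.trans ((AddEquiv.refl (Fin n →₀ ℤ)).prodCongr
    (DirectSum.addEquivProd fun i => ZMod (p i ^ e i)))
  have hfin : Module.finrank ℤ A = n := by
    rw [f'.toIntLinearEquiv.finrank_eq]
    have h1 := Int.finrank_range_add_finrank_ker
      (LinearMap.fst ℤ (Fin n →₀ ℤ) ((i : ι) → ZMod (p i ^ e i)))
    rw [LinearMap.range_eq_top.2 LinearMap.fst_surjective, finrank_top, Module.finrank_finsupp_self,
      Fintype.card_fin] at h1
    have h2 : Module.finrank ℤ (LinearMap.ker
        (LinearMap.fst ℤ (Fin n →₀ ℤ) ((i : ι) → ZMod (p i ^ e i)))) = 0 := by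
      refine Int.finrank_eq_zero_of_torsion fun x => ⟨Nat.card ((i : ι) → ZMod (p i ^ e i)),
        Nat.cast_ne_zero.2 Nat.card_pos.ne', ?_⟩
      obtain ⟨⟨x, y⟩, hx⟩ := x
      have hx' : x = 0 := hx
      subst hx'
      refine Subtype.ext (Prod.ext (smul_zero _) ?_)
      exact (natCast_zsmul _ _).trans (card_nsmul_eq_zero' (x := y))
    omega
  rw [AddSubgroup.index_range_nsmul_congr f', AddSubgroup.card_ker_nsmul_congr f',
    AddSubgroup.index_range_nsmul_prod, AddSubgroup.card_ker_nsmul_prod,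
    AddSubgroup.index_range_nsmul_free, AddSubgroup.index_range_nsmul_finite, hfin,
    Module.finrank_finsupp_self, Fintype.card_fin]
  have h1 : Nat.card (nsmulAddMonoidHom 2 : (Fin n →₀ ℤ) →+ (Fin n →₀ ℤ)).ker = 1 := by
    rw [AddSubgroup.card_eq_one, AddMonoidHom.ker_eq_bot_iff]
    intro a b hab
    ext i
    have := DFunLike.congr_fun hab i
    simpa using this
  rw [h1, one_mul]

lemma Subgroup.relIndex_map_sq {E : Type*} [CommGroup E] (H : Subgroup E)
    [Module.Finite ℤ (Additive H)] :
    (H.map (powMonoidHom 2)).relIndex H =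
      2 ^ Module.finrank ℤ (Additive H) * Nat.card (powMonoidHom 2 : H →* H).ker := by
  have h1 := AddSubgroup.index_range_two_nsmul (Additive H)
  have h2 : (H.map (powMonoidHom 2)).subgroupOf H = (powMonoidHom 2 : H →* H).range := by
    ext x
    rw [Subgroup.mem_subgroupOf]
    constructor
    · rintro ⟨y, hy, hyx⟩
      exact ⟨⟨y, hy⟩, Subtype.ext hyx⟩
    · rintro ⟨y, hy⟩
      exact ⟨y, y.2, congrArg Subtype.val hy⟩
  rw [Subgroup.relIndex, h2]
  exact h1

lemma Module.Finite.additive_subgroup {E : Type*} [CommGroup E] [Module.Finite ℤ (Additive E)]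
    (H : Subgroup E) : Module.Finite ℤ (Additive H) :=
  Module.Finite.of_injective (MonoidHom.toAdditive H.subtype).toIntLinearMap H.subtype_injective

/-- The Herbrand quotient of a finitely generated group with involution of negative rank one more
than its positive rank. -/
theorem herbrand_of_finrank {U E : Type*} [CommGroup U] [CommGroup E]
    [Module.Finite ℤ (Additive U)] [Module.Finite ℤ (Additive E)] (j : U →* E)
    (hj : Function.Injective j) (σ : E →* E) (hσ : ∀ v, σ (σ v) = v)
    (hfix : (MonoidHom.id E / σ).ker = j.range)
    (hcard : Nat.card (powMonoidHom 2 : U →* U).ker =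
      Nat.card (powMonoidHom 2 : (MonoidHom.id E * σ).ker →* (MonoidHom.id E * σ).ker).ker)
    (hpos : Nat.card (powMonoidHom 2 : U →* U).ker ≠ 0)
    (hrank : Module.finrank ℤ (Additive E) = 2 * Module.finrank ℤ (Additive U) + 1) :
    (MonoidHom.id E * σ).range.relIndex (MonoidHom.id E / σ).ker ≠ 0 ∧
    2 * (MonoidHom.id E * σ).range.relIndex (MonoidHom.id E / σ).ker =
      (MonoidHom.id E / σ).range.relIndex (MonoidHom.id E * σ).ker := by
  set N := MonoidHom.id E * σ with hN
  set Q := MonoidHom.id E / σ with hQ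
  have hNv : ∀ v, N v = v * σ v := fun v => rfl
  have hQv : ∀ v, Q v = v / σ v := fun v => rfl
  have hQk : ∀ v, v ∈ Q.ker ↔ σ v = v := fun v => by
    rw [MonoidHom.mem_ker, hQv, div_eq_one, eq_comm]
  have hNk : ∀ v, v ∈ N.ker ↔ v * σ v = 1 := fun v => by rw [MonoidHom.mem_ker, hNv]
  have hQQ : Q.ker.map N = Q.ker.map (powMonoidHom 2) := by
    refine SetLike.coe_injective (Set.image_congr fun v hv => ?_)
    rw [hNv, (hQk v).1 hv, powMonoidHom_apply, pow_two]
  have hNN : N.ker.map Q = N.ker.map (powMonoidHom 2) := by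
    refine SetLike.coe_injective (Set.image_congr fun v hv => ?_)
    rw [hQv, ← inv_eq_of_mul_eq_one_right ((hNk v).1 hv), powMonoidHom_apply, pow_two,
      div_inv_eq_mul]
  have hNQ : N.range ≤ Q.ker := by
    rintro _ ⟨v, rfl⟩
    rw [hQk, hNv, map_mul, hσ, mul_comm]
  have hQN : Q.range ≤ N.ker := by
    rintro _ ⟨v, rfl⟩
    rw [hNk, hQv, map_div, hσ, div_mul_div_cancel, div_self']
  have e1 := Subgroup.relIndex_mul_relIndex (Q.ker.map N) N.range Q.ker
    (Subgroup.map_le_range _ _) hNQ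
  have e2 := Subgroup.relIndex_mul_relIndex (N.ker.map Q) Q.range N.ker
    (Subgroup.map_le_range _ _) hQN
  rw [MonoidHom.range_eq_map N, Subgroup.relIndex_map_map, ← MonoidHom.range_eq_map, hQQ] at e1
  rw [MonoidHom.range_eq_map Q, Subgroup.relIndex_map_map, ← MonoidHom.range_eq_map, hNN] at e2
  rw [sup_comm N.ker, top_sup_eq] at e2
  rw [top_sup_eq] at e1
  have := Module.Finite.additive_subgroup Q.ker
  have := Module.Finite.additive_subgroup N.ker
  rw [Subgroup.relIndex_map_sq] at e1 e2
  let f : U ≃* Q.ker := (MonoidHom.ofInjective hj).trans (MulEquiv.subgroupCongr hfix.symm)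
  have hr1 : Module.finrank ℤ (Additive Q.ker) = Module.finrank ℤ (Additive U) :=
    (MulEquiv.toAdditive f).toIntLinearEquiv.finrank_eq.symm
  have hc1 : Nat.card (powMonoidHom 2 : Q.ker →* Q.ker).ker =
      Nat.card (powMonoidHom 2 : U →* U).ker :=
    (AddSubgroup.card_ker_nsmul_congr (MulEquiv.toAdditive f) 2).symm
  have hr2 : Module.finrank ℤ (Additive N.ker) = Module.finrank ℤ (Additive U) + 1 := by
    let n : E →* Q.ker := N.codRestrict Q.ker fun v => hNQ ⟨v, rfl⟩
    let l := (MonoidHom.toAdditive n).toIntLinearMap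
    have h1 := Int.finrank_range_add_finrank_ker l
    let g : Additive N.ker ≃ LinearMap.ker l :=
      ⟨fun v => ⟨v.1, Subtype.ext v.2⟩, fun v => ⟨v.1, congrArg Subtype.val v.2⟩,
        fun _ => rfl, fun _ => rfl⟩
    let g' : Additive N.ker ≃+ LinearMap.ker l := { g with map_add' := fun _ _ => rfl }
    rw [← g'.toIntLinearEquiv.finrank_eq] at h1
    have h2 : Module.finrank ℤ (LinearMap.range l) = Module.finrank ℤ (Additive Q.ker) := by
      apply le_antisymm (Submodule.finrank_le _)
      let d := LinearMap.lsmul ℤ (Additive Q.ker) 2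
      have h3 := Int.finrank_range_add_finrank_ker d
      have h4 : Module.finrank ℤ (LinearMap.ker d) = 0 :=
        Int.finrank_eq_zero_of_torsion fun x => ⟨2, two_ne_zero, Subtype.ext x.2⟩
      rw [← h3, h4, add_zero]
      apply Submodule.finrank_mono
      rintro _ ⟨x, rfl⟩
      refine ⟨(x.toMul : E), ?_⟩
      refine Subtype.ext ?_
      change N x.toMul.1 = x.toMul.1 ^ (2 : ℤ)
      rw [hNv, (hQk _).1 x.toMul.2, zpow_two]
    omega
  rw [hr1, hc1] at e1
  rw [hr2, ← hcard] at e2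
  have hpos' : 2 ^ Module.finrank ℤ (Additive U) * Nat.card (powMonoidHom 2 : U →* U).ker ≠ 0 :=
    mul_ne_zero (pow_ne_zero _ two_ne_zero) hpos
  rw [← e1] at hpos'
  refine ⟨right_ne_zero_of_mul hpos', ?_⟩
  apply Nat.eq_of_mul_eq_mul_left (Nat.pos_of_ne_zero (left_ne_zero_of_mul hpos'))
  rw [e2, mul_left_comm, e1, pow_succ]
  ring

end TwoIndex

lemma card_ker_sq_eq_two {G T : Type*} [CommGroup G] [CommRing T] [IsDomain T]
    (φ : G →* Tˣ) (hφ : Function.Injective φ) (hT : (1 : T) ≠ -1) {g : G} (hg : φ g = -1) :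
    Nat.card (powMonoidHom 2 : G →* G).ker = 2 := by
  have hg2 : g ^ 2 = 1 := hφ (by rw [map_pow, hg, neg_one_sq, map_one])
  rw [Nat.card_eq_two_iff]
  refine ⟨1, ⟨g, hg2⟩, ?_, ?_⟩
  · intro h
    have : g = 1 := (congrArg Subtype.val h).symm
    rw [this, map_one] at hg
    exact hT (congrArg Units.val hg)
  · rw [Set.eq_univ_iff_forall]
    rintro ⟨x, hx⟩
    have hx2 : (φ x : T) ^ 2 = 1 := by
      have : x ^ 2 = 1 := hx
      rw [← Units.val_pow_eq_pow_val, ← map_pow, this, map_one, Units.val_one]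
    rcases mul_self_eq_one_iff.1 ((pow_two _).symm.trans hx2) with h | h
    · left
      exact Subtype.ext (hφ ((Units.ext h).trans (map_one φ).symm))
    · right
      exact Subtype.ext (hφ (Eq.trans (Units.ext h) hg.symm))

lemma NumberField.one_ne_neg_one (K : Type*) [Field K] [NumberField K] : (1 : 𝓞 K) ≠ -1 := by
  intro h
  have : (2 : 𝓞 K) = 0 := by linear_combination h
  exact two_ne_zero this

lemma NumberField.IsTotallyComplex.two_mul_rank_add_one (K : Type*) [Field K] [NumberField K]
    [IsTotallyComplex K] : 2 * (Units.rank K + 1) = Module.finrank ℚ K := by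
  rw [IsTotallyComplex.finrank K, Units.rank,
    InfinitePlace.card_eq_nrRealPlaces_add_nrComplexPlaces,
    IsTotallyComplex.nrRealPlaces_eq_zero, zero_add]
  have : 0 < Fintype.card (InfinitePlace K) := Fintype.card_pos
  rw [InfinitePlace.card_eq_nrRealPlaces_add_nrComplexPlaces,
    IsTotallyComplex.nrRealPlaces_eq_zero, zero_add] at this
  omega

namespace QuadConj

lemma ker_unitQuot_eq_range {R S : Type*} [CommRing R] [CommRing S] [Algebra R S]
    {s : S ≃ₐ[R] S} (h : QuadConj R s) :
    (unitQuot s).ker = (Units.map (algebraMap R S : R →* S)).range := by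
  ext v
  rw [mem_ker_unitQuot]
  constructor
  · intro hv
    obtain ⟨a, ha⟩ := h.fixed _ hv
    have hv' : s ((v⁻¹ : Sˣ) : S) = (v⁻¹ : Sˣ) := by
      apply v.isUnit.mul_left_cancel
      rw [Units.mul_inv]
      conv_lhs => rw [← hv]
      rw [← map_mul, Units.mul_inv, map_one]
    obtain ⟨b, hb⟩ := h.fixed _ hv'
    have hab : a * b = 1 := h.inj (by rw [map_mul, ha, hb, Units.mul_inv, map_one])
    exact ⟨⟨a, b, hab, by rw [mul_comm, hab]⟩, Units.ext ha⟩
  · rintro ⟨u, rfl⟩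
    exact s.commutes _

theorem herbrand_units {k F : Type*} [Field k] [NumberField k] [Field F] [NumberField F]
    [Algebra k F] {s : 𝓞 F ≃ₐ[𝓞 k] 𝓞 F} (h : QuadConj (𝓞 k) s) [IsTotallyComplex k]
    [IsTotallyComplex F] (h2 : Module.finrank k F = 2) :
    (unitNorm s).range.relIndex (unitQuot s).ker ≠ 0 ∧
    2 * (unitNorm s).range.relIndex (unitQuot s).ker =
      (unitQuot s).range.relIndex (unitNorm s).ker := by
  have hk : Nat.card (powMonoidHom 2 : (𝓞 k)ˣ →* (𝓞 k)ˣ).ker = 2 :=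
    card_ker_sq_eq_two (MonoidHom.id _) Function.injective_id (one_ne_neg_one k) (g := -1) rfl
  have hF : Nat.card (powMonoidHom 2 : (unitNorm s).ker →* (unitNorm s).ker).ker = 2 :=
    card_ker_sq_eq_two (Subgroup.subtype _) (Subgroup.subtype_injective _) (one_ne_neg_one F)
      (g := ⟨-1, mem_ker_unitNorm.2 (by simp)⟩) rfl
  have hrank : Module.finrank ℤ (Additive (𝓞 F)ˣ) = 2 * Module.finrank ℤ (Additive (𝓞 k)ˣ) + 1 := by
    rw [Units.finrank_eq, Units.finrank_eq]
    have h1 := IsTotallyComplex.two_mul_rank_add_one k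
    have h3 := IsTotallyComplex.two_mul_rank_add_one F
    have h4 := Module.finrank_mul_finrank ℚ k F
    rw [h2] at h4
    omega
  exact herbrand_of_finrank (Units.map (algebraMap (𝓞 k) (𝓞 F) : 𝓞 k →* 𝓞 F))
    (Units.map_injective h.inj) (Units.map (s : 𝓞 F →* 𝓞 F)) (fun v => Units.ext (h.invol v))
    h.ker_unitQuot_eq_range (hk.trans hF.symm) (hk.trans_ne two_ne_zero) hrank

end QuadConj

lemma exists_not_dvd_of_sq_sub {R : Type*} [CommRing R] [IsDomain R] [WfDvdMonoid R]
    {π D a x y z : R} (hπ : Prime π) (hD : π ∣ D) (hD2 : ¬ π ^ 2 ∣ D)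
    (hz : z ≠ 0) (h : x ^ 2 - D * y ^ 2 = a * z ^ 2) :
    ∃ x z : R, ¬ π ∣ z ∧ π ∣ x ^ 2 - a * z ^ 2 := by
  obtain ⟨n, z', hz', rfl⟩ := WfDvdMonoid.max_power_factor hz hπ.irreducible
  clear hz
  induction n generalizing x y with
  | zero =>
    rw [pow_zero, one_mul] at h
    exact ⟨x, z', hz', by rw [← h, sub_sub_cancel]; exact hD.mul_right _⟩
  | succ n ih =>
    obtain ⟨d, rfl⟩ := hD
    have hx : π ∣ x := hπ.dvd_of_dvd_pow (n := 2)
      ⟨d * y ^ 2 + a * (π * π ^ n * π ^ n * z' ^ 2), by linear_combination h⟩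
    obtain ⟨x', rfl⟩ := hx
    have hd : ¬ π ∣ d := fun ⟨c, hc⟩ => hD2 ⟨c, by rw [hc]; ring⟩
    have hy : π ∣ d * y ^ 2 := by
      refine ⟨x' ^ 2 - a * (π ^ n * z') ^ 2, mul_left_cancel₀ hπ.ne_zero ?_⟩
      linear_combination -h
    obtain ⟨y', rfl⟩ := hπ.dvd_of_dvd_pow ((hπ.dvd_or_dvd hy).resolve_left hd)
    refine ih (x := x') (y := y') (mul_left_cancel₀ (pow_ne_zero 2 hπ.ne_zero) ?_)
    linear_combination h

namespace QuadConj

variable {R S : Type*} [CommRing R] [CommRing S] [Algebra R S] {s : S ≃ₐ[R] S}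

lemma exists_coord (h : QuadConj R s) {e : S} {D : R} (he : e ^ 2 = algebraMap R S D)
    (hs : s e = -e) (x : S) :
    ∃ a b, algebraMap R S (2 * D) * x = algebraMap R S a + algebraMap R S b * e := by
  obtain ⟨a, ha⟩ := h.exists_trace x
  obtain ⟨b, hb⟩ := h.fixed ((x - s x) * e) (by
    rw [map_mul, map_sub, h.invol, hs]; ring)
  refine ⟨D * a, b, ?_⟩
  rw [map_mul, map_mul, ha, hb, ← he, map_ofNat]
  ring

/-- A norm equation in `S` gives one in `R`. -/
lemma exists_sq_sub_of_norm [IsDomain S] (h : QuadConj R s) {e : S} {D : R}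
    (he : e ^ 2 = algebraMap R S D) (hs : s e = -e) (h2D : 2 * D ≠ 0) {a : R} {x y : S}
    (hy : y ≠ 0) (hxy : x * s x = algebraMap R S a * (y * s y)) :
    ∃ x y z : R, z ≠ 0 ∧ x ^ 2 - D * y ^ 2 = a * z ^ 2 := by
  obtain ⟨b, c, hbc⟩ := h.exists_coord he hs (x * s y)
  obtain ⟨n, hn⟩ := h.exists_norm y
  have hn0 : algebraMap R S n ≠ 0 := by
    rw [hn]
    exact mul_ne_zero hy ((map_ne_zero_iff _ s.injective).2 hy)
  have hd0 : algebraMap R S (2 * D) ≠ 0 := (map_ne_zero_iff _ h.inj).2 h2D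
  refine ⟨b, c, 2 * D * n, fun h0 => mul_ne_zero hd0 hn0 (by rw [← map_mul, h0, map_zero]),
    h.inj ?_⟩
  have hbc' := congrArg s hbc
  simp only [map_mul, map_add, h.invol, hs, AlgEquiv.commutes] at hbc'
  simp only [map_mul, map_sub, map_pow, ← he, hn] at hbc hbc' ⊢
  linear_combination (-(algebraMap R S b - algebraMap R S c * e)) * hbc -
    (algebraMap R S 2 * e ^ 2 * (x * s y)) * hbc' +
    (algebraMap R S 2) ^ 2 * e ^ 4 * (y * s y) * hxy

/-- The genus-theoretic obstruction to being a square in the class group. -/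
lemma exists_sq_sub_of_isSquare [IsDomain R] [IsPrincipalIdealRing R] [IsDedekindDomain S]
    (h : QuadConj R s) {e : S} {D : R}
    (he : e ^ 2 = algebraMap R S D) (hs : s e = -e) (h2D : 2 * D ≠ 0) {a : R} {I : Ideal S}
    (hI : I ≠ ⊥) (hIa : I * I.map s = Ideal.span {algebraMap R S a})
    {c : ClassGroup S} (hc : idealClass I = c ^ 2) :
    ∃ (u : Rˣ) (x y z : R), z ≠ 0 ∧ x ^ 2 - D * y ^ 2 = u * a * z ^ 2 := by
  obtain ⟨J, hJ, rfl⟩ := exists_idealClass_eq c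
  rw [← idealClass_pow hJ, idealClass_eq_iff hI (pow_ne_zero 2 hJ)] at hc
  obtain ⟨x, y, hx, hy, hxy⟩ := hc
  obtain ⟨n, hn⟩ := h.exists_mul_map_eq_span J
  have key : Ideal.span {x * s x * algebraMap R S a} =
      Ideal.span {(y * algebraMap R S n) * s (y * algebraMap R S n)} := by
    have h1 := congrArg (Ideal.map s) hxy
    rw [Ideal.map_mul, Ideal.map_mul, Ideal.map_pow, map_span_singleton, map_span_singleton] at h1
    have h2 : Ideal.span {x} * Ideal.span {s x} * (I * I.map s) =
        Ideal.span {y} * Ideal.span {s y} * (J * J.map s) ^ 2 := by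
      calc _ = (Ideal.span {x} * I) * (Ideal.span {s x} * I.map s) := by ring
        _ = _ := by rw [hxy, h1]; ring
    rw [hIa, hn, Ideal.span_singleton_pow] at h2
    simp only [Ideal.span_singleton_mul_span_singleton] at h2
    rw [h2, map_mul, s.commutes]
    congr 2
    ring
  obtain ⟨v, hv⟩ := Ideal.span_singleton_eq_span_singleton.1 key
  obtain ⟨m, hm⟩ := h.exists_norm x
  obtain ⟨l, hl⟩ := h.exists_norm (y * algebraMap R S n)
  have hI0 : algebraMap R S a ≠ 0 := by
    intro h0
    rw [h0, Ideal.span_singleton_eq_bot.2 rfl] at hIa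
    exact mul_ne_zero hI (h.map_ne_bot hI) hIa
  have hsx : s x ≠ 0 := (map_ne_zero_iff _ s.injective).2 hx
  have key' : Associated (m * a) l := by
    have hd : ∀ b c : R, algebraMap R S b ∣ algebraMap R S c → algebraMap R S b ≠ 0 → b ∣ c := by
      rintro b c ⟨t, ht⟩ hb
      obtain ⟨t', rfl⟩ := h.fixed t (by
        have := congrArg s ht
        rw [map_mul, s.commutes, s.commutes, ht] at this
        exact (mul_left_cancel₀ hb this).symm)
      exact ⟨t', h.inj (by rw [map_mul, ht])⟩
    have hma : algebraMap R S (m * a) ≠ 0 := by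
      rw [map_mul, hm]; exact mul_ne_zero (mul_ne_zero hx hsx) hI0
    have hass : Associated (algebraMap R S (m * a)) (algebraMap R S l) := by
      rw [map_mul, hm, hl]; exact ⟨v, hv⟩
    exact associated_of_dvd_dvd (hd _ _ hass.dvd hma) (hd _ _ hass.symm.dvd
      (hass.ne_zero_iff.1 hma))
  obtain ⟨u, hu⟩ := key'
  refine ⟨u, h.exists_sq_sub_of_norm he hs h2D (a := u * a) (x := y * algebraMap R S n) hx ?_⟩
  rw [← hl, ← hm, ← hu, ← map_mul]
  congr 1
  ring

lemma map_eq_of_sq [IsDedekindDomain S] {I : Ideal S} {a : R}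
    (hI : I ^ 2 = Ideal.span {algebraMap R S a}) : I.map s = I := by
  have : (I.map s) ^ 2 = I ^ 2 := by
    rw [← Ideal.map_pow, hI, map_span_singleton, s.commutes]
  exact pow_left_injective two_ne_zero this

end QuadConj

lemma Ideal.span_pair_sq {S : Type*} [CommRing S] {a v b c : S} (hv : v ^ 2 = a * (b * v + c))
    (hc : IsCoprime a c) : Ideal.span {a, v} ^ 2 = Ideal.span {a} := by
  have h : Ideal.span {a, v, b * v + c} = ⊤ := by
    rw [Ideal.eq_top_iff_one]
    obtain ⟨r, t, hrt⟩ := hc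
    have h1 : a ∈ Ideal.span {a, v, b * v + c} := Ideal.subset_span (by simp)
    have h2 : v ∈ Ideal.span {a, v, b * v + c} := Ideal.subset_span (by simp)
    have h3 : b * v + c ∈ Ideal.span {a, v, b * v + c} := Ideal.subset_span (by simp)
    have := Ideal.add_mem _ (Ideal.mul_mem_left _ r h1)
      (Ideal.mul_mem_left _ t (Ideal.sub_mem _ h3 (Ideal.mul_mem_left _ b h2)))
    rwa [show r * a + t * (b * v + c - b * v) = 1 by linear_combination hrt] at this
  calc Ideal.span {a, v} ^ 2 = Ideal.span {a} * Ideal.span {a, v, b * v + c} := by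
        rw [pow_two, Ideal.span_pair_mul_span_pair, Ideal.span_mul_span', Set.singleton_mul,
          Set.image_insert_eq, Set.image_insert_eq, Set.image_singleton, ← hv, mul_comm v a,
          ← pow_two v, Set.insert_eq_of_mem (a := a * v) (by simp)]
    _ = Ideal.span {a} := by rw [h, Ideal.mul_top]

/-- The element `π` of `R`, with residue map `φ`, stays prime in the quadratic extension `S`
with conjugation `s`. -/
structure InertAt {R S : Type*} [CommRing R] [CommRing S] {l : ℕ} (f : R →+* S) (s : S →+* S)
    (φ : R →+* ZMod l) (π : R) : Prop where
  comm : ∀ r, s (f r) = f r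
  norm : ∀ x, ∃ n, f n = x * s x
  ker : ∀ r, φ r = 0 ↔ π ∣ r
  not_isUnit : ¬ IsUnit (f π)
  dvd_of_norm : ∀ x, f π ∣ x * s x → f π ∣ x

namespace InertAt

variable {R S : Type*} [CommRing R] [CommRing S] {l : ℕ} [Fact l.Prime] {f : R →+* S} {s : S →+* S}
  {φ : R →+* ZMod l} {π : R}

lemma map_eq_zero_of_dvd (hker : ∀ r, φ r = 0 ↔ π ∣ r) (hu : ¬ IsUnit (f π)) {r : R}
    (h : f π ∣ f r) : φ r = 0 := by
  by_contra hr
  obtain ⟨n, hn⟩ := ZMod.natCast_zmod_surjective (φ r)⁻¹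
  have h1 : π ∣ r * n - 1 := (hker _).1 (by
    rw [map_sub, map_mul, map_natCast, hn, mul_inv_cancel₀ hr, map_one, sub_self])
  apply hu
  have h2 : f π ∣ f (r * n) - f 1 := by rw [← map_sub]; exact map_dvd f h1
  have h3 : f π ∣ f (r * n) := by rw [map_mul]; exact h.mul_right _
  rw [dvd_sub_right h3, map_one] at h2
  exact isUnit_of_dvd_one h2

theorem of_nonsquare {ω : S} {t n : R} (hker : ∀ r, φ r = 0 ↔ π ∣ r) (hu : ¬ IsUnit (f π))
    (hcomm : ∀ r, s (f r) = f r) (hs : s ω = f t - ω) (hω : ω ^ 2 = f t * ω - f n)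
    (hspan : ∀ x, ∃ a b, x = f a + f b * ω)
    (hd : ¬ IsSquare (φ (t ^ 2 - 4 * n))) : InertAt f s φ π := by
  have hN : ∀ a b, (f a + f b * ω) * s (f a + f b * ω) = f (a ^ 2 + t * a * b + n * b ^ 2) := by
    intro a b
    simp only [map_add, map_mul, map_pow, hcomm, hs]
    linear_combination (-(f b) ^ 2) * hω
  refine ⟨hcomm, ?_, hker, hu, ?_⟩
  · intro x
    obtain ⟨a, b, rfl⟩ := hspan x
    exact ⟨_, (hN a b).symm⟩
  · intro x hx
    obtain ⟨a, b, rfl⟩ := hspan x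
    rw [hN] at hx
    have h0 := map_eq_zero_of_dvd hker hu hx
    simp only [map_add, map_mul, map_pow] at h0
    have hb : φ b = 0 := by
      by_contra hb
      apply hd
      refine ⟨(2 * φ a + φ t * φ b) / φ b, ?_⟩
      simp only [map_sub, map_mul, map_pow, map_ofNat]
      field_simp
      linear_combination (-4) * h0
    have ha : φ a = 0 := by
      rw [hb] at h0
      simpa using h0
    exact dvd_add (map_dvd f ((hker _).1 ha)) ((map_dvd f ((hker _).1 hb)).mul_right _)

lemma dvd (h : InertAt f s φ π) {r : R} (hr : f π ∣ f r) : φ r = 0 :=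
  map_eq_zero_of_dvd h.ker h.not_isUnit hr

lemma prime (h : InertAt f s φ π) (h0 : f π ≠ 0) : Prime (f π) := by
  refine ⟨h0, h.not_isUnit, fun x y hxy => ?_⟩
  obtain ⟨a, ha⟩ := h.norm x
  obtain ⟨b, hb⟩ := h.norm y
  have : f π ∣ f (a * b) := by
    rw [map_mul, ha, hb]
    exact (hxy.mul_right (s x * s y)).trans (dvd_of_eq (by ring))
  have := h.dvd this
  rw [map_mul, mul_eq_zero] at this
  rcases this with h' | h'
  · exact .inl (h.dvd_of_norm x (ha ▸ map_dvd f ((h.ker _).1 h')))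
  · exact .inr (h.dvd_of_norm y (hb ▸ map_dvd f ((h.ker _).1 h')))

lemma isSquare (h : InertAt f s φ π) {x z w : S} (hz : ¬ f π ∣ z) (hx : f π ∣ x ^ 2 - w * z ^ 2)
    {n : R} (hn : f n = w * s w) : IsSquare (φ n) := by
  obtain ⟨a, ha⟩ := h.norm x
  obtain ⟨b, hb⟩ := h.norm z
  have hb0 : φ b ≠ 0 := fun h0 => hz (h.dvd_of_norm z (hb ▸ map_dvd f ((h.ker _).1 h0)))
  obtain ⟨c, hc⟩ := hx
  have h1 : φ (a ^ 2 - n * b ^ 2) = 0 := by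
    apply h.dvd
    have hc' := congrArg s hc
    simp only [map_sub, map_mul, map_pow, h.comm] at hc'
    refine ⟨c * (s x) ^ 2 + w * z ^ 2 * s c, ?_⟩
    simp only [map_sub, map_mul, map_pow, ha, hb, hn]
    linear_combination (s x) ^ 2 * hc + w * z ^ 2 * hc'
  refine ⟨φ a / φ b, ?_⟩
  simp only [map_sub, map_mul, map_pow] at h1
  field_simp
  linear_combination -h1

end InertAt

namespace Zsqrtd

variable {d : ℤ}

lemma not_mul_self (hd : d = -1 ∨ d = -2 ∨ d = 2) (n : ℤ) : d ≠ n * n := by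
  rcases hd with rfl | rfl | rfl
  · nlinarith
  · nlinarith
  · intro h
    have h1 : n < 2 := by nlinarith
    have h2 : -2 < n := by nlinarith
    interval_cases n <;> omega

lemma isDomain_of_small (hd : d = -1 ∨ d = -2 ∨ d = 2) : IsDomain (ℤ√d) := by
  have : NoZeroDivisors (ℤ√d) := ⟨fun {a b} h => by
    have h1 := congrArg norm h
    rw [norm_mul, norm_zero, mul_eq_zero, norm_eq_zero (not_mul_self hd),
      norm_eq_zero (not_mul_self hd)] at h1
    exact h1⟩
  exact NoZeroDivisors.to_isDomain _

lemma exists_abs_two_mul_sub_le (u N : ℤ) (hN : N ≠ 0) : ∃ k, |2 * (u - k * N)| ≤ |N| := by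
  refine ⟨round ((u : ℚ) / N), ?_⟩
  have h := abs_sub_round ((u : ℚ) / N)
  have hN' : (N : ℚ) ≠ 0 := by exact_mod_cast hN
  have h1 : ((u : ℚ) - round ((u : ℚ) / N) * N) = ((u : ℚ) / N - round ((u : ℚ) / N)) * N := by
    field_simp
  have h2 : |(2 : ℚ) * (u - round ((u : ℚ) / N) * N)| ≤ |(N : ℚ)| := by
    rw [h1, abs_mul, abs_mul, abs_two]
    nlinarith [abs_nonneg (N : ℚ)]
  exact_mod_cast h2

/-- The rings `ℤ[√d]` with `|d| ≤ 2` are norm-Euclidean. -/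
lemma exists_norm_sub_lt (hd : d = -1 ∨ d = -2 ∨ d = 2) (x : ℤ√d) {a : ℤ√d} (ha : a ≠ 0) :
    ∃ c, (norm (x - c * a)).natAbs < (norm a).natAbs := by
  have hN : norm a ≠ 0 := fun h => ha ((norm_eq_zero (not_mul_self hd) a).1 h)
  obtain ⟨k, hk⟩ := exists_abs_two_mul_sub_le (x * star a).re _ hN
  obtain ⟨l, hl⟩ := exists_abs_two_mul_sub_le (x * star a).im _ hN
  refine ⟨⟨k, l⟩, ?_⟩
  have h1 : norm (x - ⟨k, l⟩ * a) * norm a =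
      ((x * star a).re - k * norm a) ^ 2 - d * ((x * star a).im - l * norm a) ^ 2 := by
    rw [← norm_conj a, ← norm_mul, sub_mul, mul_assoc, ← norm_eq_mul_conj, norm_conj]
    simp only [norm_def (_ - _), re_sub, im_sub, re_mul, im_mul, re_intCast, im_intCast]
    ring
  zify
  have h2 : |norm (x - ⟨k, l⟩ * a)| * |norm a| < |norm a| * |norm a| := by
    rw [← abs_mul, h1]
    have hk2 := sq_le_sq' (abs_le.1 hk).1 (abs_le.1 hk).2
    have hl2 := sq_le_sq' (abs_le.1 hl).1 (abs_le.1 hl).2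
    have hpos : 0 < |norm a| := abs_pos.2 hN
    rw [abs_lt]
    rcases hd with rfl | rfl | rfl <;> constructor <;> nlinarith
  exact lt_of_mul_lt_mul_right h2 (abs_nonneg _)

theorem isPrincipalIdealRing_of_small (hd : d = -1 ∨ d = -2 ∨ d = 2) :
    IsPrincipalIdealRing (ℤ√d) := by
  refine ⟨fun I => ⟨?_⟩⟩
  by_cases hI : I = ⊥
  · exact ⟨0, by rw [hI]; simp⟩
  obtain ⟨b, hb, hb0⟩ := Submodule.exists_mem_ne_zero_of_ne_bot hI
  obtain ⟨a, ⟨haI, ha0⟩, hmin⟩ := (measure fun a : ℤ√d => (norm a).natAbs).wf.has_min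
    {a | a ∈ I ∧ a ≠ 0} ⟨b, hb, hb0⟩
  refine ⟨a, _root_.le_antisymm (fun x hx => ?_) ((Ideal.span_singleton_le_iff_mem I).2 haI)⟩
  obtain ⟨c, hc⟩ := exists_norm_sub_lt hd x ha0
  by_cases h0 : x - c * a = 0
  · exact Ideal.mem_span_singleton'.2 ⟨c, (sub_eq_zero.1 h0).symm⟩
  · exact absurd hc (hmin (x - c * a) ⟨I.sub_mem hx (I.mul_mem_left c haI), h0⟩)

lemma exists_natAbs_norm_eq (hd : d = -1 ∨ d = -2 ∨ d = 2) {l : ℕ} (hl : l.Prime) {n : ℤ}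
    (hn : (l : ℤ) ∣ n ^ 2 - d) : ∃ a : ℤ√d, (norm a).natAbs = l := by
  have := isDomain_of_small hd
  have := isPrincipalIdealRing_of_small hd
  have hl0 : (l : ℤ√d) ≠ 0 := by exact_mod_cast hl.ne_zero
  have hlu : ¬ IsUnit (l : ℤ√d) := by
    rw [← norm_eq_one_iff, norm_natCast, Int.natAbs_mul, Int.natAbs_natCast]
    intro h
    exact hl.one_lt.ne' (Nat.eq_one_of_mul_eq_one_right h)
  have hnp : ¬ Prime (l : ℤ√d) := by
    intro hp
    have h1 : (l : ℤ√d) ∣ ⟨n, 1⟩ * ⟨n, -1⟩ := by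
      obtain ⟨c, hc⟩ := hn
      refine ⟨(c : ℤ√d), ?_⟩
      ext
      · simp
        linear_combination hc
      · simp
    have hdiv : ∀ e : ℤ, (l : ℤ√d) ∣ ⟨n, e⟩ → (l : ℤ) ∣ e := by
      rintro e ⟨c, hc⟩
      exact ⟨c.im, by simpa using congrArg im hc⟩
    have hl1 : ¬ (l : ℤ) ∣ 1 := fun h => hl.one_lt.ne' (by
      have := Int.natAbs_dvd_natAbs.2 h
      simpa using this)
    rcases hp.dvd_or_dvd h1 with h | h
    · exact hl1 (hdiv _ h)
    · exact hl1 ((dvd_neg).1 (hdiv _ h))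
  rw [← irreducible_iff_prime, irreducible_iff] at hnp
  push Not at hnp
  obtain ⟨a, b, hab, ha, hb⟩ := hnp hlu
  refine ⟨a, ?_⟩
  rw [← norm_eq_one_iff] at ha hb
  have h1 := congrArg (fun x => (norm x).natAbs) hab
  simp only [norm_natCast, norm_mul, Int.natAbs_mul, Int.natAbs_natCast] at h1
  exact ((hl.mul_eq_prime_sq_iff ha hb).1 (by rw [← h1, sq])).1

/-- The residue map of a prime element of prime norm. -/
lemma exists_residueMap (hd : d = -1 ∨ d = -2 ∨ d = 2) {l : ℕ} (hl : l.Prime) {a : ℤ√d}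
    (ha : (norm a).natAbs = l) :
    ∃ φ : ℤ√d →+* ZMod l, ∀ r, φ r = 0 ↔ a ∣ r := by
  have : Fact l.Prime := ⟨hl⟩
  have hla : (l : ℤ) ∣ norm a := Int.natCast_dvd.2 (by rw [ha])
  have hN : ((norm a : ℤ) : ZMod l) = 0 := (ZMod.intCast_zmod_eq_zero_iff_dvd _ _).2 hla
  have him : ((a.im : ℤ) : ZMod l) ≠ 0 := by
    intro h
    have h1 : ((a.re : ℤ) : ZMod l) = 0 := by
      rw [norm_def] at hN
      push_cast at hN
      rw [h] at hN
      simpa using hN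
    rw [ZMod.intCast_zmod_eq_zero_iff_dvd] at h h1
    obtain ⟨u, hu⟩ := h
    obtain ⟨v, hv⟩ := h1
    have : (l : ℤ) * l ∣ norm a := ⟨v * v - d * u * u, by rw [norm_def, hu, hv]; ring⟩
    rw [← Int.natAbs_dvd_natAbs, ha, Int.natAbs_mul, Int.natAbs_natCast] at this
    have := Nat.le_of_dvd hl.pos this
    nlinarith [hl.two_le]
  let n : ZMod l := -(a.re : ZMod l) / (a.im : ZMod l)
  have hn : n * n = (d : ZMod l) := by
    simp only [n]
    rw [norm_def] at hN
    push_cast at hN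
    field_simp
    linear_combination hN
  refine ⟨lift ⟨n, hn⟩, fun r => ?_⟩
  have hφ : ∀ r : ℤ√d, lift ⟨n, hn⟩ r = (r.re : ZMod l) + r.im * n := fun r => rfl
  constructor
  · intro h
    have hmul : a ∣ (norm a : ℤ√d) := by rw [norm_eq_mul_conj]; exact dvd_mul_right _ _
    have h2 : (l : ℤ√d) ∣ r * star a := by
      rw [hφ] at h
      simp only [n] at h
      field_simp at h
      have hre : ((r * star a).im : ZMod l) = 0 := by
        simp
        linear_combination -h
      have hre' : ((r * star a).re : ZMod l) = 0 := by
        refine (mul_eq_zero.1 (?_ : (a.im : ZMod l) * _ = 0)).resolve_left him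
        rw [norm_def] at hN
        push_cast at hN
        simp only [re_mul, re_star, im_star]
        push_cast
        linear_combination (a.re : ZMod l) * h + r.im * hN
      rw [← Int.cast_natCast, intCast_dvd]
      exact ⟨(ZMod.intCast_zmod_eq_zero_iff_dvd _ _).1 hre',
        (ZMod.intCast_zmod_eq_zero_iff_dvd _ _).1 hre⟩
    have h3 : (norm a : ℤ√d) ∣ (l : ℤ√d) := by
      rw [← Int.cast_natCast, intCast_dvd_intCast, ← ha]
      exact Int.dvd_natAbs.2 dvd_rfl
    have h4 := h3.trans h2
    rw [norm_eq_mul_conj, mul_comm r, mul_comm a] at h4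
    have := isDomain_of_small hd
    have ha0 : star a ≠ 0 := by
      intro h0
      have := norm_conj a
      rw [h0, norm_zero] at this
      rw [← this] at ha
      exact hl.ne_zero ha.symm
    exact (mul_dvd_mul_iff_left ha0).1 h4
  · rintro ⟨c, rfl⟩
    rw [map_mul, hφ a]
    have : (a.re : ZMod l) + a.im * n = 0 := by
      simp only [n]
      field_simp
      ring
    rw [this, zero_mul]

end Zsqrtd

section

/-- Arithmetic data of an imaginary quadratic principal ideal domain in which `p` splits, `q` is
inert and `2` ramifies. -/
structure BaseData (R : Type*) [CommRing R] (p q : ℕ) where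
  /-- a prime above `p` -/
  π₁ : R
  /-- the other prime above `p` -/
  π₂ : R
  /-- the prime above `2` -/
  θ : R
  /-- a unit -/
  ε : R
  /-- the residue map of `π₁` -/
  φ₁ : R →+* ZMod p
  /-- the residue map of `π₂` -/
  φ₂ : R →+* ZMod p
  /-- the residue map of `θ` -/
  φθ : R →+* ZMod 2
  /-- the norm -/
  ν : R →* ℤ
  /-- the conjugation -/
  conj : R ≃+* R
  ker₁ : ∀ r, φ₁ r = 0 ↔ π₁ ∣ r
  ker₂ : ∀ r, φ₂ r = 0 ↔ π₂ ∣ r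
  kerθ : ∀ r, φθ r = 0 ↔ θ ∣ r
  ne₁ : φ₁ π₂ ≠ 0
  ne₂ : φ₂ π₁ ≠ 0
  mul_π : π₁ * π₂ = p
  ν_π₁ : ν π₁ = p
  ν_θ : ν θ = 2
  coe_ν : ∀ r, (ν r : R) = r * conj r
  mul_φ : ∀ r, φ₁ r * φ₂ r = ν r
  ν_unit : ∀ r, IsUnit r → ν r = 1
  inert : InertAt (Int.castRingHom R) conj (Int.castRingHom (ZMod q)) q
  isUnit_ε : IsUnit ε
  nonsquare_ε : ¬ IsSquare (φ₁ ε)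
  nonsquare_ε₂ : ¬ IsSquare (φ₂ ε)

namespace Zsqrtd

variable {d : ℤ}

lemma ker_star {l : ℕ} {φ : ℤ√d →+* ZMod l} {a : ℤ√d} (h : ∀ r, φ r = 0 ↔ a ∣ r) (r : ℤ√d) :
    (φ.comp (starRingEnd (ℤ√d))) r = 0 ↔ star a ∣ r := by
  rw [RingHom.comp_apply, h, starRingEnd_apply]
  constructor
  · rintro ⟨c, hc⟩
    exact ⟨star c, by rw [← star_mul', ← hc, star_star]⟩
  · rintro ⟨c, rfl⟩
    exact ⟨star c, by rw [star_mul', star_star]⟩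

lemma mul_residueMap {l : ℕ} (φ : ℤ√d →+* ZMod l) (r : ℤ√d) :
    φ r * (φ.comp (starRingEnd (ℤ√d))) r = norm r := by
  rw [RingHom.comp_apply, starRingEnd_apply, ← map_mul, ← norm_eq_mul_conj, map_intCast]

lemma residueMap_star_ne (hd : d = -1 ∨ d = -2 ∨ d = 2) {l : ℕ} (hl : l.Prime) (hl2 : l ≠ 2)
    {φ : ℤ√d →+* ZMod l} {a : ℤ√d} (ha : (norm a).natAbs = l) (h : φ a = 0) : φ (star a) ≠ 0 := by
  have : Fact l.Prime := ⟨hl⟩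
  intro h'
  have h1 : ((2 * a.re : ℤ) : ZMod l) = 0 := by
    have : ((2 * a.re : ℤ) : ℤ√d) = a + star a := by
      ext
      · simp; ring
      · simp
    rw [← map_intCast φ, this, map_add, h, h', add_zero]
  have hre : (l : ℤ) ∣ a.re := by
    rw [ZMod.intCast_zmod_eq_zero_iff_dvd] at h1
    refine ((Nat.prime_iff_prime_int.1 hl).dvd_or_dvd h1).resolve_left fun h2 => hl2 ?_
    exact (Nat.prime_dvd_prime_iff_eq hl Nat.prime_two).1 (by exact_mod_cast h2)
  have hnorm : (l : ℤ) ∣ norm a := Int.natCast_dvd.2 (by rw [ha])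
  have h2 : (l : ℤ) ∣ d * a.im * a.im := by
    have := norm_def a
    rw [show d * a.im * a.im = a.re * a.re - norm a by rw [this]; ring]
    exact dvd_sub (hre.mul_right _) hnorm
  have h3 : ((l : ℤ) * l : ℤ) ∣ norm a ∨ (l : ℤ) ∣ d := by
    rcases (Nat.prime_iff_prime_int.1 hl).dvd_or_dvd h2 with h3 | h3
    · rcases (Nat.prime_iff_prime_int.1 hl).dvd_or_dvd h3 with h4 | h4
      · exact .inr h4
      · left
        obtain ⟨u, hu⟩ := hre
        obtain ⟨v, hv⟩ := h4
        exact ⟨u * u - d * v * v, by rw [norm_def, hu, hv]; ring⟩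
    · left
      obtain ⟨u, hu⟩ := hre
      obtain ⟨v, hv⟩ := h3
      exact ⟨u * u - d * v * v, by rw [norm_def, hu, hv]; ring⟩
  rcases h3 with h3 | h3
  · rw [← Int.natAbs_dvd_natAbs, ha, Int.natAbs_mul, Int.natAbs_natCast] at h3
    have := Nat.le_of_dvd hl.pos h3
    nlinarith [hl.two_le]
  · have h4 : l ∣ 2 := by
      rw [← Int.natAbs_dvd_natAbs, Int.natAbs_natCast] at h3
      rcases hd with rfl | rfl | rfl
      · exact h3.trans (by norm_num)
      · exact h3
      · exact h3
    exact hl2 ((Nat.prime_dvd_prime_iff_eq hl Nat.prime_two).1 h4)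

lemma inertAt {q : ℕ} (hq : q.Prime) (hdq : ¬ IsSquare (d : ZMod q)) :
    InertAt (Int.castRingHom (ℤ√d)) (starRingEnd (ℤ√d)) (Int.castRingHom (ZMod q)) (q : ℤ) := by
  have : Fact q.Prime := ⟨hq⟩
  refine InertAt.of_nonsquare (ω := sqrtd) (t := 0) (n := -d)
    (fun r => ZMod.intCast_zmod_eq_zero_iff_dvd _ _) ?_ ?_ ?_ ?_ ?_ ?_
  · rw [isUnit_iff_norm_isUnit]
    simp only [eq_intCast, norm_intCast]
    intro h
    exact (Nat.prime_iff_prime_int.1 hq).not_isUnit (isUnit_of_mul_isUnit_left h)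
  · intro r
    rw [starRingEnd_apply]
    ext <;> simp
  · rw [starRingEnd_apply]
    ext <;> simp
  · rw [sq, dmuld]
    simp
  · intro x
    exact ⟨x.re, x.im, by ext <;> simp⟩
  · rintro ⟨x, hx⟩
    have h4 : (4 : ZMod q) ≠ 0 := by
      intro h
      rw [eq_intCast] at hx
      push_cast at hx
      have h2 : (2 : ZMod q) = 0 := by
        have : (2 : ZMod q) * 2 = 0 := by rw [← h]; norm_num
        simpa using this
      have hsq : ∀ y : ZMod q, IsSquare y := by
        have hq2 : q = 2 := by
          have : ((2 : ℕ) : ZMod q) = 0 := by exact_mod_cast h2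
          rw [ZMod.natCast_eq_zero_iff] at this
          exact (Nat.prime_dvd_prime_iff_eq hq Nat.prime_two).1 this
        subst hq2
        exact FiniteField.isSquare_of_char_two (ZMod.ringChar_zmod_n 2)
      exact hdq (hsq _)
    apply hdq
    have h2 : (2 : ZMod q) ≠ 0 := fun h2 =>
      h4 (by rw [show (4 : ZMod q) = 2 * 2 by norm_num, h2, mul_zero])
    refine ⟨x / 2, ?_⟩
    rw [eq_intCast] at hx
    push_cast at hx
    field_simp
    linear_combination hx

end Zsqrtd

lemma InertAt.congr {R R' : Type*} [CommRing R] [CommRing R'] (ψ : R ≃+* R') {q : ℕ} {s : R →+* R}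
    (h : InertAt (Int.castRingHom R) s (Int.castRingHom (ZMod q)) (q : ℤ)) :
    InertAt (Int.castRingHom R') ((ψ : R →+* R').comp (s.comp (ψ.symm : R' →+* R)))
      (Int.castRingHom (ZMod q)) (q : ℤ) := by
  refine ⟨?_, ?_, h.ker, ?_, ?_⟩
  · simp
  · intro x
    obtain ⟨n, hn⟩ := h.norm (ψ.symm x)
    refine ⟨n, ψ.symm.injective ?_⟩
    simpa using hn
  · intro hu
    exact h.not_isUnit (by simpa using hu.map ψ.symm)
  · intro x hx
    have h1 := map_dvd ψ.symm hx
    have h2 := h.dvd_of_norm (ψ.symm x) (by simpa using h1)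
    simpa using map_dvd ψ h2

open Zsqrtd in
theorem BaseData.exists_of_equiv {R : Type*} [CommRing R] {d : ℤ} (hd : d = -1 ∨ d = -2)
    (ψ : ℤ√d ≃+* R) {p q : ℕ} (hp : p.Prime) (hp2 : p ≠ 2) (hq : q.Prime)
    (hdp : IsSquare (d : ZMod p)) (hdq : ¬ IsSquare (d : ZMod q)) {θ ε : ℤ√d} (hθ : norm θ = 2)
    (hε : norm ε = 1) (hεp : ∀ φ : ℤ√d →+* ZMod p, ¬ IsSquare (φ ε)) :
    ∃ B : BaseData R p q, B.θ = ψ θ ∧ B.ε = ψ ε ∧ ∀ x, B.ν (ψ x) = norm x := by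
  have hd' : d = -1 ∨ d = -2 ∨ d = 2 := by tauto
  have hd0 : d ≤ 0 := by omega
  obtain ⟨n, hn⟩ := hdp
  obtain ⟨n, rfl⟩ := ZMod.intCast_surjective n
  obtain ⟨a, ha⟩ := exists_natAbs_norm_eq hd' hp (n := n) (by
    rw [← ZMod.intCast_zmod_eq_zero_iff_dvd]
    push_cast
    rw [hn]
    ring)
  have ha' : norm a = p := by rw [← ha]; exact (Int.natAbs_of_nonneg (norm_nonneg hd0 a)).symm
  obtain ⟨φ, hφ⟩ := exists_residueMap hd' hp ha
  obtain ⟨φθ, hφθ⟩ := exists_residueMap hd' Nat.prime_two (a := θ) (by rw [hθ]; rfl)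
  have hφa : φ a = 0 := (hφ a).2 dvd_rfl
  have hne := residueMap_star_ne hd' hp hp2 ha hφa
  have hdvd : ∀ a r, a ∣ ψ.symm r ↔ ψ a ∣ r := fun a r => by
    rw [← map_dvd_iff ψ, ψ.apply_symm_apply]
  exact ⟨{
    π₁ := ψ a
    π₂ := ψ (star a)
    θ := ψ θ
    ε := ψ ε
    φ₁ := φ.comp (ψ.symm : R →+* ℤ√d)
    φ₂ := (φ.comp (starRingEnd (ℤ√d))).comp (ψ.symm : R →+* ℤ√d)
    φθ := φθ.comp (ψ.symm : R →+* ℤ√d)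
    ν := normMonoidHom.comp (ψ.symm : R →* ℤ√d)
    conj := ψ.symm.trans ((starRingAut : RingAut (ℤ√d)).trans ψ)
    ker₁ := fun r => (hφ _).trans (hdvd _ _)
    ker₂ := fun r => (ker_star hφ _).trans (hdvd _ _)
    kerθ := fun r => (hφθ _).trans (hdvd _ _)
    ne₁ := by simpa using hne
    ne₂ := by simpa [starRingEnd_apply] using hne
    mul_π := by rw [← map_mul, ← norm_eq_mul_conj, ha']; simp
    ν_π₁ := by simpa [normMonoidHom] using ha'
    ν_θ := by simpa [normMonoidHom] using hθ
    coe_ν := fun r => by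
      apply ψ.symm.injective
      simp [normMonoidHom, norm_eq_mul_conj]
    mul_φ := fun r => mul_residueMap φ _
    ν_unit := fun r hr => (norm_eq_one_iff' hd0 _).2 (hr.map ψ.symm)
    inert := InertAt.congr ψ (inertAt hq hdq)
    isUnit_ε := ((norm_eq_one_iff' hd0 _).1 hε).map ψ
    nonsquare_ε := by simpa using hεp φ
    nonsquare_ε₂ := by simpa using hεp (φ.comp (starRingEnd (ℤ√d))) },
    rfl, rfl, fun x => by simp [normMonoidHom]⟩

end

/-- If the `2`-torsion of a finite abelian group meets the squares trivially, then an odd power of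
every element is `2`-torsion. -/
lemma exists_odd_pow_mem {C : Type*} [CommGroup C] [Finite C] (T : Finset C)
    (hT : ∀ x ∈ T, x ^ 2 = 1) (hcard : Nat.card (powMonoidHom 2 : C →* C).ker ≤ T.card)
    (hsq : ∀ x ∈ T, x ≠ 1 → ∀ c, x ≠ c ^ 2) : ∃ m, Odd m ∧ ∀ c : C, c ^ m ∈ T := by
  have hker : ∀ x : C, x ^ 2 = 1 → x ∈ T := by
    intro x hx
    have h1 : (T : Set C) ⊆ ((powMonoidHom 2 : C →* C).ker : Set C) := fun y hy => hT y hy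
    have h2 := Set.eq_of_subset_of_ncard_le h1 (by
      rw [Set.ncard_coe_finset]
      exact hcard) (Set.toFinite _)
    have h3 : x ∈ ((powMonoidHom 2 : C →* C).ker : Set C) := hx
    rw [← h2] at h3
    exact h3
  have hpow : ∀ (k : ℕ) (x : C), x ^ 2 ^ (k + 1) = 1 → x ^ 2 = 1 := by
    intro k
    induction k with
    | zero => intro x hx; simpa using hx
    | succ k ih =>
      intro x hx
      apply ih
      by_contra hne
      have h1 : (x ^ 2 ^ (k + 1)) ^ 2 = 1 := by rw [← pow_mul, ← pow_succ, hx]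
      exact hsq _ (hker _ h1) hne (x ^ 2 ^ k) (by rw [← pow_mul, ← pow_succ])
  obtain ⟨k, m, hm, hkm⟩ := Nat.exists_eq_two_pow_mul_odd (n := Nat.card C) Nat.card_pos.ne'
  refine ⟨m, hm, fun c => hker _ (hpow k _ ?_)⟩
  rw [← pow_mul, pow_succ, mul_comm m, mul_right_comm, ← hkm, pow_mul, pow_card_eq_one', one_pow]

namespace BaseData

set_option linter.unusedSectionVars false

variable {R S : Type*} [CommRing R] {p q : ℕ} [Fact p.Prime]

lemma isSquare_of_dvd {π : R} {φ : R →+* ZMod p} (hφ : ∀ r, φ r = 0 ↔ π ∣ r) {x z a : R}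
    (hz : ¬ π ∣ z) (h : π ∣ x ^ 2 - a * z ^ 2) : IsSquare (φ a) := by
  rw [← hφ] at h hz
  refine ⟨φ x / φ z, ?_⟩
  simp only [map_sub, map_mul, map_pow] at h
  field_simp
  linear_combination -h

lemma prime_of_ker {π : R} {φ : R →+* ZMod p} (hφ : ∀ r, φ r = 0 ↔ π ∣ r) (h0 : π ≠ 0) :
    Prime π := by
  refine ⟨h0, fun hu => ?_, fun a b hab => ?_⟩
  · have := (hφ 1).2 hu.dvd
    rw [map_one] at this
    exact one_ne_zero this
  · rw [← hφ, map_mul, mul_eq_zero, hφ, hφ] at hab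
    exact hab

variable [Fact q.Prime] [CharZero R] (B : BaseData R p q)

lemma π_ne : B.π₁ ≠ 0 ∧ B.π₂ ≠ 0 := by
  have : B.π₁ * B.π₂ ≠ 0 := by
    rw [B.mul_π]
    exact_mod_cast (Fact.out : p.Prime).ne_zero
  exact ⟨left_ne_zero_of_mul this, right_ne_zero_of_mul this⟩

lemma prime₁ : Prime B.π₁ := prime_of_ker B.ker₁ B.π_ne.1

lemma prime₂ : Prime B.π₂ := prime_of_ker B.ker₂ B.π_ne.2

lemma primeθ : Prime B.θ := by
  refine prime_of_ker B.kerθ fun h0 => ?_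
  have := B.coe_ν B.θ
  rw [B.ν_θ, h0, zero_mul] at this
  exact two_ne_zero (by exact_mod_cast this : (2 : R) = 0)

lemma prime_q (B : BaseData R p q) : Prime (q : R) := by
  have := B.inert.prime (by simpa using (Fact.out : q.Prime).ne_zero)
  simpa using this

/-- The discriminant hypothesis: `D` is `π₁ π₂ q` times a number prime to it. -/
structure IsDisc (D w : R) : Prop where
  eq : D = w * (B.π₁ * B.π₂ * q)
  ne₁ : B.φ₁ w ≠ 0
  ne₂ : B.φ₂ w ≠ 0
  not_dvd : ¬ (q : R) ∣ w

variable {B} {D w : R}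

lemma φ₁_q (hpq : p ≠ q) (B : BaseData R p q) : B.φ₁ (q : R) ≠ 0 ∧ B.φ₂ (q : R) ≠ 0 := by
  have : (q : ZMod p) ≠ 0 := by
    rw [Ne, ZMod.natCast_eq_zero_iff, Nat.prime_dvd_prime_iff_eq Fact.out Fact.out]
    exact hpq
  exact ⟨by simpa using this, by simpa using this⟩

lemma not_q_dvd (hpq : p ≠ q) (B : BaseData R p q) : ¬ (q : R) ∣ B.π₁ * B.π₂ := by
  rw [B.mul_π]
  intro h
  have := B.inert.dvd (r := (p : ℤ)) (by simpa using h)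
  rw [eq_intCast, Int.cast_natCast, ZMod.natCast_eq_zero_iff,
    Nat.prime_dvd_prime_iff_eq Fact.out Fact.out] at this
  exact hpq this.symm

variable [IsDomain R]

lemma IsDisc.not_sq_dvd₁ (hpq : p ≠ q) (h : B.IsDisc D w) : ¬ B.π₁ ^ 2 ∣ D := by
  rw [h.eq, show w * (B.π₁ * B.π₂ * q) = B.π₁ * (w * B.π₂ * q) by ring, sq,
    mul_dvd_mul_iff_left B.π_ne.1, ← B.ker₁, map_mul, map_mul]
  exact mul_ne_zero (mul_ne_zero h.ne₁ B.ne₁) (φ₁_q hpq B).1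

lemma IsDisc.not_sq_dvd₂ (hpq : p ≠ q) (h : B.IsDisc D w) : ¬ B.π₂ ^ 2 ∣ D := by
  rw [h.eq, show w * (B.π₁ * B.π₂ * q) = B.π₂ * (w * B.π₁ * q) by ring, sq,
    mul_dvd_mul_iff_left B.π_ne.2, ← B.ker₂, map_mul, map_mul]
  exact mul_ne_zero (mul_ne_zero h.ne₂ B.ne₂) (φ₁_q hpq B).2

lemma IsDisc.not_sq_dvd_q (hpq : p ≠ q) (h : B.IsDisc D w) : ¬ (q : R) ^ 2 ∣ D := by
  rw [h.eq, show w * (B.π₁ * B.π₂ * q) = q * (w * (B.π₁ * B.π₂)) by ring, sq,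
    mul_dvd_mul_iff_left B.prime_q.ne_zero]
  intro hd
  exact (B.prime_q.dvd_or_dvd hd).elim h.not_dvd (not_q_dvd hpq B)

lemma IsDisc.dvd₁ (h : B.IsDisc D w) : B.π₁ ∣ D := ⟨w * B.π₂ * q, by rw [h.eq]; ring⟩

lemma IsDisc.dvd₂ (h : B.IsDisc D w) : B.π₂ ∣ D := ⟨w * B.π₁ * q, by rw [h.eq]; ring⟩

lemma IsDisc.dvd_q (h : B.IsDisc D w) : (q : R) ∣ D := ⟨w * (B.π₁ * B.π₂), by rw [h.eq]; ring⟩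

lemma IsDisc.ne_zero (h : B.IsDisc D w) : 2 * D ≠ 0 := by
  rw [h.eq]
  refine mul_ne_zero two_ne_zero (mul_ne_zero ?_ (mul_ne_zero (mul_ne_zero B.π_ne.1 B.π_ne.2)
    B.prime_q.ne_zero))
  rintro rfl
  exact h.ne₁ (map_zero _)

variable [IsPrincipalIdealRing R] [CommRing S] [Algebra R S] [IsDedekindDomain S]
  {s : S ≃ₐ[R] S} {e : S}

lemma not_norm_ε (hpq : p ≠ q) (h : QuadConj R s) (hD : B.IsDisc D w)
    (he : e ^ 2 = algebraMap R S D) (hs : s e = -e) {x y : S} (hy : y ≠ 0) :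
    x * s x ≠ algebraMap R S B.ε * (y * s y) := by
  intro hxy
  obtain ⟨x, y, z, hz, h1⟩ := h.exists_sq_sub_of_norm he hs hD.ne_zero hy hxy
  obtain ⟨x, z, hz, h2⟩ := exists_not_dvd_of_sq_sub B.prime₁ hD.dvd₁ (hD.not_sq_dvd₁ hpq) hz h1
  exact B.nonsquare_ε (isSquare_of_dvd B.ker₁ hz h2)

lemma isSquare_ν_of_isSquare (hpq : p ≠ q) (h : QuadConj R s) (hD : B.IsDisc D w)
    (he : e ^ 2 = algebraMap R S D) (hs : s e = -e) {I : Ideal S} (hI : I ≠ ⊥) {a : R}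
    (hIa : I ^ 2 = Ideal.span {algebraMap R S a}) {c : ClassGroup S} (hc : idealClass I = c ^ 2) :
    IsSquare (B.ν a : ZMod p) ∧ IsSquare (B.ν a : ZMod q) := by
  obtain ⟨u, x, y, z, hz, h1⟩ := h.exists_sq_sub_of_isSquare he hs hD.ne_zero hI
    (by rw [QuadConj.map_eq_of_sq hIa, ← sq, hIa]) hc
  have hν : B.ν (u * a) = B.ν a := by rw [map_mul, B.ν_unit _ u.isUnit, one_mul]
  obtain ⟨x₁, z₁, hz₁, h₁⟩ :=
    exists_not_dvd_of_sq_sub B.prime₁ hD.dvd₁ (hD.not_sq_dvd₁ hpq) hz h1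
  obtain ⟨x₂, z₂, hz₂, h₂⟩ :=
    exists_not_dvd_of_sq_sub B.prime₂ hD.dvd₂ (hD.not_sq_dvd₂ hpq) hz h1
  obtain ⟨x₃, z₃, hz₃, h₃⟩ :=
    exists_not_dvd_of_sq_sub B.prime_q hD.dvd_q (hD.not_sq_dvd_q hpq) hz h1
  constructor
  · rw [← hν, ← B.mul_φ]
    exact (isSquare_of_dvd B.ker₁ hz₁ h₁).mul (isSquare_of_dvd B.ker₂ hz₂ h₂)
  · rw [← hν]
    exact B.inert.isSquare (x := x₃) (z := z₃) (w := u * a) (by simpa using hz₃)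
      (by simpa using h₃) (B.coe_ν _)

end BaseData

lemma exists_odd_pow_eq {C : Type*} [CommGroup C] [Finite C] {x : C} (hx : x ^ 2 = 1)
    (hcard : Nat.card (powMonoidHom 2 : C →* C).ker ≤ 2) (hxs : ∀ c, x ≠ c ^ 2) :
    ∃ m, Odd m ∧ ∀ c : C, c ^ m = 1 ∨ c ^ m = x := by
  classical
  have hx1 : 1 ≠ x := fun h => hxs 1 (by rw [← h, one_pow])
  have := exists_odd_pow_mem {1, x} (by simp [hx]) (by rwa [Finset.card_pair hx1])
    (by simp [hxs])
  simpa using this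

lemma exists_odd_pow_eq' {C : Type*} [CommGroup C] [Finite C] {x y : C} (hx : x ^ 2 = 1)
    (hy : y ^ 2 = 1) (hcard : Nat.card (powMonoidHom 2 : C →* C).ker ≤ 4)
    (hxs : ∀ c, x ≠ c ^ 2) (hys : ∀ c, y ≠ c ^ 2) (hxys : ∀ c, x * y ≠ c ^ 2) :
    ∃ m, Odd m ∧ ∀ c : C, c ^ m = 1 ∨ c ^ m = x ∨ c ^ m = y ∨ c ^ m = x * y := by
  classical
  have h1 : ∀ {a : C}, (∀ c, a ≠ c ^ 2) → a ≠ 1 := fun h h' => h 1 (by rw [h', one_pow])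
  have hxy : x ≠ y := by
    rintro rfl
    exact h1 hxys (by rw [← sq, hx])
  have := exists_odd_pow_mem {1, x, y, x * y} (by simp [hx, hy, mul_pow]) (by
    rw [Finset.card_insert_of_notMem, Finset.card_insert_of_notMem, Finset.card_pair]
    · exact hcard
    · simpa using h1 hxs
    · simpa [hxy] using h1 hys
    · simpa [eq_comm] using ⟨h1 hxs, h1 hys, h1 hxys⟩)
    (by simp [hxs, hys, hxys])
  simpa using this

lemma idealClass_sq_eq_one {R S : Type*} [CommRing R] [CommRing S] [Algebra R S]
    [IsDedekindDomain S] (hinj : Function.Injective (algebraMap R S)) {I : Ideal S} {a : R}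
    (ha : a ≠ 0) (hI : I ^ 2 = Ideal.span {algebraMap R S a}) : I ≠ ⊥ ∧ idealClass I ^ 2 = 1 := by
  have ha' : algebraMap R S a ≠ 0 := (map_ne_zero_iff _ hinj).2 ha
  have h0 : I ≠ ⊥ := by
    rintro rfl
    rw [Ideal.bot_pow two_ne_zero, eq_comm, Ideal.span_singleton_eq_bot] at hI
    exact ha' hI
  exact ⟨h0, by rw [← idealClass_pow h0, hI, idealClass_span ha']⟩

namespace QuadConj

variable {R S : Type*} [CommRing R] [IsDomain R] [IsPrincipalIdealRing R] [CommRing S] [Algebra R S]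

lemma span_sq_of_prime {π D : R} {e : S} (hπ : Prime π) (hD : π ∣ D) (hD2 : ¬ π ^ 2 ∣ D)
    (he : e ^ 2 = algebraMap R S D) :
    Ideal.span {algebraMap R S π, e} ^ 2 = Ideal.span {algebraMap R S π} := by
  obtain ⟨c, rfl⟩ := hD
  rw [sq, mul_dvd_mul_iff_left hπ.ne_zero, ← hπ.irreducible.coprime_iff_not_dvd] at hD2
  refine Ideal.span_pair_sq (b := 0) (c := algebraMap R S c) ?_ ?_
  · rw [he, zero_mul, zero_add, map_mul]
  · exact hD2.map (algebraMap R S)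

end QuadConj

namespace BaseData

variable {R S : Type*} [CommRing R] [IsDomain R] [IsPrincipalIdealRing R] [CharZero R]
  {p q : ℕ} [Fact p.Prime] [Fact q.Prime] {B : BaseData R p q} {D w : R}
  [CommRing S] [Algebra R S] [IsDedekindDomain S] {s : S ≃ₐ[R] S} {e : S}

/-- The class group when exactly the primes `π₁`, `π₂`, `q` ramify. -/
theorem exists_odd_pow_of_three [Finite (ClassGroup S)] (hpq : p ≠ q) (h : QuadConj R s)
    (hD : B.IsDisc D w) (hw : IsUnit w) (he : e ^ 2 = algebraMap R S D) (hs : s e = -e) {z : S}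
    (hz : z - s z = e) (hpq' : ¬ IsSquare (p : ZMod q))
    (hfin : (QuadConj.unitNorm s).range.relIndex (QuadConj.unitQuot s).ker ≠ 0)
    (hherb : 2 * (QuadConj.unitNorm s).range.relIndex (QuadConj.unitQuot s).ker ≤
      (QuadConj.unitQuot s).range.relIndex (QuadConj.unitNorm s).ker) :
    ∃ m, Odd m ∧ ∀ c : ClassGroup S,
      c ^ m = 1 ∨ c ^ m = idealClass (Ideal.span {algebraMap R S B.π₁, e}) := by
  have h₁ := QuadConj.span_sq_of_prime B.prime₁ hD.dvd₁ (hD.not_sq_dvd₁ hpq) he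
  have h₂ := QuadConj.span_sq_of_prime B.prime₂ hD.dvd₂ (hD.not_sq_dvd₂ hpq) he
  have h₃ := QuadConj.span_sq_of_prime B.prime_q hD.dvd_q (hD.not_sq_dvd_q hpq) he
  obtain ⟨h₁0, h₁1⟩ := idealClass_sq_eq_one h.inj B.π_ne.1 h₁
  refine exists_odd_pow_eq h₁1 ?_ ?_
  · have := h.four_mul_card_le (π := ![B.π₁, B.π₂, (q : R)])
      (P := ![Ideal.span {algebraMap R S B.π₁, e}, Ideal.span {algebraMap R S B.π₂, e},
        Ideal.span {algebraMap R S q, e}]) (z := z)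
      (by simp [Fin.forall_fin_succ, B.prime₁, B.prime₂, B.prime_q])
      (by simpa [Fin.forall_fin_succ] using ⟨h₁, h₂, by simpa using h₃⟩) ?_
      (B.isUnit_ε.map (algebraMap R S)).unit (by simp)
      (fun x y hy => not_norm_ε hpq h hD he hs hy) hfin hherb
    · rw [Fintype.card_fin] at this
      omega
    · intro Q hQ hmem
      rw [hz] at hmem
      have h1 := Q.pow_mem_of_mem hmem 2 two_pos
      rw [he, hD.eq, map_mul, map_mul, map_mul] at h1
      rcases hQ.mem_or_mem h1 with h1 | h1
      · exact absurd (Q.eq_top_of_isUnit_mem h1 (hw.map _)) hQ.ne_top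
      rcases hQ.mem_or_mem h1 with h1 | h1
      · rcases hQ.mem_or_mem h1 with h1 | h1
        exacts [⟨0, h1⟩, ⟨1, h1⟩]
      · exact ⟨2, h1⟩
  · intro c hc
    have := (isSquare_ν_of_isSquare hpq h hD he hs h₁0 h₁ hc).2
    rw [B.ν_π₁, Int.cast_natCast] at this
    exact hpq' this

/-- The class group when exactly the primes `θ`, `π₁`, `π₂`, `q` ramify. -/
theorem exists_odd_pow_of_four [Finite (ClassGroup S)] (hpq : p ≠ q) (h : QuadConj R s)
    (hD : B.IsDisc D w) (hw : w ∣ 2) (hθ : 2 ∣ B.θ ^ 2) (he : e ^ 2 = algebraMap R S D)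
    (hs : s e = -e) {v b c : S} (hv : v ^ 2 = algebraMap R S B.θ * (b * v + c))
    (hc : IsCoprime (algebraMap R S B.θ) c)
    (hpq' : ¬ IsSquare (p : ZMod q)) (h2p : ¬ IsSquare (2 : ZMod p)) (h2q : IsSquare (2 : ZMod q))
    (h2q0 : (2 : ZMod q) ≠ 0)
    (hfin : (QuadConj.unitNorm s).range.relIndex (QuadConj.unitQuot s).ker ≠ 0)
    (hherb : 2 * (QuadConj.unitNorm s).range.relIndex (QuadConj.unitQuot s).ker ≤
      (QuadConj.unitQuot s).range.relIndex (QuadConj.unitNorm s).ker) :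
    ∃ m, Odd m ∧ ∀ c : ClassGroup S,
      c ^ m = 1 ∨ c ^ m = idealClass (Ideal.span {algebraMap R S B.π₁, e}) ∨
      c ^ m = idealClass (Ideal.span {algebraMap R S B.θ, v}) ∨
      c ^ m = idealClass (Ideal.span {algebraMap R S B.π₁, e}) *
        idealClass (Ideal.span {algebraMap R S B.θ, v}) := by
  have h₁ := QuadConj.span_sq_of_prime B.prime₁ hD.dvd₁ (hD.not_sq_dvd₁ hpq) he
  have h₂ := QuadConj.span_sq_of_prime B.prime₂ hD.dvd₂ (hD.not_sq_dvd₂ hpq) he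
  have h₃ := QuadConj.span_sq_of_prime B.prime_q hD.dvd_q (hD.not_sq_dvd_q hpq) he
  have h₀ := Ideal.span_pair_sq hv hc
  obtain ⟨h₁0, h₁1⟩ := idealClass_sq_eq_one h.inj B.π_ne.1 h₁
  obtain ⟨h₀0, h₀1⟩ := idealClass_sq_eq_one h.inj B.primeθ.ne_zero h₀
  refine exists_odd_pow_eq' h₁1 h₀1 ?_ ?_ ?_ ?_
  · have := h.four_mul_card_le (π := ![B.θ, B.π₁, B.π₂, (q : R)])
      (P := ![Ideal.span {algebraMap R S B.θ, v}, Ideal.span {algebraMap R S B.π₁, e},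
        Ideal.span {algebraMap R S B.π₂, e}, Ideal.span {algebraMap R S q, e}]) (z := e)
      (by simp [Fin.forall_fin_succ, B.primeθ, B.prime₁, B.prime₂, B.prime_q])
      (by simpa [Fin.forall_fin_succ] using ⟨h₀, h₁, h₂, by simpa using h₃⟩) ?_
      (B.isUnit_ε.map (algebraMap R S)).unit (by simp)
      (fun x y hy => not_norm_ε hpq h hD he hs hy) hfin hherb
    · rw [Fintype.card_fin] at this
      omega
    · intro Q hQ hmem
      rw [hs, sub_neg_eq_add, ← two_mul] at hmem
      have h2Q : algebraMap R S 2 ∈ Q → algebraMap R S B.θ ∈ Q := by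
        intro h2
        refine hQ.mem_of_pow_mem 2 ?_
        rw [← map_pow]
        exact Q.mem_of_dvd (map_dvd _ hθ) h2
      rcases hQ.mem_or_mem hmem with hmem | hmem
      · exact ⟨0, h2Q (by rwa [map_ofNat])⟩
      have h1 := Q.pow_mem_of_mem hmem 2 two_pos
      rw [he, hD.eq, map_mul, map_mul, map_mul] at h1
      rcases hQ.mem_or_mem h1 with h1 | h1
      · exact ⟨0, h2Q (Q.mem_of_dvd (map_dvd _ hw) h1)⟩
      rcases hQ.mem_or_mem h1 with h1 | h1
      · rcases hQ.mem_or_mem h1 with h1 | h1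
        exacts [⟨1, h1⟩, ⟨2, h1⟩]
      · exact ⟨3, h1⟩
  · intro c hc
    have := (isSquare_ν_of_isSquare hpq h hD he hs h₁0 h₁ hc).2
    rw [B.ν_π₁, Int.cast_natCast] at this
    exact hpq' this
  · intro c hc
    have := (isSquare_ν_of_isSquare hpq h hD he hs h₀0 h₀ hc).1
    rw [B.ν_θ, Int.cast_ofNat] at this
    exact h2p this
  · intro c hc
    rw [← idealClass_mul h₁0 h₀0] at hc
    have := (isSquare_ν_of_isSquare hpq h hD he hs (mul_ne_zero h₁0 h₀0)
      (a := B.π₁ * B.θ) (by rw [mul_pow, h₁, h₀, Ideal.span_singleton_mul_span_singleton, map_mul])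
      hc).2
    rw [map_mul, B.ν_π₁, B.ν_θ, Int.cast_mul, Int.cast_natCast, Int.cast_ofNat] at this
    have h3 := this.div h2q
    rw [mul_div_cancel_right₀ _ h2q0] at h3
    exact hpq' h3

end BaseData

section

namespace Zsqrtd

lemma map_eq {d : ℤ} {A : Type*} [CommRing A] (f : ℤ√d →+* A) (x : ℤ√d) :
    f x = x.re + x.im * f sqrtd := by
  conv_lhs => rw [show x = (x.re : ℤ√d) + (x.im : ℤ√d) * sqrtd by ext <;> simp]
  rw [map_add, map_mul, map_intCast, map_intCast]

lemma map_star_eq {d : ℤ} {A : Type*} [CommRing A] {f : ℤ√d →+* A} {g : A →+* A}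
    (h : g (f sqrtd) = -f sqrtd) (x : ℤ√d) : g (f x) = f (star x) := by
  rw [map_eq f x, map_eq f (star x), map_add, map_mul, h, map_intCast, map_intCast]
  simp

lemma map_mul_map_eq {d : ℤ} {A : Type*} [CommRing A] {f : ℤ√d →+* A} {g : A →+* A}
    (h : g (f sqrtd) = -f sqrtd) (x : ℤ√d) : f x * g (f x) = norm x := by
  rw [map_star_eq h, ← map_mul, ← norm_eq_mul_conj, map_intCast]

/-- A totally positive unit of `ℤ[√2]` is a square. -/
lemma isSquare_of_norm_eq_one {α : ℤ√2} (hα : norm α = 1) (h0 : 0 ≤ α.re) : IsSquare α := by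
  obtain ⟨A, C⟩ := α
  simp only [norm_def] at hα h0
  obtain ⟨a, ha⟩ : Odd A := by
    have h : Odd (A * A) := ⟨C * C, by linear_combination hα⟩
    exact (Int.odd_mul.1 h).1
  obtain ⟨b, hb⟩ : Even C := by
    have h : Even (C * C) := ⟨a * (a + 1), by
      have : 2 * (C * C) = 2 * (a * (a + 1) + a * (a + 1)) := by
        rw [ha] at hα
        linear_combination -hα
      linarith⟩
    simpa [Int.even_mul] using h
  have hab : a * (a + 1) = 2 * b ^ 2 := by
    rw [ha, hb] at hα
    linarith [hα, show (2 * a + 1) * (2 * a + 1) - 2 * (b + b) * (b + b) =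
      4 * (a * (a + 1)) - 8 * b ^ 2 + 1 by ring]
  have ha0 : 0 ≤ a := by omega
  have key : ∀ x y : ℤ, 0 ≤ x → 0 ≤ y → IsCoprime x y → x * y = b ^ 2 →
      ∃ r t : ℤ, x = r ^ 2 ∧ y = t ^ 2 ∧ b = r * t := by
    intro x y hx hy hxy h
    obtain ⟨r, hr⟩ := Int.sq_of_isCoprime hxy h
    obtain ⟨t, ht⟩ := Int.sq_of_isCoprime hxy.symm (by rw [mul_comm, h])
    replace hr : x = r ^ 2 := by
      rcases hr with hr | hr
      · exact hr
      · nlinarith [sq_nonneg r]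
    replace ht : y = t ^ 2 := by
      rcases ht with ht | ht
      · exact ht
      · nlinarith [sq_nonneg t]
    rw [hr, ht, ← mul_pow, eq_comm, sq_eq_sq_iff_eq_or_eq_neg] at h
    rcases h with h | h
    · exact ⟨r, t, hr, ht, h⟩
    · exact ⟨-r, t, by rw [hr]; ring, ht, by rw [h]; ring⟩
  rcases Int.even_or_odd' a with ⟨a', h' | h'⟩
  · obtain ⟨r, t, hr, ht, hrt⟩ := key a' (a + 1) (by omega) (by omega)
      ⟨-2, 1, by rw [h']; ring⟩ (by rw [h'] at hab ⊢; linarith)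
    refine ⟨⟨t, r⟩, ?_⟩
    ext
    · simp only [re_mul]
      linarith
    · simp only [im_mul]
      linarith
  · obtain ⟨r, t, hr, ht, hrt⟩ := key a (a' + 1) (by omega) (by omega)
      ⟨-1, 2, by rw [h']; ring⟩ (by rw [h'] at hab ⊢; linarith)
    refine ⟨⟨r, t⟩, ?_⟩
    ext
    · simp only [re_mul]
      linarith
    · simp only [im_mul]
      linarith

end Zsqrtd

/-- `O` is the ring `ℤ[ζ]` with `ζ` a primitive eighth root of unity. -/
structure Zeta8 {O : Type} [CommRing O] (ζ : O) : Prop where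
  pow_four : ζ ^ 4 = -1
  coord : ∀ x : O, ∃ a b c d : ℤ, x = a + b * ζ + c * ζ ^ 2 + d * ζ ^ 3
  unique : ∀ a b c d : ℤ, (a + b * ζ + c * ζ ^ 2 + d * ζ ^ 3 : O) = 0 →
    a = 0 ∧ b = 0 ∧ c = 0 ∧ d = 0
  lift : ∀ {A : Type} [CommRing A] (y : A), y ^ 4 = -1 → ∃ f : O →+* A, f ζ = y

namespace Zeta8

open Zsqrtd

variable {O : Type} [CommRing O] {ζ : O}

lemma hom_ext (h : Zeta8 ζ) {A : Type*} [CommRing A] {f g : O →+* A} (hfg : f ζ = g ζ) : f = g := by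
  ext x
  obtain ⟨a, b, c, d, rfl⟩ := h.coord x
  simp [hfg]

lemma isUnit (h : Zeta8 ζ) : IsUnit ζ :=
  IsUnit.of_mul_eq_one (-ζ ^ 3) (by linear_combination -h.pow_four)

lemma isUnit_intCast (h : Zeta8 ζ) {n : ℤ} (hn : IsUnit (n : O)) : IsUnit n := by
  obtain ⟨y, hy⟩ := hn.exists_right_inv
  obtain ⟨a, b, c, d, rfl⟩ := h.coord y
  have := (h.unique (n * a - 1) (n * b) (n * c) (n * d) (by
    push_cast
    linear_combination hy)).1
  exact IsUnit.of_mul_eq_one a (by linarith)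

lemma exists_mul_bar (h : Zeta8 ζ) {f : ℤ√2 →+* O} (hf : f sqrtd = ζ - ζ ^ 3) {bar : O →+* O}
    (hbar : bar ζ = -ζ ^ 3) (x : O) : ∃ α, f α = x * bar x ∧ 0 ≤ α.re ∧ 0 ≤ norm α := by
  obtain ⟨a, b, c, d, rfl⟩ := h.coord x
  refine ⟨⟨a ^ 2 + b ^ 2 + c ^ 2 + d ^ 2, a * b + b * c + c * d - d * a⟩, ?_, by positivity, ?_⟩
  · rw [map_eq, hf]
    simp only [map_add, map_mul, map_pow, map_intCast, hbar]
    push_cast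
    have h4 := h.pow_four
    have h5 : ζ ^ 5 = -ζ := by linear_combination ζ * h4
    have h6 : ζ ^ 6 = -ζ ^ 2 := by linear_combination ζ ^ 2 * h4
    have h7 : ζ ^ 7 = -ζ ^ 3 := by linear_combination ζ ^ 3 * h4
    have h8 : ζ ^ 8 = 1 := by linear_combination (ζ ^ 4 - 1) * h4
    have h9 : ζ ^ 9 = ζ := by linear_combination ζ * h8
    have h10 : ζ ^ 10 = ζ ^ 2 := by linear_combination ζ ^ 2 * h8
    have h11 : ζ ^ 11 = ζ ^ 3 := by linear_combination ζ ^ 3 * h8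
    have h12 : ζ ^ 12 = -1 := by linear_combination h4 + ζ ^ 4 * h8
    ring_nf
    simp only [h4, h5, h6, h7, h8, h9, h10, h11, h12]
    ring
  · have : norm (⟨a ^ 2 + b ^ 2 + c ^ 2 + d ^ 2, a * b + b * c + c * d - d * a⟩ : ℤ√2) =
        (a ^ 2 - c ^ 2 + 2 * b * d) ^ 2 + (2 * a * c - b ^ 2 + d ^ 2) ^ 2 := by
      rw [norm_def]
      ring
    rw [this]
    positivity

lemma injective (h : Zeta8 ζ) {f : ℤ√2 →+* O} (hf : f sqrtd = ζ - ζ ^ 3) :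
    Function.Injective f := by
  rw [injective_iff_map_eq_zero]
  intro x hx
  rw [map_eq, hf] at hx
  obtain ⟨h1, h2, -⟩ := h.unique x.re x.im 0 (-x.im) (by push_cast; linear_combination hx)
  ext
  exacts [h1, h2]

lemma isSquare_of_isUnit (h : Zeta8 ζ) {f : ℤ√2 →+* O} (hf : f sqrtd = ζ - ζ ^ 3) {bar : O →+* O}
    (hbar : bar ζ = -ζ ^ 3) {u : O} (hu : IsUnit u) {α : ℤ√2} (hα : f α = u * bar u) :
    IsSquare α := by
  obtain ⟨v, huv⟩ := hu.exists_right_inv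
  obtain ⟨α', h1, h2, h3⟩ := h.exists_mul_bar hf hbar u
  obtain ⟨β, h4, -⟩ := h.exists_mul_bar hf hbar v
  obtain rfl : α' = α := h.injective hf (h1.trans hα.symm)
  have h5 : α' * β = 1 := by
    apply h.injective hf
    have := congrArg bar huv
    rw [map_mul, map_one] at this
    rw [map_mul, hα, h4, map_one]
    linear_combination u * v * this + huv
  have h6 : IsUnit (norm α') := (isUnit_iff_norm_isUnit _).1 (IsUnit.of_mul_eq_one β h5)
  exact isSquare_of_norm_eq_one ((Int.isUnit_iff.1 h6).resolve_right (by omega)) h2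

lemma not_isUnit_map (h : Zeta8 ζ) {d : ℤ} {f : ℤ√d →+* O} {g : O →+* O}
    (hg : g (f sqrtd) = -f sqrtd)
    {x : ℤ√d} (hx : ¬ IsUnit (norm x)) : ¬ IsUnit (f x) := by
  intro hu
  apply hx
  apply h.isUnit_intCast
  rw [← map_mul_map_eq hg]
  exact hu.mul (hu.map g)

end Zeta8

end

section

open Zsqrtd

/-- The arithmetic of the eighth cyclotomic field `O` over the base ring `R`. -/
structure CycData {R : Type*} [CommRing R] {p q : ℕ} (B : BaseData R p q) {O : Type} [CommRing O]
    (g : R →+* O) where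
  /-- the automorphism over `R` -/
  s : O →+* O
  /-- complex conjugation -/
  bar : O →+* O
  /-- the inclusion of the real subring -/
  f : ℤ√2 →+* O
  /-- a unit -/
  ζ : O
  /-- a prime above `q` -/
  ρ : ℤ√2
  /-- the residue map of `ρ` -/
  φ : ℤ√2 →+* ZMod q
  inert₁ : InertAt g s B.φ₁ B.π₁
  inert₂ : InertAt g s B.φ₂ B.π₂
  inj : Function.Injective f
  isUnit_ζ : IsUnit ζ
  norm_ζ : g B.ε = ζ * s ζ
  natAbs_norm_ρ : (norm ρ).natAbs = q
  inert₃ : InertAt f bar φ ρ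
  inert₄ : InertAt f bar (φ.comp (starRingEnd (ℤ√2))) (star ρ)
  bar_π : g B.π₁ * bar (g B.π₁) = p
  isSquare_unit : ∀ u α, IsUnit u → f α = u * bar u → IsSquare α
  exists_prime : ∀ r : ℕ, r.Prime → r % 8 = 1 → ∃ (χ : O →+* ZMod r) (κ : O) (α : ℤ√2),
    (∀ x, χ x = 0 ↔ κ ∣ x) ∧ f α = κ * bar κ ∧ norm α = r

namespace Zeta8

variable {O : Type} [CommRing O] {ζ : O}

lemma norm_map [IsDomain O] [Module.Free ℤ O] [Module.Finite ℤ O] (h : Zeta8 ζ) {g : O →+* O}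
    (hg : g (g ζ) = ζ) (x : O) : Algebra.norm ℤ (g x) = Algebra.norm ℤ x := by
  have hgg : g.comp g = RingHom.id O := h.hom_ext hg
  exact Algebra.norm_eq_of_algEquiv (RingEquiv.toIntAlgEquiv (RingEquiv.ofRingHom g g hgg hgg)) x

lemma exists_residue {r : ℕ} (hr : r.Prime) (hr8 : r % 8 = 1) : ∃ y : ZMod r, y ^ 4 = -1 := by
  have : Fact r.Prime := ⟨hr⟩
  have hr2 : r ≠ 2 := by rintro rfl; omega
  obtain ⟨i, hi⟩ := (ZMod.exists_sq_eq_neg_one_iff (p := r)).2 (by omega)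
  obtain ⟨t, ht⟩ := (ZMod.exists_sq_eq_two_iff hr2).2 (Or.inl hr8)
  have h2 : (2 : ZMod r) ≠ 0 := by
    intro h
    have : (r : ℕ) ∣ 2 := (ZMod.natCast_eq_zero_iff 2 r).1 (by exact_mod_cast h)
    exact hr2 ((Nat.prime_dvd_prime_iff_eq hr Nat.prime_two).1 this)
  have ht0 : t ≠ 0 := by
    rintro rfl
    exact h2 (by rw [ht, zero_mul])
  have h1 : ((1 + i) / t) ^ 2 = i := by
    field_simp
    linear_combination (-1) * hi + i * ht
  exact ⟨(1 + i) / t, by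
    rw [show 4 = 2 * 2 from rfl, pow_mul, h1]
    linear_combination -hi⟩

lemma exists_prime [IsDomain O] [IsPrincipalIdealRing O] [Module.Free ℤ O] [Module.Finite ℤ O]
    (h : Zeta8 ζ) (hfr : Module.finrank ℤ O = 4) {f : ℤ√2 →+* O} (hf : f sqrtd = ζ - ζ ^ 3)
    {bar : O →+* O} (hbar : bar ζ = -ζ ^ 3) {r : ℕ} (hr : r.Prime) (hr8 : r % 8 = 1) :
    ∃ (χ : O →+* ZMod r) (κ : O) (α : ℤ√2),
      (∀ x, χ x = 0 ↔ κ ∣ x) ∧ f α = κ * bar κ ∧ norm α = r := by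
  obtain ⟨y, hy⟩ := exists_residue hr hr8
  obtain ⟨χ, -⟩ := h.lift y hy
  obtain ⟨κ, hκ⟩ := (IsPrincipalIdealRing.principal (RingHom.ker χ)).principal
  obtain ⟨α, hα, -, hα0⟩ := h.exists_mul_bar hf hbar κ
  refine ⟨χ, κ, α, fun x => ?_, hα, ?_⟩
  · rw [← RingHom.mem_ker, hκ]
    exact Ideal.mem_span_singleton
  obtain ⟨g, hg⟩ := h.lift (ζ ^ 3) (by linear_combination (ζ ^ 8 - ζ ^ 4 + 1) * h.pow_four)
  have h4 := h.pow_four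
  have hgf : g (f sqrtd) = -f sqrtd := by
    rw [hf, map_sub, map_pow, hg]
    linear_combination (-ζ ^ 5 + ζ) * h4
  have hnκ : (Algebra.norm ℤ κ).natAbs = r := by
    rw [← Ideal.absNorm_span_singleton, Ideal.absNorm_apply, Submodule.cardQuot_apply,
      ← Ideal.submodule_span_eq, ← hκ,
      Nat.card_congr (RingHom.quotientKerEquivOfSurjective (ZMod.ringHom_surjective χ)).toEquiv,
      Nat.card_zmod]
  have h1 := congrArg (Algebra.norm ℤ) (map_mul_map_eq hgf α)
  have hbb : bar (bar ζ) = ζ := by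
    rw [hbar, map_neg, map_pow, hbar]
    linear_combination (ζ ^ 5 - ζ) * h4
  have hgg : g (g ζ) = ζ := by
    rw [hg, map_pow, hg]
    linear_combination (ζ ^ 5 - ζ) * h4
  rw [hα, map_mul g, map_mul, map_mul, map_mul, h.norm_map hgg, h.norm_map hgg, h.norm_map hbb,
    ← eq_intCast (algebraMap ℤ O), Algebra.norm_algebraMap, hfr] at h1
  have h2 : norm α ^ 4 = (r : ℤ) ^ 4 := by
    rw [← h1, ← hnκ, Int.natCast_natAbs, Even.pow_abs ⟨2, rfl⟩]
    ring
  exact (pow_left_inj₀ hα0 (Int.natCast_nonneg r) (by norm_num)).1 h2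

lemma inertAt_sqrtTwo (h : Zeta8 ζ) {q : ℕ} [Fact q.Prime] {f : ℤ√2 →+* O}
    (hf : f sqrtd = ζ - ζ ^ 3) {bar : O →+* O} (hbar : bar ζ = -ζ ^ 3) {ρ : ℤ√2}
    {φ : ℤ√2 →+* ZMod q} (hφ : ∀ r, φ r = 0 ↔ ρ ∣ r) (hρ : (norm ρ).natAbs = q)
    (hq : ¬ IsSquare (-2 : ZMod q)) : InertAt f bar φ ρ := by
  have h4 := h.pow_four
  obtain ⟨g, hg⟩ := h.lift (ζ ^ 3) (by linear_combination (ζ ^ 8 - ζ ^ 4 + 1) * h.pow_four)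
  have hgf : g (f sqrtd) = -f sqrtd := by
    rw [hf, map_sub, map_pow, hg]
    linear_combination (-ζ ^ 5 + ζ) * h4
  have hbf : bar (f sqrtd) = f sqrtd := by
    rw [hf, map_sub, map_pow, hbar]
    linear_combination (ζ ^ 5 - ζ) * h4
  refine InertAt.of_nonsquare (ω := ζ) (t := sqrtd) (n := 1) hφ ?_ ?_ ?_ ?_ ?_ ?_
  · refine h.not_isUnit_map hgf ?_
    rw [Int.isUnit_iff_natAbs_eq, hρ]
    exact (Fact.out : q.Prime).ne_one
  · intro r
    rw [map_eq f r, map_add, map_mul, map_intCast, map_intCast, hbf]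
  · rw [hbar, hf]
    ring
  · rw [hf, map_one]
    linear_combination h4
  · intro x
    obtain ⟨a, b, c, d, rfl⟩ := h.coord x
    refine ⟨⟨a - c, -d⟩, ⟨b + d, c⟩, ?_⟩
    rw [map_eq f ⟨a - c, -d⟩, map_eq f ⟨b + d, c⟩, hf]
    push_cast
    linear_combination c * h4
  · have : (sqrtd ^ 2 - 4 * 1 : ℤ√2) = ((-2 : ℤ) : ℤ√2) := by
      ext <;> simp [sq]
    rw [this, map_intCast]
    simpa using hq

theorem exists_cycData [IsDomain O] [IsPrincipalIdealRing O] [Module.Free ℤ O] [Module.Finite ℤ O]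
    (h : Zeta8 ζ) (hfr : Module.finrank ℤ O = 4) {R : Type*} [CommRing R] {p q : ℕ} [Fact p.Prime]
    [Fact q.Prime] (B : BaseData R p q) {g : R →+* O} {s bar : O →+* O} {t : R}
    (hs : s ζ = g t - ζ) (hsg : ∀ r, s (g r) = g r) (hζ : ζ ^ 2 = g t * ζ - g B.ε)
    (hspan : ∀ x, ∃ a b, x = g a + g b * ζ) (h₁ : ¬ IsSquare (B.φ₁ (t ^ 2 - 4 * B.ε)))
    (h₂ : ¬ IsSquare (B.φ₂ (t ^ 2 - 4 * B.ε))) (hbar : bar ζ = -ζ ^ 3)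
    (hπ : g B.π₁ * bar (g B.π₁) = p) (h2q : IsSquare (2 : ZMod q))
    (hq : ¬ IsSquare (-2 : ZMod q)) : Nonempty (CycData B g) := by
  have h4 := h.pow_four
  obtain ⟨f, hf⟩ : ∃ f : ℤ√2 →+* O, f sqrtd = ζ - ζ ^ 3 :=
    ⟨Zsqrtd.lift ⟨ζ - ζ ^ 3, by push_cast; linear_combination (ζ ^ 2 - 2) * h4⟩, by simp⟩
  obtain ⟨n, hn⟩ := h2q
  obtain ⟨n, rfl⟩ := ZMod.intCast_surjective n
  have hd : (2 : ℤ) = -1 ∨ (2 : ℤ) = -2 ∨ (2 : ℤ) = 2 := by tauto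
  obtain ⟨ρ, hρ⟩ := exists_natAbs_norm_eq hd (Fact.out : q.Prime) (n := n) (by
    rw [← ZMod.intCast_zmod_eq_zero_iff_dvd]
    push_cast
    rw [hn]
    ring)
  obtain ⟨φ, hφ⟩ := exists_residueMap hd Fact.out hρ
  have hp1 : ¬ IsUnit (p : O) := fun hu => (Nat.prime_iff_prime_int.1
    (Fact.out : p.Prime)).not_isUnit (h.isUnit_intCast (by simpa using hu))
  have hπ₁ : ¬ IsUnit (g B.π₁) := fun hu => hp1 (hπ ▸ hu.mul (hu.map bar))
  have hπ₂ : ¬ IsUnit (g B.π₂) := by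
    intro hu
    apply hπ₁
    have h1 : Associated (g B.π₁) (p : O) := ⟨hu.unit, by
      rw [IsUnit.unit_spec, ← map_mul, B.mul_π, map_natCast]⟩
    have h2 : Associated (bar (g B.π₁)) (p : O) := by
      have := h1.map bar
      rwa [map_natCast] at this
    have hp0 : (p : O) ≠ 0 := by
      intro h0
      have := (h.unique p 0 0 0 (by simpa using h0)).1
      exact (Fact.out : p.Prime).ne_zero (by exact_mod_cast this)
    have h3 := h1.mul_mul h2
    rw [hπ] at h3
    obtain ⟨u, hu⟩ := h3
    exact absurd (mul_left_cancel₀ hp0 hu ▸ u.isUnit) hp1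
  exact ⟨{
    s := s
    bar := bar
    f := f
    ζ := ζ
    ρ := ρ
    φ := φ
    inert₁ := InertAt.of_nonsquare B.ker₁ hπ₁ hsg hs hζ hspan h₁
    inert₂ := InertAt.of_nonsquare B.ker₂ hπ₂ hsg hs hζ hspan h₂
    inj := h.injective hf
    isUnit_ζ := h.isUnit
    norm_ζ := by rw [hs]; linear_combination hζ
    natAbs_norm_ρ := hρ
    inert₃ := h.inertAt_sqrtTwo hf hbar hφ hρ hq
    inert₄ := h.inertAt_sqrtTwo hf hbar (ker_star hφ) (by rw [norm_conj, hρ]) hq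
    bar_π := hπ
    isSquare_unit := fun u α hu hα => h.isSquare_of_isUnit hf hbar hu hα
    exists_prime := fun r hr hr8 => h.exists_prime hfr hf hbar hr hr8 }⟩

end Zeta8

end

section

open Zsqrtd

namespace Zeta8

variable {O : Type} [CommRing O] {ζ : O}

lemma exists_bar (h : Zeta8 ζ) : ∃ bar : O →+* O, bar ζ = -ζ ^ 3 :=
  h.lift _ (by linear_combination (ζ ^ 8 - ζ ^ 4 + 1) * h.pow_four)

lemma map_equiv_eq {d : ℤ} {R : Type*} [CommRing R] (ψ : ℤ√d ≃+* R) {g : R →+* O} (x : ℤ√d) :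
    g (ψ x) = x.re + x.im * g (ψ sqrtd) :=
  map_eq (g.comp (ψ : ℤ√d →+* R)) x

lemma mul_bar_eq {d : ℤ} {R : Type*} [CommRing R] (ψ : ℤ√d ≃+* R) {g : R →+* O} {bar : O →+* O}
    (hg : bar (g (ψ sqrtd)) = -g (ψ sqrtd)) {p q : ℕ} {B : BaseData R p q}
    (hν : ∀ x, B.ν (ψ x) = norm x) : g B.π₁ * bar (g B.π₁) = p := by
  obtain ⟨x, hx⟩ := ψ.surjective B.π₁
  have h1 := map_mul_map_eq (f := g.comp (ψ : ℤ√d →+* R)) (g := bar) hg x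
  rw [← hν, hx, B.ν_π₁] at h1
  simpa [hx] using h1

theorem exists_cycData_neg_one [IsDomain O] [IsPrincipalIdealRing O] [Module.Free ℤ O]
    [Module.Finite ℤ O] (h : Zeta8 ζ) (hfr : Module.finrank ℤ O = 4) {R : Type*} [CommRing R]
    {p q : ℕ} [Fact p.Prime] [Fact q.Prime] (B : BaseData R p q) {g : R →+* O}
    (ψ : ℤ√(-1) ≃+* R) (hg : g (ψ sqrtd) = ζ ^ 2) (hε : B.ε = ψ (-sqrtd))
    (hν : ∀ x, B.ν (ψ x) = norm x) (hp : IsSquare (-1 : ZMod p)) (hp2 : p ≠ 2)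
    (h2q : IsSquare (2 : ZMod q)) (hq : ¬ IsSquare (-2 : ZMod q)) : Nonempty (CycData B g) := by
  have h4 := h.pow_four
  obtain ⟨bar, hbar⟩ := h.exists_bar
  obtain ⟨s, hs⟩ := h.lift (-ζ) (by linear_combination h4)
  have key : ∀ φ : R →+* ZMod p, ¬ IsSquare (φ B.ε) → ¬ IsSquare (φ (0 ^ 2 - 4 * B.ε)) := by
    intro φ hφ hsq
    apply hφ
    have h2 : (2 : ZMod p) ≠ 0 := by
      intro h
      have : (p : ℕ) ∣ 2 := (ZMod.natCast_eq_zero_iff 2 p).1 (by exact_mod_cast h)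
      exact hp2 ((Nat.prime_dvd_prime_iff_eq Fact.out Nat.prime_two).1 this)
    have h1 := (hsq.mul hp).div (IsSquare.mul_self (2 : ZMod p))
    have h3 : φ (0 ^ 2 - 4 * B.ε) * -1 / (2 * 2) = φ B.ε := by
      rw [map_sub, map_mul, map_ofNat, map_pow, map_zero]
      field_simp
      ring
    rwa [h3] at h1
  refine h.exists_cycData hfr B (t := 0) (s := s) (by rw [hs, map_zero, zero_sub]) ?_ ?_ ?_
    (key _ B.nonsquare_ε) (key _ B.nonsquare_ε₂) hbar (mul_bar_eq ψ ?_ hν) h2q hq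
  · intro r
    obtain ⟨x, rfl⟩ := ψ.surjective r
    rw [map_equiv_eq, hg, map_add, map_mul, map_pow, hs, map_intCast, map_intCast, neg_sq]
  · rw [hε, map_neg, map_neg, hg, map_zero]
    ring
  · intro x
    obtain ⟨a, b, c, d, rfl⟩ := h.coord x
    refine ⟨ψ ⟨a, c⟩, ψ ⟨b, d⟩, ?_⟩
    rw [map_equiv_eq ψ ⟨a, c⟩, map_equiv_eq ψ ⟨b, d⟩, hg]
    push_cast
    ring
  · rw [hg, map_pow, hbar]
    linear_combination ζ ^ 2 * h4

theorem exists_cycData_neg_two [IsDomain O] [IsPrincipalIdealRing O] [Module.Free ℤ O]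
    [Module.Finite ℤ O] (h : Zeta8 ζ) (hfr : Module.finrank ℤ O = 4) {R : Type*} [CommRing R]
    {p q : ℕ} [Fact p.Prime] [Fact q.Prime] (B : BaseData R p q) {g : R →+* O}
    (ψ : ℤ√(-2) ≃+* R) (hg : g (ψ sqrtd) = ζ + ζ ^ 3) (hε : B.ε = ψ (-1))
    (hν : ∀ x, B.ν (ψ x) = norm x) (hp : ¬ IsSquare (2 : ZMod p))
    (h2q : IsSquare (2 : ZMod q)) (hq : ¬ IsSquare (-2 : ZMod q)) : Nonempty (CycData B g) := by
  have h4 := h.pow_four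
  obtain ⟨bar, hbar⟩ := h.exists_bar
  obtain ⟨s, hs⟩ := h.lift (ζ ^ 3) (by linear_combination (ζ ^ 8 - ζ ^ 4 + 1) * h4)
  have ht : ψ sqrtd ^ 2 - 4 * B.ε = 2 := by
    have : (sqrtd ^ 2 - 4 * (-1) : ℤ√(-2)) = 2 := by ext <;> simp [sq]
    rw [hε]
    have h1 := congrArg ψ this
    rwa [map_sub, map_pow, map_mul, map_ofNat, map_ofNat] at h1
  have key : ∀ φ : R →+* ZMod p, ¬ IsSquare (φ (ψ sqrtd ^ 2 - 4 * B.ε)) := by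
    intro φ
    rw [ht, map_ofNat]
    exact hp
  refine h.exists_cycData hfr B (t := ψ sqrtd) (s := s) (by rw [hs, hg]; ring) ?_ ?_ ?_
    (key _) (key _) hbar (mul_bar_eq ψ ?_ hν) h2q hq
  · intro r
    obtain ⟨x, rfl⟩ := ψ.surjective r
    rw [map_equiv_eq, hg, map_add, map_mul, map_add, map_pow, hs, map_intCast, map_intCast]
    linear_combination x.im * (ζ ^ 5 - ζ) * h4
  · rw [hε, map_neg, map_neg, hg, map_one, map_one]
    linear_combination -h4
  · intro x
    obtain ⟨a, b, c, d, rfl⟩ := h.coord x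
    refine ⟨ψ ⟨a + c, d⟩, ψ ⟨b - d, c⟩, ?_⟩
    rw [map_equiv_eq ψ ⟨a + c, d⟩, map_equiv_eq ψ ⟨b - d, c⟩, hg]
    push_cast
    linear_combination -c * h4
  · rw [hg, map_add, map_pow, hbar]
    linear_combination (-ζ ^ 5 + ζ) * h4

end Zeta8

end

section

open Zsqrtd

lemma ZMod.exists_not_isSquare (p : ℕ) [Fact p.Prime] (hp : p ≠ 2) : ∃ a : ZMod p, ¬ IsSquare a :=
  FiniteField.exists_nonsquare (by rwa [ZMod.ringChar_zmod_n])

lemma ZMod.isSquare_mul_of_not {p : ℕ} [Fact p.Prime] {a b : ZMod p} (ha : ¬ IsSquare a)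
    (hb : ¬ IsSquare b) : IsSquare (a * b) := by
  have ha0 : a ≠ 0 := by rintro rfl; exact ha (IsSquare.zero)
  have hb0 : b ≠ 0 := by rintro rfl; exact hb (IsSquare.zero)
  rw [← quadraticChar_one_iff_isSquare (mul_ne_zero ha0 hb0), map_mul,
    quadraticChar_neg_one_iff_not_isSquare.2 ha, quadraticChar_neg_one_iff_not_isSquare.2 hb]
  rfl

/-- There is a prime `r ≡ 1 mod 8` which is a nonresidue modulo `p` and modulo `q`. -/
lemma exists_prime_nonresidue (p q : ℕ) [Fact p.Prime] [Fact q.Prime] (hp : p ≠ 2) (hq : q ≠ 2)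
    (hpq : p ≠ q) : ∃ r : ℕ, r.Prime ∧ r % 8 = 1 ∧ ¬ IsSquare (r : ZMod q) ∧
      IsSquare (-1 : ZMod r) ∧ IsSquare ((p * q : ℕ) : ZMod r) ∧ ((p * q : ℕ) : ZMod r) ≠ 0 ∧
      (2 : ZMod r) ≠ 0 := by
  have hp' : p.Prime := Fact.out
  have hq' : q.Prime := Fact.out
  obtain ⟨a, ha⟩ := ZMod.exists_not_isSquare p hp
  obtain ⟨b, hb⟩ := ZMod.exists_not_isSquare q hq
  have hcop : Nat.Coprime p q := (Nat.coprime_primes hp' hq').2 hpq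
  have hcop8 : Nat.Coprime 8 (p * q) := by
    rw [show 8 = 2 ^ 3 from rfl]
    exact Nat.Coprime.pow_left 3 (Nat.Coprime.mul_right ((Nat.coprime_primes Nat.prime_two hp').2
      hp.symm) ((Nat.coprime_primes Nat.prime_two hq').2 hq.symm))
  obtain ⟨x, hxp, hxq⟩ := Nat.chineseRemainder hcop a.val b.val
  obtain ⟨y, hy8, hyx⟩ := Nat.chineseRemainder hcop8 1 x
  have hya : (y : ZMod p) = a := by
    rw [← ZMod.natCast_zmod_val a, ZMod.natCast_eq_natCast_iff]
    exact (hyx.of_mul_right q).trans hxp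
  have hyb : (y : ZMod q) = b := by
    rw [← ZMod.natCast_zmod_val b, ZMod.natCast_eq_natCast_iff]
    exact (hyx.of_mul_left p).trans hxq
  have hunit : ∀ {l : ℕ} [Fact l.Prime] {c : ZMod l}, ¬ IsSquare c → (y : ZMod l) = c →
      Nat.Coprime y l := by
    intro l _ c hc hyc
    rw [Nat.coprime_comm, Nat.Prime.coprime_iff_not_dvd Fact.out, ← ZMod.natCast_eq_zero_iff, hyc]
    rintro rfl
    exact hc IsSquare.zero
  have hcop' : Nat.Coprime y (8 * (p * q)) := by
    refine Nat.Coprime.mul_right ?_ (Nat.Coprime.mul_right (hunit ha hya) (hunit hb hyb))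
    rw [Nat.Coprime, hy8.gcd_eq, Nat.gcd_one_left]
  obtain ⟨r, -, hr, hry⟩ := Nat.forall_exists_prime_gt_and_modEq 0 (q := 8 * (p * q))
    (mul_ne_zero (by norm_num) (mul_ne_zero hp'.ne_zero hq'.ne_zero)) hcop'
  have : Fact r.Prime := ⟨hr⟩
  have hr8 : r % 8 = 1 := (hry.of_mul_right _).trans hy8
  have hrp : (r : ZMod p) = a := by
    rw [← hya, ZMod.natCast_eq_natCast_iff]
    exact (hry.of_mul_left _).of_mul_right _
  have hrq : (r : ZMod q) = b := by
    rw [← hyb, ZMod.natCast_eq_natCast_iff]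
    exact (hry.of_mul_left _).of_mul_left _
  have h1 : ¬ IsSquare (p : ZMod r) := by
    rw [ZMod.exists_sq_eq_prime_iff_of_mod_four_eq_one (by omega) hp, hrp]
    exact ha
  have h2 : ¬ IsSquare (q : ZMod r) := by
    rw [ZMod.exists_sq_eq_prime_iff_of_mod_four_eq_one (by omega) hq, hrq]
    exact hb
  refine ⟨r, hr, hr8, hrq ▸ hb, ZMod.exists_sq_eq_neg_one_iff.2 (by omega), ?_, ?_, ?_⟩
  · push_cast
    exact ZMod.isSquare_mul_of_not h1 h2
  · push_cast
    refine mul_ne_zero (fun h => h1 ?_) (fun h => h2 ?_) <;> simp [h]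
  · intro h
    have : r ∣ 2 := (ZMod.natCast_eq_zero_iff 2 r).1 (by exact_mod_cast h)
    rw [(Nat.prime_dvd_prime_iff_eq hr Nat.prime_two).1 this] at hr8
    omega

end

section

open Zsqrtd

lemma Ideal.span_pair_mul_eq {S : Type*} [CommRing S] {κ x y m l n : S}
    (hxy : x * y = κ * n) (h : m * κ + l * (x + y) = 1) :
    Ideal.span {κ, x} * Ideal.span {κ, y} = Ideal.span {κ} := by
  rw [Ideal.span_pair_mul_span_pair]
  refine _root_.le_antisymm (Ideal.span_le.2 ?_) ((Ideal.span_singleton_le_iff_mem _).2 ?_)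
  · simp only [Set.insert_subset_iff, Set.singleton_subset_iff, SetLike.mem_coe,
      Ideal.mem_span_singleton]
    exact ⟨dvd_mul_right .., dvd_mul_right .., dvd_mul_left .., ⟨n, hxy⟩⟩
  · have hκ : κ = m * (κ * κ) + (l * (x * κ) + l * (κ * y)) := by linear_combination -κ * h
    suffices m * (κ * κ) + (l * (x * κ) + l * (κ * y)) ∈
      Ideal.span {κ * κ, κ * y, x * κ, x * y} by rwa [← hκ] at this
    refine add_mem (Ideal.mul_mem_left _ _ (Ideal.subset_span ?_)) (add_mem
      (Ideal.mul_mem_left _ _ (Ideal.subset_span ?_))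
      (Ideal.mul_mem_left _ _ (Ideal.subset_span ?_))) <;> simp

namespace CycData

section Base

variable {R : Type*} [CommRing R] {p q : ℕ} {B : BaseData R p q}
  {O : Type} [CommRing O] {g : R →+* O} (C : CycData B g)

lemma map_mul_ρ : ∃ u : O, IsUnit u ∧ (q : O) = u * (C.f C.ρ * C.f (star C.ρ)) := by
  have h1 : C.f C.ρ * C.f (star C.ρ) = ((norm C.ρ : ℤ) : O) := by
    rw [← map_mul, ← norm_eq_mul_conj, map_intCast]
  have h2 := C.natAbs_norm_ρ
  rw [h1]
  rcases Int.natAbs_eq (norm C.ρ) with h | h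
  · exact ⟨1, isUnit_one, by rw [h, h2]; simp⟩
  · exact ⟨-1, isUnit_one.neg, by rw [h, h2]; simp⟩

/-- The ramified primes. -/
def ram (i : Fin 4) : O := ![g B.π₁, g B.π₂, C.f C.ρ, C.f (star C.ρ)] i

lemma exists_eq_mul [Fact p.Prime] [Fact q.Prime] [IsDomain O] [CharZero O] (hpq : p ≠ q)
    (hq2 : q ≠ 2) {D : O} (hD : D = p * q ∨ D = -(p * q)) :
    (∃ w : O, IsUnit w ∧ D = w * ∏ i, C.ram i) ∧
      ∀ i, Prime (C.ram i) ∧ C.ram i ∣ D ∧ ¬ C.ram i ^ 2 ∣ D := by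
  have hp0 : (p : O) ≠ 0 := by exact_mod_cast (Fact.out : p.Prime).ne_zero
  have hq0 : (q : O) ≠ 0 := by exact_mod_cast (Fact.out : q.Prime).ne_zero
  have hqp : (q : ZMod p) ≠ 0 := by
    rw [Ne, ZMod.natCast_eq_zero_iff, Nat.prime_dvd_prime_iff_eq Fact.out Fact.out]
    exact hpq
  have hpq' : (p : ZMod q) ≠ 0 := by
    rw [Ne, ZMod.natCast_eq_zero_iff, Nat.prime_dvd_prime_iff_eq Fact.out Fact.out]
    exact hpq.symm
  obtain ⟨u, hu, hq⟩ := C.map_mul_ρ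
  have hπ : g B.π₁ * g B.π₂ = (p : O) := by rw [← map_mul, B.mul_π, map_natCast]
  have hρ₁ : C.φ C.ρ = 0 := (C.inert₃.ker _).2 dvd_rfl
  have hρ₂ : C.φ (star C.ρ) ≠ 0 :=
    residueMap_star_ne (Or.inr (Or.inr rfl)) Fact.out hq2 C.natAbs_norm_ρ hρ₁
  obtain ⟨v, hv, hDv⟩ : ∃ v : O, IsUnit v ∧ D = v * (p * q) := by
    rcases hD with rfl | rfl
    · exact ⟨1, isUnit_one, by ring⟩
    · exact ⟨-1, isUnit_one.neg, by ring⟩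
  have key : ∀ {a b : O} (w : O), Prime a → IsUnit w → D = w * (a * b) → ¬ a ∣ b →
      Prime a ∧ a ∣ D ∧ ¬ a ^ 2 ∣ D := by
    intro a b w ha hw hDw hab
    refine ⟨ha, ⟨w * b, by rw [hDw]; ring⟩, ?_⟩
    rw [hDw, hw.dvd_mul_left, sq, mul_dvd_mul_iff_left ha.ne_zero]
    exact hab
  have hπ₁0 : g B.π₁ ≠ 0 := fun h => hp0 (by rw [← hπ, h, zero_mul])
  have hπ₂0 : g B.π₂ ≠ 0 := fun h => hp0 (by rw [← hπ, h, mul_zero])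
  have hρ₁0 : C.f C.ρ ≠ 0 := fun h => hq0 (by rw [hq, h, zero_mul, mul_zero])
  have hρ₂0 : C.f (star C.ρ) ≠ 0 := fun h => hq0 (by rw [hq, h, mul_zero, mul_zero])
  refine ⟨⟨v * u, hv.mul hu, ?_⟩, ?_⟩
  · rw [hDv, ← hπ, hq]
    simp only [ram, Fin.prod_univ_four, Matrix.cons_val]
    ring
  have h₀ : Prime (C.ram 0) ∧ C.ram 0 ∣ D ∧ ¬ C.ram 0 ^ 2 ∣ D := by
    refine key (b := g (B.π₂ * q)) v (C.inert₁.prime hπ₁0) hv ?_ ?_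
    · rw [map_mul, hDv, ← hπ, map_natCast]
      simp only [ram, Matrix.cons_val]
      ring
    · intro h
      have := C.inert₁.dvd h
      rw [map_mul, map_natCast] at this
      exact mul_ne_zero B.ne₁ hqp this
  have h₁ : Prime (C.ram 1) ∧ C.ram 1 ∣ D ∧ ¬ C.ram 1 ^ 2 ∣ D := by
    refine key (b := g (B.π₁ * q)) v (C.inert₂.prime hπ₂0) hv ?_ ?_
    · rw [map_mul, hDv, ← hπ, map_natCast]
      simp only [ram, Matrix.cons_val]
      ring
    · intro h
      have := C.inert₂.dvd h
      rw [map_mul, map_natCast] at this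
      exact mul_ne_zero B.ne₂ hqp this
  have h₂ : Prime (C.ram 2) ∧ C.ram 2 ∣ D ∧ ¬ C.ram 2 ^ 2 ∣ D := by
    refine key (b := C.f (star C.ρ * p)) (v * u) (C.inert₃.prime hρ₁0) (hv.mul hu) ?_ ?_
    · rw [map_mul, hDv, hq, map_natCast]
      simp only [ram, Matrix.cons_val]
      ring
    · intro h
      have := C.inert₃.dvd h
      rw [map_mul, map_natCast] at this
      exact mul_ne_zero hρ₂ hpq' this
  have h₃ : Prime (C.ram 3) ∧ C.ram 3 ∣ D ∧ ¬ C.ram 3 ^ 2 ∣ D := by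
    refine key (b := C.f (C.ρ * p)) (v * u) (C.inert₄.prime hρ₂0) (hv.mul hu) ?_ ?_
    · rw [map_mul, hDv, hq, map_natCast]
      simp only [ram, Matrix.cons_val]
      ring
    · intro h
      have := C.inert₄.dvd h
      rw [map_mul, map_natCast] at this
      exact mul_ne_zero (by simpa [starRingEnd_apply] using hρ₂) hpq' this
  intro i
  fin_cases i
  exacts [h₀, h₁, h₂, h₃]

end Base

variable {R : Type*} [CommRing R] {p q : ℕ} [Fact p.Prime] [Fact q.Prime] {B : BaseData R p q}
  {O : Type} [CommRing O] [IsDomain O] [CharZero O] [IsPrincipalIdealRing O] {g : R →+* O}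
  {S : Type*} [CommRing S] [Algebra O S] [IsDedekindDomain S]
  {s : S ≃ₐ[O] S} {e : S} {D : O}

/-- The `2`-torsion of the class group has order at most four. -/
theorem card_two_torsion_le (C : CycData B g) [Finite (ClassGroup S)] (hpq : p ≠ q)
    (hq2 : q ≠ 2) (hD : D = p * q ∨ D = -(p * q)) (h : QuadConj O s) (he : e ^ 2 = algebraMap O S D)
    (hs : s e = -e) {z : S} (hz : z - s z = e)
    (hfin : (QuadConj.unitNorm s).range.relIndex (QuadConj.unitQuot s).ker ≠ 0)
    (hherb : 2 * (QuadConj.unitNorm s).range.relIndex (QuadConj.unitQuot s).ker ≤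
      (QuadConj.unitQuot s).range.relIndex (QuadConj.unitNorm s).ker) :
    Nat.card (powMonoidHom 2 : ClassGroup S →* ClassGroup S).ker ≤ 4 := by
  obtain ⟨⟨w, hw, hDw⟩, hram⟩ := C.exists_eq_mul hpq hq2 hD
  have hD0 : 2 * D ≠ 0 := by
    refine mul_ne_zero two_ne_zero ?_
    rintro rfl
    exact (hram 0).2.2 (dvd_zero _)
  have := h.four_mul_card_le (π := C.ram) (P := fun i => Ideal.span {algebraMap O S (C.ram i), e})
    (z := z) (fun i => (hram i).1)
    (fun i => QuadConj.span_sq_of_prime (hram i).1 (hram i).2.1 (hram i).2.2 he) ?_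
    (C.isUnit_ζ.map (algebraMap O S)).unit (by simp) ?_ hfin hherb
  · rw [Fintype.card_fin] at this
    omega
  · intro Q hQ hmem
    rw [hz] at hmem
    have h1 := Q.pow_mem_of_mem hmem 2 two_pos
    rw [he, hDw, map_mul, map_prod] at h1
    rcases hQ.mem_or_mem h1 with h1 | h1
    · exact absurd (Q.eq_top_of_isUnit_mem h1 (hw.map _)) hQ.ne_top
    · obtain ⟨i, -, hi⟩ := (Ideal.IsPrime.prod_mem_iff (hp := hQ)).1 h1
      exact ⟨i, hi⟩
  · intro x y hy hxy
    obtain ⟨x, y, z, hz, h1⟩ := h.exists_sq_sub_of_norm he hs hD0 hy hxy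
    obtain ⟨x, z, hz, h2⟩ := exists_not_dvd_of_sq_sub (hram 0).1 (hram 0).2.1 (hram 0).2.2 hz h1
    exact B.nonsquare_ε (C.inert₁.isSquare hz h2 C.norm_ζ)

/-- A necessary condition for an ideal class to be a square. -/
lemma isSquare_of_isSquare (C : CycData B g) (hpq : p ≠ q) (hq2 : q ≠ 2)
    (hD : D = p * q ∨ D = -(p * q))
    (h : QuadConj O s) (he : e ^ 2 = algebraMap O S D) (hs : s e = -e) {I : Ideal S} (hI : I ≠ ⊥)
    {a : O} (hIa : I * I.map s = Ideal.span {algebraMap O S a}) {c : ClassGroup S}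
    (hc : idealClass I = c ^ 2) {α : ℤ√2} (hα : C.f α = a * C.bar a) :
    IsSquare (C.φ α) ∧ IsSquare (C.φ (star α)) := by
  obtain ⟨-, hram⟩ := C.exists_eq_mul hpq hq2 hD
  have hD0 : 2 * D ≠ 0 := by
    refine mul_ne_zero two_ne_zero ?_
    rintro rfl
    exact (hram 0).2.2 (dvd_zero _)
  obtain ⟨u, x, y, z, hz, h1⟩ := h.exists_sq_sub_of_isSquare he hs hD0 hI hIa hc
  obtain ⟨β, hβ⟩ := C.inert₃.norm u
  obtain ⟨γ, rfl⟩ := C.isSquare_unit u β u.isUnit hβ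
  have hn : C.f (γ * γ * α) = u * a * C.bar (u * a) := by
    rw [map_mul, hβ, hα, map_mul]
    ring
  have hu : IsUnit (C.f (γ * γ)) := hβ ▸ u.isUnit.mul (u.isUnit.map C.bar)
  have key : ∀ {φ : ℤ√2 →+* ZMod q} {ρ : ℤ√2}, InertAt C.f C.bar φ ρ → Prime (C.f ρ) →
      C.f ρ ∣ D → ¬ C.f ρ ^ 2 ∣ D → IsSquare (φ α) := by
    intro φ ρ hi hp hd hd2
    obtain ⟨x, z, hz, h2⟩ := exists_not_dvd_of_sq_sub hp hd hd2 hz h1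
    have h3 := hi.isSquare hz h2 hn
    have h0 : φ γ ≠ 0 := by
      intro h0
      refine hi.not_isUnit (isUnit_of_dvd_unit (map_dvd C.f ?_) hu)
      exact ((hi.ker _).1 h0).mul_right _
    rw [map_mul, map_mul] at h3
    have h4 := h3.div (IsSquare.mul_self (φ γ))
    rwa [mul_div_cancel_left₀ _ (mul_ne_zero h0 h0)] at h4
  exact ⟨key C.inert₃ (hram 2).1 (hram 2).2.1 (hram 2).2.2,
    key C.inert₄ (hram 3).1 (hram 3).2.1 (hram 3).2.2⟩

/-- The class group has a nonsquare class besides the ramified one. -/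
theorem exists_nonsquare (C : CycData B g) (hp2 : p ≠ 2) (hpq : p ≠ q) (hq2 : q ≠ 2)
    (hD : D = p * q ∨ D = -(p * q)) (h : QuadConj O s) (he : e ^ 2 = algebraMap O S D)
    (hs : s e = -e) (hpq' : ¬ IsSquare (p : ZMod q)) {P : ClassGroup S}
    (hP : P = idealClass (Ideal.span {algebraMap O S (g B.π₁), e})) :
    P ^ 2 = 1 ∧ (∀ c, P ≠ c ^ 2) ∧ ∃ T : ClassGroup S, ∀ c, T ≠ c ^ 2 ∧ T * P ≠ c ^ 2 := by
  obtain ⟨-, hram⟩ := C.exists_eq_mul hpq hq2 hD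
  have hI2 := QuadConj.span_sq_of_prime (hram 0).1 (hram 0).2.1 (hram 0).2.2 he
  obtain ⟨hI, hP2⟩ := idealClass_sq_eq_one h.inj (hram 0).1.ne_zero hI2
  have hII := QuadConj.map_eq_of_sq (s := s) hI2
  change Ideal.span {algebraMap O S (g B.π₁), e} ^ 2 = _ at hI2
  change Ideal.span {algebraMap O S (g B.π₁), e} ≠ _ at hI
  change (Ideal.span {algebraMap O S (g B.π₁), e}).map s =
    Ideal.span {algebraMap O S (g B.π₁), e} at hII
  change idealClass (Ideal.span {algebraMap O S (g B.π₁), e}) ^ 2 = _ at hP2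
  change _ = Ideal.span {algebraMap O S (g B.π₁)} at hI2
  set I := Ideal.span {algebraMap O S (g B.π₁), e} with hIdef
  refine ⟨hP ▸ hP2, ?_, ?_⟩
  · intro c hc
    have := (C.isSquare_of_isSquare hpq hq2 hD h he hs hI (a := g B.π₁) (by rw [hII, ← sq, hI2])
      (hP ▸ hc) (α := p) (by rw [map_natCast, C.bar_π])).1
    rw [map_natCast] at this
    exact hpq' this
  obtain ⟨r, hr, hr8, hrq, hr1, hrD, hrD0, hr2⟩ := exists_prime_nonresidue p q hp2 hq2 hpq
  have : Fact r.Prime := ⟨hr⟩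
  obtain ⟨χ, κ, α, hχ, hα, hαr⟩ := C.exists_prime r hr hr8
  obtain ⟨b, hb, hb0⟩ : ∃ b : ZMod r, χ D = b * b ∧ b ≠ 0 := by
    obtain ⟨b, hb⟩ : IsSquare (χ D) := by
      rcases hD with rfl | rfl
      · simpa using hrD
      · have := hr1.mul hrD
        simpa using this
    refine ⟨b, hb, ?_⟩
    rintro rfl
    apply hrD0
    rcases hD with rfl | rfl <;> simpa using hb
  obtain ⟨b, rfl⟩ := ZMod.natCast_zmod_surjective b
  have hκ0 : κ ≠ 0 := by
    rintro rfl
    have h1 : α = 0 := C.inj (by rw [hα, zero_mul, map_zero])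
    rw [h1, Zsqrtd.norm_zero] at hαr
    exact hr.ne_zero (by exact_mod_cast hαr.symm)
  obtain ⟨k, hk⟩ : κ ∣ D - (b : O) * b := by
    rw [← hχ, map_sub, map_mul, map_natCast, hb, sub_self]
  obtain ⟨m, l, hml⟩ : ∃ m l : O, m * κ + l * (2 * b) = 1 := by
    obtain ⟨l, hl⟩ := ZMod.natCast_zmod_surjective (2 * (b : ZMod r))⁻¹
    obtain ⟨m, hm⟩ : κ ∣ 1 - (l : O) * (2 * b) := by
      rw [← hχ]
      simp only [map_sub, map_mul, map_natCast, map_ofNat, map_one, hl]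
      rw [inv_mul_cancel₀ (mul_ne_zero hr2 hb0), sub_self]
    exact ⟨m, l, by linear_combination -hm⟩
  set J : Ideal S := Ideal.span {algebraMap O S κ, e - algebraMap O S b} with hJ
  have hJs : J.map s = Ideal.span {algebraMap O S κ, -e - algebraMap O S b} := by
    rw [hJ, Ideal.map_span, Set.image_pair, map_sub, hs, AlgEquiv.commutes, AlgEquiv.commutes]
  have hJJ : J * J.map s = Ideal.span {algebraMap O S κ} := by
    rw [hJs, hJ]
    refine Ideal.span_pair_mul_eq (m := algebraMap O S m) (l := -algebraMap O S l)
      (n := -algebraMap O S k) ?_ ?_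
    · have hk' := congrArg (algebraMap O S) hk
      simp only [map_sub, map_mul] at hk'
      linear_combination -he - hk'
    · have hml' := congrArg (algebraMap O S) hml
      simp only [map_add, map_mul, map_ofNat, map_one] at hml'
      linear_combination hml'
  have hκS : algebraMap O S κ ≠ 0 := (map_ne_zero_iff _ h.inj).2 hκ0
  have hJ0 : J ≠ ⊥ := by
    intro h0
    rw [h0, Ideal.bot_mul, eq_comm, Ideal.span_singleton_eq_bot] at hJJ
    exact hκS hJJ
  have hnorm : ∀ x : ℤ√2, C.φ x * C.φ (star x) = (norm x : ZMod q) := mul_residueMap C.φ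
  refine ⟨idealClass J, fun c => ⟨fun hc => ?_, fun hc => ?_⟩⟩
  · obtain ⟨h1, h2⟩ := C.isSquare_of_isSquare hpq hq2 hD h he hs hJ0 hJJ hc hα
    have h3 := h1.mul h2
    rw [hnorm, hαr, Int.cast_natCast] at h3
    exact hrq h3
  · rw [hP, ← idealClass_mul hJ0 hI] at hc
    obtain ⟨h1, h2⟩ := C.isSquare_of_isSquare hpq hq2 hD h he hs (mul_ne_zero hJ0 hI)
      (a := κ * g B.π₁) (by
        rw [Ideal.map_mul, hII, mul_mul_mul_comm, hJJ, ← sq, hI2,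
          Ideal.span_singleton_mul_span_singleton, map_mul]) hc (α := α * p) (by
        rw [map_mul, hα, map_natCast, map_mul, ← C.bar_π]
        ring)
    have h3 := h1.mul h2
    have hp0 : (p : ZMod q) ≠ 0 := fun h0 => hpq' (h0 ▸ IsSquare.zero)
    rw [hnorm, norm_mul, hαr, norm_natCast, Int.cast_mul, Int.cast_mul, Int.cast_natCast,
      Int.cast_natCast] at h3
    have h4 := h3.div (IsSquare.mul_self (p : ZMod q))
    rw [mul_div_cancel_right₀ _ (mul_ne_zero hp0 hp0)] at h4
    exact hrq h4

end CycData

end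

/-- A criterion for the Sylow `2`-subgroup of a finite commutative group to be a Klein group. -/
theorem nonempty_sylow_mulEquiv {G : Type*} [CommGroup G] [Finite G] {P T : G} {m : ℕ}
    (hm : Odd m) (hGm : ∀ c : G, (c ^ 2) ^ m = 1 ∨ (c ^ 2) ^ m = P) (hP2 : P ^ 2 = 1)
    (hP : ∀ c, P ≠ c ^ 2) (hT : ∀ c, T ≠ c ^ 2 ∧ T * P ≠ c ^ 2)
    (hcard : Nat.card (powMonoidHom 2 : G →* G).ker ≤ 4) (H : Sylow 2 G) :
    Nonempty (↥(H : Subgroup G) ≃* Multiplicative (ZMod 2 × ZMod 2)) := by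
  have hsq : ∀ c : G, (c ^ 2) ^ m = 1 := fun c => (hGm c).resolve_right fun h =>
    hP (c ^ m) (by rw [← h, ← pow_mul, ← pow_mul, mul_comm])
  have hH : (H : Subgroup G) = (powMonoidHom 2 : G →* G).ker := by
    refine le_antisymm (fun x hx => ?_) ?_
    · obtain ⟨n, hn⟩ := IsPGroup.iff_orderOf.1 H.isPGroup' ⟨x, hx⟩
      rw [Subgroup.orderOf_mk] at hn
      have h1 : orderOf (x ^ 2) ∣ m := orderOf_dvd_of_pow_eq_one (hsq x)
      have h2 : orderOf (x ^ 2) ∣ 2 ^ n := hn ▸ orderOf_pow_dvd 2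
      have h3 : Nat.Coprime (2 ^ n) m := Nat.Coprime.pow_left n (Nat.coprime_two_left.2 hm)
      exact orderOf_eq_one_iff.1 (Nat.eq_one_of_dvd_coprimes h3 h2 h1)
    · have h1 : IsPGroup 2 (powMonoidHom 2 : G →* G).ker := by
        intro x
        exact ⟨1, Subtype.ext (by simpa using MonoidHom.mem_ker.1 x.2)⟩
      obtain ⟨H', hH'⟩ := h1.exists_le_sylow
      have : Subsingleton (Sylow 2 G) := (Sylow.unique_of_normal H inferInstance).instSubsingleton
      rwa [Subsingleton.elim H H']
  have hP1 : P ≠ 1 := fun h => hP 1 (by rw [h, one_pow])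
  obtain ⟨n, rfl⟩ := hm
  have hUker : (T ^ (2 * n + 1)) ^ 2 = 1 := by rw [← hsq T, ← pow_mul, ← pow_mul, mul_comm]
  have hTT : T * T ^ (2 * n + 1) = (T ^ (n + 1)) ^ 2 := by
    rw [← pow_succ', ← pow_mul]
    congr 1
    ring
  generalize T ^ (2 * n + 1) = U at *
  have hPP : P * P = 1 := by rw [← sq, hP2]
  have hU1 : U ≠ 1 := fun h => (hT (T ^ (n + 1))).1 (by rw [← hTT, h, mul_one])
  have hUP : U ≠ P := fun h => (hT (T ^ (n + 1))).2 (by rw [← hTT, h])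
  have hPU1 : P * U ≠ 1 := fun h => hUP (by rw [← mul_one P, ← h, ← mul_assoc, hPP, one_mul])
  have hcard4 : Nat.card (H : Subgroup G) = 4 := by
    rw [hH]
    refine le_antisymm hcard ?_
    classical
    have h4 : ({1, P, U, P * U} : Finset G).card = 4 := by
      rw [Finset.card_eq_succ]
      refine ⟨1, {P, U, P * U}, ?_, rfl,
          Finset.card_eq_three.2 ⟨P, U, P * U, hUP.symm, ?_, ?_, rfl⟩⟩
      · simp [hP1.symm, hU1.symm, hPU1.symm]
      · simpa using hU1
      · simpa using hP1
    rw [← h4, ← Set.ncard_coe_finset, ← SetLike.coe_sort_coe, Nat.card_coe_set_eq]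
    refine Set.ncard_le_ncard (fun x hx => ?_) (Set.toFinite _)
    simp only [Finset.coe_insert, Finset.coe_singleton, Set.mem_insert_iff,
      Set.mem_singleton_iff] at hx
    rcases hx with rfl | rfl | rfl | rfl <;>
      simp [MonoidHom.mem_ker, powMonoidHom_apply, mul_pow, hP2, hUker]
  have : IsKleinFour (H : Subgroup G) := by
    refine ⟨hcard4, ?_⟩
    refine ((Nat.dvd_prime Nat.prime_two).1 (Monoid.exponent_dvd_of_forall_pow_eq_one
      fun x => ?_)).resolve_left fun h => ?_
    · have : (x : G) ∈ (powMonoidHom 2 : G →* G).ker := hH ▸ x.2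
      exact Subtype.ext (by simpa using MonoidHom.mem_ker.1 this)
    · rw [Monoid.exp_eq_one_iff] at h
      rw [Nat.card_of_subsingleton 1] at hcard4
      omega
  exact IsKleinFour.nonempty_mulEquiv

section Extension

variable {A S : Type*} [CommRing A] [IsDedekindDomain A] [CommRing S] [IsDedekindDomain S]
  [Algebra A S]

lemma idealClass_map_eq (hinj : Function.Injective (algebraMap A S)) {I J : Ideal A}
    (hI : I ≠ ⊥) (hJ : J ≠ ⊥) (h : idealClass I = idealClass J) :
    idealClass (I.map (algebraMap A S)) = idealClass (J.map (algebraMap A S)) := by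
  obtain ⟨x, y, hx, hy, hxy⟩ := (idealClass_eq_iff hI hJ).1 h
  have hb : ∀ {I : Ideal A}, I ≠ ⊥ → I.map (algebraMap A S) ≠ ⊥ := fun hI h =>
    hI ((Ideal.map_eq_bot_iff_of_injective hinj).1 h)
  refine (idealClass_eq_iff (hb hI) (hb hJ)).2 ⟨algebraMap A S x, algebraMap A S y,
    (map_ne_zero_iff _ hinj).2 hx, (map_ne_zero_iff _ hinj).2 hy, ?_⟩
  have := congrArg (Ideal.map (algebraMap A S)) hxy
  rwa [Ideal.map_mul, Ideal.map_mul, Ideal.map_span, Ideal.map_span, Set.image_singleton,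
    Set.image_singleton] at this

/-- Classes extended from a ring whose class group is generated by two ideals, up to odd order. -/
lemma exists_odd_pow_map (hinj : Function.Injective (algebraMap A S)) {I J : Ideal A}
    (hI : I ≠ ⊥) (hJ : J ≠ ⊥) {P : ClassGroup S} (hIP : idealClass (I.map (algebraMap A S)) = P)
    (hJP : idealClass (J.map (algebraMap A S)) = 1)
    (H : ∃ m, Odd m ∧ ∀ c : ClassGroup A, c ^ m = 1 ∨ c ^ m = idealClass I ∨
      c ^ m = idealClass J ∨ c ^ m = idealClass I * idealClass J) :
    ∃ m, Odd m ∧ ∀ n : Ideal A, n ≠ ⊥ → idealClass (n.map (algebraMap A S)) ^ m = 1 ∨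
      idealClass (n.map (algebraMap A S)) ^ m = P := by
  obtain ⟨m, hm, H⟩ := H
  refine ⟨m, hm, fun n hn => ?_⟩
  have hb : ∀ {I : Ideal A}, I ≠ ⊥ → I.map (algebraMap A S) ≠ ⊥ := fun hI h =>
    hI ((Ideal.map_eq_bot_iff_of_injective hinj).1 h)
  have key : ∀ {Q : Ideal A}, Q ≠ ⊥ → idealClass n ^ m = idealClass Q →
      idealClass (n.map (algebraMap A S)) ^ m = idealClass (Q.map (algebraMap A S)) := by
    intro Q hQ h
    rw [← idealClass_pow hn] at h
    rw [← idealClass_pow (hb hn), ← Ideal.map_pow]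
    exact idealClass_map_eq hinj (pow_ne_zero _ hn) hQ h
  rcases H (idealClass n) with h | h | h | h
  · left
    rw [key (Q := ⊤) (by simp) (by rw [h, idealClass_top]), Ideal.map_top, idealClass_top]
  · exact Or.inr ((key hI h).trans hIP)
  · exact Or.inl ((key hJ h).trans hJP)
  · right
    rw [← idealClass_mul hI hJ] at h
    rw [key (mul_ne_zero hI hJ) h, Ideal.map_mul, idealClass_mul (hb hI) (hb hJ), hIP, hJP,
      mul_one]

end Extension

/-- In a biquadratic extension, squares of classes come from the intermediate rings. -/
theorem QuadConj.exists_odd_sq_pow {A₂ A₃ O S : Type*} [CommRing A₂] [CommRing A₃] [CommRing O]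
    [CommRing S] [IsDedekindDomain S] [IsPrincipalIdealRing O]
    [Algebra A₂ S] [Algebra A₃ S] [Algebra O S] {τ₂ : S ≃ₐ[A₂] S} {τ₃ : S ≃ₐ[A₃] S} {σ : S ≃ₐ[O] S}
    (h₂ : QuadConj A₂ τ₂) (h₃ : QuadConj A₃ τ₃) (hσ : QuadConj O σ)
    (hτ : ∀ x, τ₂ (τ₃ x) = σ x) {P : ClassGroup S} (hP : P ^ 2 = 1)
    (H₂ : ∃ m, Odd m ∧ ∀ n : Ideal A₂, n ≠ ⊥ → idealClass (n.map (algebraMap A₂ S)) ^ m = 1 ∨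
      idealClass (n.map (algebraMap A₂ S)) ^ m = P)
    (H₃ : ∃ m, Odd m ∧ ∀ n : Ideal A₃, n ≠ ⊥ → idealClass (n.map (algebraMap A₃ S)) ^ m = 1 ∨
      idealClass (n.map (algebraMap A₃ S)) ^ m = P) :
    ∃ m, Odd m ∧ ∀ c : ClassGroup S, (c ^ 2) ^ m = 1 ∨ (c ^ 2) ^ m = P := by
  obtain ⟨m₂, hm₂, H₂⟩ := H₂
  obtain ⟨m₃, hm₃, H₃⟩ := H₃
  refine ⟨m₂ * m₃, hm₂.mul hm₃, fun c => ?_⟩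
  obtain ⟨I, hI, rfl⟩ := exists_idealClass_eq c
  have hc : idealClass I ^ 2 = idealClass ((normIdeal τ₂ I).map (algebraMap A₂ S)) *
      idealClass ((normIdeal τ₃ I).map (algebraMap A₃ S)) := by
    rw [← h₂.mul_map_eq I, ← h₃.mul_map_eq I, idealClass_mul hI (h₂.map_ne_bot hI),
      idealClass_mul hI (h₃.map_ne_bot hI)]
    suffices idealClass (I.map τ₂) * idealClass (I.map τ₃) = 1 by
      rw [mul_mul_mul_comm, this, mul_one, sq]
    have h1 : I.map τ₃ = (I.map σ).map τ₂ := by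
      have h1 : ∀ x, τ₃ x = τ₂ (σ x) := fun x => by rw [← hτ, h₂.invol]
      ext x
      rw [Ideal.mem_map_of_equiv, Ideal.mem_map_of_equiv]
      constructor
      · rintro ⟨y, hy, rfl⟩
        exact ⟨σ y, Ideal.mem_map_of_mem _ hy, (h1 y).symm⟩
      · rintro ⟨y, hy, rfl⟩
        obtain ⟨z, hz, rfl⟩ := (Ideal.mem_map_of_equiv _ _).1 hy
        exact ⟨z, hz, h1 z⟩
    obtain ⟨n, hn⟩ := hσ.exists_mul_map_eq_span I
    have hn0 : algebraMap O S n ≠ 0 := by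
      intro h0
      rw [h0, Ideal.span_singleton_eq_bot.2 rfl] at hn
      exact mul_ne_zero hI (hσ.map_ne_bot hI) hn
    rw [h1, ← idealClass_mul (h₂.map_ne_bot hI) (h₂.map_ne_bot (hσ.map_ne_bot hI)),
      ← Ideal.map_mul, hn, map_span_singleton]
    exact idealClass_span ((map_ne_zero_iff _ τ₂.injective).2 hn0)
  have hPm : ∀ {m : ℕ}, Odd m → P ^ m = P := by
    rintro m ⟨n, rfl⟩
    rw [pow_succ, pow_mul, hP, one_pow, one_mul]
  have hb₂ : normIdeal τ₂ I ≠ ⊥ := by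
    intro h
    have := h₂.mul_map_eq I
    rw [h, Ideal.map_bot] at this
    exact mul_ne_zero hI (h₂.map_ne_bot hI) this
  have hb₃ : normIdeal τ₃ I ≠ ⊥ := by
    intro h
    have := h₃.mul_map_eq I
    rw [h, Ideal.map_bot] at this
    exact mul_ne_zero hI (h₃.map_ne_bot hI) this
  rw [hc, mul_pow, pow_mul, mul_comm m₂, pow_mul _ m₃ m₂]
  rcases H₂ _ hb₂ with h | h <;> rcases H₃ _ hb₃ with h' | h' <;>
    simp only [h, h', one_pow, hPm hm₂, hPm hm₃, one_mul, mul_one, true_or, or_true]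
  exact Or.inl (by rw [← sq, hP])

namespace QuadConj

/-- The nontrivial automorphism of a quadratic extension of number fields. -/
theorem exists_of_finrank {k F : Type*} [Field k] [NumberField k] [Field F] [NumberField F]
    [Algebra k F] (h2 : Module.finrank k F = 2) : ∃ s : 𝓞 F ≃ₐ[𝓞 k] 𝓞 F, QuadConj (𝓞 k) s := by
  have : Algebra.IsQuadraticExtension k F := ⟨h2⟩
  have : IsGalois k F := Algebra.IsQuadraticExtension.isGalois k F
  have hcard : Nat.card Gal(F/k) = 2 := by rw [IsGalois.card_aut_eq_finrank, h2]
  obtain ⟨t, ht, htu⟩ := (Nat.card_eq_two_iff' (1 : Gal(F/k))).1 hcard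
  have htt : t * t = 1 := by rw [← sq, ← hcard, pow_card_eq_one']
  let r := galRestrict (𝓞 k) k F (𝓞 F)
  have hr : ∀ x, algebraMap (𝓞 F) F (r t x) = t (algebraMap (𝓞 F) F x) :=
    algebraMap_galRestrict_apply (𝓞 k) t
  refine ⟨r t, FaithfulSMul.algebraMap_injective _ _, fun x => ?_, fun x hx => ?_, ?_⟩
  · rw [← AlgEquiv.mul_apply, ← map_mul, htt, map_one, AlgEquiv.one_apply]
  · have hfix : ∀ f : Gal(F/k), f (algebraMap (𝓞 F) F x) = algebraMap (𝓞 F) F x := by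
      intro f
      by_cases hf : f = 1
      · rw [hf, AlgEquiv.one_apply]
      · rw [htu f hf, ← hr, hx]
    obtain ⟨y, hy⟩ := IntermediateField.mem_bot.1 ((IsGalois.mem_bot_iff_fixed _).2 hfix)
    have hintegral : IsIntegral ℤ y := by
      have h1 : IsIntegral ℤ (algebraMap k F y) := hy ▸ x.2
      exact (isIntegral_algebraMap_iff (algebraMap k F).injective).1 h1
    exact ⟨⟨y, hintegral⟩, RingOfIntegers.ext hy⟩
  · by_contra! hx
    apply ht
    apply r.injective
    rw [map_one]
    exact AlgEquiv.ext hx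

variable {R S : Type*} [CommRing R] [CommRing S] [Algebra R S] {s : S ≃ₐ[R] S}

lemma apply_eq_neg [IsDomain S] (h : QuadConj R s) {e : S} {a : R} (he : e ^ 2 = algebraMap R S a)
    (hne : ∀ r, algebraMap R S r ≠ e) : s e = -e := by
  have h1 : s e ^ 2 = e ^ 2 := by rw [← map_pow, he, AlgEquiv.commutes]
  refine (sq_eq_sq_iff_eq_or_eq_neg.1 h1).resolve_left fun h2 => ?_
  obtain ⟨r, hr⟩ := h.fixed e h2
  exact hne r hr

/-- Ring homomorphisms are determined by their values on the base and on a square root. -/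
lemma ringHom_ext [IsDomain R] [CharZero R] {S' : Type*} [CommRing S'] [IsDomain S']
    (h : QuadConj R s) {e : S} {D : R} (hD : D ≠ 0) (he : e ^ 2 = algebraMap R S D)
    (hs : s e = -e) {f g : S →+* S'} (hfinj : Function.Injective f)
    (hR : ∀ r, f (algebraMap R S r) = g (algebraMap R S r)) (hfe : f e = g e) : f = g := by
  ext x
  obtain ⟨a, b, hab⟩ := h.exists_coord he hs x
  have h1 : f (algebraMap R S (2 * D)) * f x = f (algebraMap R S (2 * D)) * g x := by
    rw [← map_mul, hab, hR, ← map_mul, hab]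
    simp only [map_add, map_mul, hR, hfe]
  have h0 : f (algebraMap R S (2 * D)) ≠ 0 :=
    (map_ne_zero_iff _ hfinj).2 ((map_ne_zero_iff _ h.inj).2 (mul_ne_zero two_ne_zero hD))
  exact mul_left_cancel₀ h0 h1

end QuadConj

section

open Zsqrtd

namespace Zsqrtd

variable {d : ℤ} {k : Type*} [Field k] [NumberField k] {t : k}

lemma eq_zero_of_sq_eq (hd : d < 0) (ht : t ^ 2 = d) {a b : ℚ} (h : (a : k) + b * t = 0) :
    a = 0 ∧ b = 0 := by
  have h1 : ((a ^ 2 - d * b ^ 2 : ℚ) : k) = 0 := by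
    push_cast
    linear_combination (a - b * t) * h + (b : k) ^ 2 * ht
  have h2 : a ^ 2 - d * b ^ 2 = 0 := by exact_mod_cast h1
  have hd' : (d : ℚ) < 0 := by exact_mod_cast hd
  have hb : b = 0 := by
    by_contra hb
    have : 0 < b ^ 2 := by positivity
    nlinarith [sq_nonneg a]
  subst hb
  exact ⟨by simpa using h2, rfl⟩

lemma exists_eq_add (hd : d < 0) (hk : Module.finrank ℚ k = 2) (ht : t ^ 2 = d) (x : k) :
    ∃ a b : ℚ, x = a + b * t := by
  have hli : LinearIndependent ℚ ![(1 : k), t] := by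
    rw [LinearIndependent.pair_iff]
    intro a b hab
    refine eq_zero_of_sq_eq hd ht ?_
    rwa [Rat.smul_def, Rat.smul_def, mul_one] at hab
  let b := basisOfLinearIndependentOfCardEqFinrank hli (by rw [hk, Fintype.card_fin])
  refine ⟨b.repr x 0, b.repr x 1, ?_⟩
  conv_lhs => rw [← b.sum_repr x, Fin.sum_univ_two]
  simp [b, Rat.smul_def]

/-- The ring of integers of an imaginary quadratic field, when `ℤ√d` is principal. -/
theorem exists_ringEquiv_ringOfIntegers (hd : d = -1 ∨ d = -2) (hk : Module.finrank ℚ k = 2)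
    (ht : t ^ 2 = d) : ∃ ψ : ℤ√d ≃+* 𝓞 k, ((ψ sqrtd : 𝓞 k) : k) = t := by
  have hd0 : d < 0 := by omega
  have := isDomain_of_small (d := d) (by omega)
  have := isPrincipalIdealRing_of_small (d := d) (by omega)
  have htint : IsIntegral ℤ t := by
    refine IsIntegral.of_pow two_pos ?_
    rw [ht]
    exact isIntegral_algebraMap
  obtain ⟨t', rfl⟩ : ∃ t' : 𝓞 k, (t' : k) = t := ⟨⟨t, htint⟩, rfl⟩
  have ht' : t' * t' = (d : 𝓞 k) := RingOfIntegers.coe_injective (by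
    rw [map_mul, ← sq, ht, map_intCast])
  let f : ℤ√d →+* 𝓞 k := lift ⟨t', ht'⟩
  have hf : ∀ a, (f a : k) = a.re + a.im * t' := fun a => by simp [f]
  let _ : Algebra (ℤ√d) k := ((algebraMap (𝓞 k) k).comp f).toAlgebra
  have hmap : ∀ a, algebraMap (ℤ√d) k a = a.re + a.im * t' := hf
  have hinj : Function.Injective (algebraMap (ℤ√d) k) := by
    rw [injective_iff_map_eq_zero]
    intro a ha
    rw [hmap] at ha
    obtain ⟨h1, h2⟩ := eq_zero_of_sq_eq (a := a.re) (b := a.im) hd0 ht (by exact_mod_cast ha)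
    exact Zsqrtd.ext (by exact_mod_cast h1) (by exact_mod_cast h2)
  have : FaithfulSMul (ℤ√d) k := (faithfulSMul_iff_algebraMap_injective _ _).2 hinj
  have : IsFractionRing (ℤ√d) k := by
    refine IsFractionRing.of_field _ _ fun z => ?_
    obtain ⟨a, b, rfl⟩ := exists_eq_add hd0 hk ht z
    refine ⟨⟨a.num * b.den, b.num * a.den⟩, ⟨a.den * b.den, 0⟩, ?_⟩
    have h1 : (a.den : k) ≠ 0 := by exact_mod_cast a.den_ne_zero
    have h2 : (b.den : k) ≠ 0 := by exact_mod_cast b.den_ne_zero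
    rw [hmap, hmap]
    push_cast
    rw [Rat.cast_def a, Rat.cast_def b]
    field_simp
    ring
  refine ⟨RingEquiv.ofBijective f ⟨fun a b hab => hinj (congrArg (algebraMap (𝓞 k) k) hab),
    fun x => ?_⟩, ?_⟩
  · have hx : IsIntegral (ℤ√d) (x : k) := x.2.tower_top
    obtain ⟨y, hy⟩ := IsIntegrallyClosed.isIntegral_iff.1 hx
    exact ⟨y, RingOfIntegers.ext hy⟩
  · change (f sqrtd : k) = t'
    rw [hf]
    simp

end Zsqrtd

end

namespace Zeta8

lemma isPrimitiveRoot {K : Type*} [Field K] [CharZero K] {z : K} (hz : z ^ 4 = -1) {n : ℕ}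
    (hn : n = 2) : IsPrimitiveRoot z (2 ^ (n + 1)) := by
  subst hn
  rw [← orderOf_eq_prime_pow (p := 2) (n := 2) (x := z)]
  · exact IsPrimitiveRoot.orderOf z
  · rw [show 2 ^ 2 = 4 from rfl, hz]
    norm_num
  · rw [show 2 ^ (2 + 1) = 4 * 2 from rfl, pow_mul, hz]
    norm_num

lemma isCyclotomicExtension {K : Type*} [Field K] [NumberField K]
    (hK : Module.finrank ℚ K = 4) {z : K} (hz : z ^ 4 = -1)
    {n : ℕ} (hn : n = 2) : IsCyclotomicExtension {2 ^ (n + 1)} ℚ K := by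
  have hp := isPrimitiveRoot hz hn
  have hc := hp.intermediateField_adjoin_isCyclotomicExtension ℚ
  have h1 : Module.finrank ℚ ℚ⟮z⟯ = (2 ^ (n + 1)).totient := by
    rw [adjoin.finrank (Algebra.IsIntegral.isIntegral z),
      ← Polynomial.cyclotomic_eq_minpoly_rat hp (by positivity), Polynomial.natDegree_cyclotomic]
  have htop : ℚ⟮z⟯ = ⊤ := by
    refine eq_of_le_of_finrank_eq le_top ?_
    rw [h1, finrank_top', hK, hn]
    decide
  exact @IsCyclotomicExtension.equiv _ ℚ _ _ _ _ _ _ _ hc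
    ((equivOfEq htop).trans topEquiv)

lemma isPrincipalIdealRing {K : Type*} [Field K] [NumberField K]
    (hK : Module.finrank ℚ K = 4) {z : K} (hz : z ^ 4 = -1) : IsPrincipalIdealRing (𝓞 K) := by
  obtain ⟨n, hn⟩ : ∃ n : ℕ, n = 2 := ⟨2, rfl⟩
  have := isCyclotomicExtension hK hz hn
  have : Fact (Nat.Prime 2) := ⟨Nat.prime_two⟩
  apply RingOfIntegers.isPrincipalIdealRing_of_isPrincipal_of_pow_le_of_mem_primesOver_of_mem_Icc
  intro p hp hpp P hP _
  have hpi := Real.pi_gt_three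
  have hM : ⌊(4 / Real.pi) ^ InfinitePlace.nrComplexPlaces K *
      (((Module.finrank ℚ K).factorial : ℝ) / (Module.finrank ℚ K : ℝ) ^ Module.finrank ℚ K *
        √|(discr K : ℝ)|)⌋₊ < 3 := by
    have hφ : (2 ^ (2 + 1)).totient = 4 := by decide
    rw [IsCyclotomicExtension.Rat.nrComplexPlaces_eq_totient_div_two (2 ^ (n + 1)),
      IsCyclotomicExtension.Rat.discr_prime_pow 2 (n + 1), hK, hn, hφ, Nat.floor_lt (by positivity)]
    have h16 :
        √|((((-1) ^ (4 / 2) * (2 : ℕ) ^ (2 ^ (2 + 1 - 1) * ((2 - 1) * (2 + 1) - 1)) : ℤ)) : ℝ)|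
        = 16 := by
      norm_num
    rw [h16]
    norm_num [Nat.factorial]
    rw [div_pow, div_mul_eq_mul_div, div_lt_iff₀ (by positivity)]
    nlinarith
  have hp2 : p = 2 := by
    have := (Finset.mem_Icc.1 hp).2
    have := hpp.two_le
    omega
  subst hp2
  obtain ⟨h1, h2⟩ := hP
  rw [IsCyclotomicExtension.Rat.eq_span_zeta_sub_one_of_liesOver 2 n K (isPrimitiveRoot hz hn) P]
  exact ⟨_, rfl⟩

theorem of_ringOfIntegers {K : Type} [Field K] [NumberField K]
    (hK : Module.finrank ℚ K = 4) {ζ : 𝓞 K} (hζ : ζ ^ 4 = -1) : Zeta8 ζ := by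
  have hz : (ζ : K) ^ 4 = -1 := by
    rw [← map_pow, hζ, map_neg, map_one]
  obtain ⟨n, hn⟩ : ∃ n : ℕ, n = 2 := ⟨2, rfl⟩
  have := isCyclotomicExtension hK hz hn
  have : Fact (Nat.Prime 2) := ⟨Nat.prime_two⟩
  have hp := isPrimitiveRoot hz hn
  let b := hp.integralPowerBasisOfPrimePow
  have hgen : b.gen = ζ := by
    rw [IsPrimitiveRoot.integralPowerBasisOfPrimePow_gen]
    rfl
  have hdim : b.dim = 4 := by
    rw [IsPrimitiveRoot.integralPowerBasisOfPrimePow_dim, hn]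
    decide
  let B : Module.Basis (Fin 4) ℤ (𝓞 K) := b.basis.reindex (finCongr hdim)
  have hB : ∀ i : Fin 4, B i = ζ ^ (i : ℕ) := by
    intro i
    simp [B, hgen]
  have hmin : minpoly ℤ ζ = Polynomial.X ^ 4 + 1 := by
    have h1 : minpoly ℤ (ζ : K) = minpoly ℤ ζ :=
      minpoly.algebraMap_eq RingOfIntegers.coe_injective ζ
    rw [← h1, ← Polynomial.cyclotomic_eq_minpoly hp (by norm_num),
      Polynomial.cyclotomic_prime_pow_eq_geom_sum Nat.prime_two, hn]
    simp [Finset.sum_range_succ, add_comm]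
  refine ⟨hζ, fun x => ?_, fun a₀ a₁ a₂ a₃ h => ?_, fun {A} _ y hy => ?_⟩
  · refine ⟨B.repr x 0, B.repr x 1, B.repr x 2, B.repr x 3, ?_⟩
    conv_lhs => rw [← B.sum_repr x, Fin.sum_univ_four]
    simp [hB]
  · have := Fintype.linearIndependent_iff.1 B.linearIndependent ![a₀, a₁, a₂, a₃]
      (by simpa [Fin.sum_univ_four, hB] using h)
    exact ⟨this 0, this 1, this 2, this 3⟩
  · have hy' : Polynomial.aeval y (minpoly ℤ b.gen) = 0 := by
      rw [hgen, hmin]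
      simp [hy]
    refine ⟨(b.lift y hy' : 𝓞 K →+* A), ?_⟩
    rw [← hgen]
    exact b.lift_gen y hy'

end Zeta8

lemma Ideal.eq_of_sq_eq {S : Type*} [CommRing S] [IsDedekindDomain S] {I J : Ideal S}
    (h : I ^ 2 = J ^ 2) : I = J := by
  have hd : ∀ {I J : Ideal S}, I ^ 2 = J ^ 2 → I ∣ J := fun h =>
    (UniqueFactorizationMonoid.pow_dvd_pow_iff_dvd two_ne_zero).1 (dvd_of_eq h)
  exact _root_.le_antisymm (Ideal.dvd_iff_le.1 (hd h.symm)) (Ideal.dvd_iff_le.1 (hd h))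

lemma BaseData.θ_ne_zero {R : Type*} [CommRing R] [CharZero R] {p q : ℕ} (B : BaseData R p q) :
    B.θ ≠ 0 := by
  intro h
  have h1 := B.coe_ν B.θ
  rw [B.ν_θ, h] at h1
  norm_num at h1

/-- The class group of a biquadratic extension `L / k` with intermediate fields `K`, `F₂`, `F₃`,
where `K` is generated by `g`, `F₂` by `e₂`, and `F₃` by their product `e₃`. -/
theorem nonempty_sylow_mulEquiv_of_biquadratic {k K F₂ F₃ L : Type} [Field k] [NumberField k]
    [Field K] [NumberField K] [Field F₂] [NumberField F₂] [Field F₃] [NumberField F₃]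
    [Field L] [NumberField L] [Algebra k K] [Algebra k F₂] [Algebra k F₃] [Algebra k L]
    [Algebra K L] [Algebra F₂ L] [Algebra F₃ L] [IsScalarTower k K L] [IsScalarTower k F₂ L]
    [IsScalarTower k F₃ L] [IsTotallyComplex k] [IsPrincipalIdealRing (𝓞 k)]
    [IsPrincipalIdealRing (𝓞 K)]
    (hK : Module.finrank k K = 2) (hF₂ : Module.finrank k F₂ = 2) (hF₃ : Module.finrank k F₃ = 2)
    (hKL : Module.finrank K L = 2) (hF₂L : Module.finrank F₂ L = 2)
    (hF₃L : Module.finrank F₃ L = 2)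
    {p q : ℕ} [Fact p.Prime] [Fact q.Prime] (hp2 : p ≠ 2) (hq2 : q ≠ 2) (hpq : p ≠ q)
    (hpq' : ¬ IsSquare (p : ZMod q)) (h2p : ¬ IsSquare (2 : ZMod p)) (h2q : IsSquare (2 : ZMod q))
    {B : BaseData (𝓞 k) p q} (C : CycData B (algebraMap (𝓞 k) (𝓞 K)))
    {g : 𝓞 K} {γ : 𝓞 k} (hγ : γ ≠ 0) (hg : g ^ 2 = algebraMap (𝓞 k) (𝓞 K) γ)
    {e₂ : 𝓞 F₂} {e₃ : 𝓞 F₃}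
    (hge : algebraMap (𝓞 F₃) (𝓞 L) e₃ = algebraMap (𝓞 K) (𝓞 L) g * algebraMap (𝓞 F₂) (𝓞 L) e₂)
    (hg₁ : ∀ r, algebraMap (𝓞 k) (𝓞 K) r ≠ g)
    (hg₂ : ∀ r, algebraMap (𝓞 F₂) (𝓞 L) r ≠ algebraMap (𝓞 K) (𝓞 L) g)
    (hg₃ : ∀ r, algebraMap (𝓞 F₃) (𝓞 L) r ≠ algebraMap (𝓞 K) (𝓞 L) g)
    (he : ∀ r, algebraMap (𝓞 K) (𝓞 L) r ≠ algebraMap (𝓞 F₂) (𝓞 L) e₂)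
    (he₂ : ∀ r, algebraMap (𝓞 k) (𝓞 F₂) r ≠ e₂) (he₃ : ∀ r, algebraMap (𝓞 k) (𝓞 F₃) r ≠ e₃)
    {D : 𝓞 k} (hD : D = p * q ∨ D = -(p * q)) (heD : e₂ ^ 2 = algebraMap (𝓞 k) (𝓞 F₂) D)
    {z : 𝓞 F₂} (hz : 2 * z = 1 + e₂) {w : 𝓞 k} (hγD : B.IsDisc (γ * D) w) (hw : w ∣ 2)
    (hθ : 2 ∣ B.θ ^ 2) {v b c : 𝓞 F₃} (hv : v ^ 2 = algebraMap (𝓞 k) (𝓞 F₃) B.θ * (b * v + c))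
    (hc : IsCoprime (algebraMap (𝓞 k) (𝓞 F₃) B.θ) c)
    {l : 𝓞 K} (hl : Associated (algebraMap (𝓞 k) (𝓞 K) B.θ) (l ^ 2))
    (H : Sylow 2 (ClassGroup (𝓞 L))) :
    Nonempty (↥(H : Subgroup (ClassGroup (𝓞 L))) ≃* Multiplicative (ZMod 2 × ZMod 2)) := by
  have hTK : IsTotallyComplex K := isTotallyComplex_of_algebra k K
  have hTF₂ : IsTotallyComplex F₂ := isTotallyComplex_of_algebra k F₂
  have hTF₃ : IsTotallyComplex F₃ := isTotallyComplex_of_algebra k F₃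
  have hTL : IsTotallyComplex L := isTotallyComplex_of_algebra k L
  have h2q0 : (2 : ZMod q) ≠ 0 := by
    intro h
    have := (ZMod.natCast_eq_zero_iff 2 q).1 (by exact_mod_cast h)
    exact hq2 ((Nat.prime_dvd_prime_iff_eq Fact.out Nat.prime_two).1 this)
  have tK : ∀ r, algebraMap (𝓞 K) (𝓞 L) (algebraMap (𝓞 k) (𝓞 K) r) = algebraMap (𝓞 k) (𝓞 L) r :=
    fun r => (IsScalarTower.algebraMap_apply _ _ _ r).symm
  have t₂ : ∀ r, algebraMap (𝓞 F₂) (𝓞 L) (algebraMap (𝓞 k) (𝓞 F₂) r) =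
    algebraMap (𝓞 k) (𝓞 L) r := fun r => (IsScalarTower.algebraMap_apply _ _ _ r).symm
  have t₃ : ∀ r, algebraMap (𝓞 F₃) (𝓞 L) (algebraMap (𝓞 k) (𝓞 F₃) r) =
    algebraMap (𝓞 k) (𝓞 L) r := fun r => (IsScalarTower.algebraMap_apply _ _ _ r).symm
  have hDz : D ≠ 0 := by
    have hp := (Fact.out : p.Prime).ne_zero
    have hq := (Fact.out : q.Prime).ne_zero
    rcases hD with rfl | rfl
    · exact_mod_cast mul_ne_zero hp hq
    · exact neg_ne_zero.2 (by exact_mod_cast mul_ne_zero hp hq)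
  have heD₃ : e₃ ^ 2 = algebraMap (𝓞 k) (𝓞 F₃) (γ * D) := by
    apply FaithfulSMul.algebraMap_injective (𝓞 F₃) (𝓞 L)
    rw [map_pow, hge, mul_pow, ← map_pow, hg, ← map_pow, heD, tK, t₂, t₃, map_mul]
  have hgL : (algebraMap (𝓞 K) (𝓞 L) g) ^ 2 = algebraMap (𝓞 k) (𝓞 L) γ := by
    rw [← map_pow, hg, tK]
  have heL : (algebraMap (𝓞 F₂) (𝓞 L) e₂) ^ 2 =
      algebraMap (𝓞 K) (𝓞 L) (algebraMap (𝓞 k) (𝓞 K) D) := by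
    rw [← map_pow, heD, t₂, tK]
  obtain ⟨s, hs⟩ := QuadConj.exists_of_finrank hK
  obtain ⟨s₂, hs₂⟩ := QuadConj.exists_of_finrank hF₂
  obtain ⟨s₃, hs₃⟩ := QuadConj.exists_of_finrank hF₃
  obtain ⟨σ, hσ⟩ := QuadConj.exists_of_finrank hKL
  obtain ⟨τ₂, hτ₂⟩ := QuadConj.exists_of_finrank hF₂L
  obtain ⟨τ₃, hτ₃⟩ := QuadConj.exists_of_finrank hF₃L
  have sg := hs.apply_eq_neg hg hg₁
  have se₂ := hs₂.apply_eq_neg heD he₂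
  have se₃ := hs₃.apply_eq_neg heD₃ he₃
  have σe := hσ.apply_eq_neg heL he
  have τ₂g := hτ₂.apply_eq_neg (a := algebraMap (𝓞 k) (𝓞 F₂) γ) (by rw [hgL, t₂]) hg₂
  have τ₃g := hτ₃.apply_eq_neg (a := algebraMap (𝓞 k) (𝓞 F₃) γ) (by rw [hgL, t₃]) hg₃
  have hg0 : algebraMap (𝓞 K) (𝓞 L) g ≠ 0 := fun h => hg₂ 0 (by rw [map_zero, h])
  have τ₃e : τ₃ (algebraMap (𝓞 F₂) (𝓞 L) e₂) = -algebraMap (𝓞 F₂) (𝓞 L) e₂ := by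
    have h1 := τ₃.commutes e₃
    rw [hge, map_mul, τ₃g] at h1
    refine mul_left_cancel₀ hg0 ?_
    linear_combination -h1
  have hτ : ∀ x, τ₂ (τ₃ x) = σ x := by
    have hDL : algebraMap (𝓞 k) (𝓞 K) D ≠ 0 := (map_ne_zero_iff _ hs.inj).2 hDz
    have h1 : ((τ₂ : 𝓞 L →+* 𝓞 L).comp (τ₃ : 𝓞 L →+* 𝓞 L)).comp (algebraMap (𝓞 K) (𝓞 L)) =
        (σ : 𝓞 L →+* 𝓞 L).comp (algebraMap (𝓞 K) (𝓞 L)) := by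
      refine hs.ringHom_ext hγ hg sg ?_ (fun r => ?_) ?_
      · exact (τ₂.injective.comp τ₃.injective).comp hσ.inj
      · change τ₂ (τ₃ (algebraMap (𝓞 K) (𝓞 L) _)) = σ (algebraMap (𝓞 K) (𝓞 L) _)
        rw [σ.commutes, tK, ← t₃, τ₃.commutes, t₃, ← t₂, τ₂.commutes]
      · change τ₂ (τ₃ (algebraMap (𝓞 K) (𝓞 L) _)) = σ (algebraMap (𝓞 K) (𝓞 L) _)
        rw [σ.commutes, τ₃g, map_neg, τ₂g, neg_neg]
    have h2 : (τ₂ : 𝓞 L →+* 𝓞 L).comp (τ₃ : 𝓞 L →+* 𝓞 L) = (σ : 𝓞 L →+* 𝓞 L) := by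
      refine hσ.ringHom_ext hDL heL σe (τ₂.injective.comp τ₃.injective)
        (fun r => RingHom.congr_fun h1 r) ?_
      change τ₂ (τ₃ _) = σ _
      rw [τ₃e, σe, map_neg, τ₂.commutes]
    exact fun x => RingHom.congr_fun h2 x
  have hz₂ : z - s₂ z = e₂ := by
    have h1 := congrArg s₂ hz
    rw [map_mul, map_ofNat, map_add, map_one, se₂] at h1
    refine mul_left_cancel₀ (two_ne_zero (α := 𝓞 F₂)) ?_
    linear_combination hz - h1
  have hzL : algebraMap (𝓞 F₂) (𝓞 L) z - σ (algebraMap (𝓞 F₂) (𝓞 L) z) =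
      algebraMap (𝓞 F₂) (𝓞 L) e₂ := by
    have h0 := congrArg (algebraMap (𝓞 F₂) (𝓞 L)) hz
    rw [map_mul, map_ofNat, map_add, map_one] at h0
    have h1 := congrArg σ h0
    rw [map_mul, map_ofNat, map_add, map_one, σe] at h1
    refine mul_left_cancel₀ (two_ne_zero (α := 𝓞 L)) ?_
    linear_combination h0 - h1
  obtain ⟨w₂, hw₂, hD₂⟩ : ∃ w : 𝓞 k, IsUnit w ∧ B.IsDisc D w := by
    rcases hD with rfl | rfl
    · exact ⟨1, isUnit_one, by rw [B.mul_π]; ring, by simp, by simp,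
        fun h => B.prime_q.not_isUnit (isUnit_of_dvd_one h)⟩
    · exact ⟨-1, isUnit_one.neg, by rw [B.mul_π]; ring, by simp, by simp,
        fun h => B.prime_q.not_isUnit (isUnit_of_dvd_one (by simpa using h))⟩
  obtain ⟨f₂, n₂⟩ := hs₂.herbrand_units hF₂
  obtain ⟨f₃, n₃⟩ := hs₃.herbrand_units hF₃
  obtain ⟨fL, nL⟩ := hσ.herbrand_units hKL
  have odd₂ := BaseData.exists_odd_pow_of_three hpq hs₂ hD₂ hw₂ heD se₂ hz₂ hpq' f₂ n₂.le
  have odd₃ := BaseData.exists_odd_pow_of_four hpq hs₃ hγD hw hθ heD₃ se₃ hv hc hpq' h2p h2q h2q0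
    f₃ n₃.le
  have cardL := C.card_two_torsion_le hpq hq2 (D := algebraMap (𝓞 k) (𝓞 K) D)
    (by rcases hD with rfl | rfl <;> simp) hσ heL σe hzL fL nL.le
  obtain ⟨hP2, hP, T, hT⟩ := C.exists_nonsquare hp2 hpq hq2 (D := algebraMap (𝓞 k) (𝓞 K) D)
    (by rcases hD with rfl | rfl <;> simp) hσ heL σe hpq' rfl
  have sq₂ := QuadConj.span_sq_of_prime B.prime₁ hD₂.dvd₁ (hD₂.not_sq_dvd₁ hpq) heD
  have sq₃ := QuadConj.span_sq_of_prime B.prime₁ hγD.dvd₁ (hγD.not_sq_dvd₁ hpq) heD₃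
  have map₂ : (Ideal.span {algebraMap (𝓞 k) (𝓞 F₂) B.π₁, e₂}).map (algebraMap (𝓞 F₂) (𝓞 L)) =
      Ideal.span {algebraMap (𝓞 K) (𝓞 L) (algebraMap (𝓞 k) (𝓞 K) B.π₁),
        algebraMap (𝓞 F₂) (𝓞 L) e₂} := by
    rw [Ideal.map_span, Set.image_pair, t₂, tK]
  have map₃ : (Ideal.span {algebraMap (𝓞 k) (𝓞 F₃) B.π₁, e₃}).map (algebraMap (𝓞 F₃) (𝓞 L)) =
      Ideal.span {algebraMap (𝓞 K) (𝓞 L) (algebraMap (𝓞 k) (𝓞 K) B.π₁),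
        algebraMap (𝓞 F₂) (𝓞 L) e₂} := by
    apply Ideal.eq_of_sq_eq
    rw [← map₂, ← Ideal.map_pow, sq₃, ← Ideal.map_pow, sq₂, Ideal.map_span, Ideal.map_span,
      Set.image_singleton, Set.image_singleton, t₂, t₃]
  have sqv := Ideal.span_pair_sq hv hc
  have mapv : (Ideal.span {algebraMap (𝓞 k) (𝓞 F₃) B.θ, v}).map (algebraMap (𝓞 F₃) (𝓞 L)) =
      Ideal.span {algebraMap (𝓞 K) (𝓞 L) l} := by
    apply Ideal.eq_of_sq_eq
    rw [← Ideal.map_pow, sqv, Ideal.map_span, Set.image_singleton, t₃, Ideal.span_singleton_pow,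
      Ideal.span_singleton_eq_span_singleton, ← tK, ← map_pow]
    exact hl.map _
  have hθ0 := B.θ_ne_zero
  have hl0 : algebraMap (𝓞 K) (𝓞 L) l ≠ 0 := by
    rw [map_ne_zero_iff _ hσ.inj]
    rintro rfl
    have := hl.eq_zero_iff.2 (by simp)
    exact hθ0 ((map_eq_zero_iff _ hs.inj).1 this)
  have ne_bot : ∀ {A : Type} [CommRing A] [IsDomain A] {I : Ideal A} {a : A}, a ≠ 0 →
      I ^ 2 = Ideal.span {a} → I ≠ ⊥ := by
    rintro A _ _ I a ha h rfl
    rw [← Ideal.zero_eq_bot, zero_pow two_ne_zero, Ideal.zero_eq_bot, eq_comm,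
      Ideal.span_singleton_eq_bot] at h
    exact ha h
  have H₂ := exists_odd_pow_map hτ₂.inj
    (ne_bot ((map_ne_zero_iff _ hs₂.inj).2 B.π_ne.1) sq₂) (J := ⊤) top_ne_bot
    (by rw [map₂]) (by rw [Ideal.map_top, idealClass_top])
    (odd₂.imp fun m hm => ⟨hm.1, fun c => (hm.2 c).imp_right Or.inl⟩)
  have H₃ := exists_odd_pow_map hτ₃.inj
    (ne_bot ((map_ne_zero_iff _ hs₃.inj).2 B.π_ne.1) sq₃)
    (ne_bot ((map_ne_zero_iff _ hs₃.inj).2 hθ0) sqv)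
    (by rw [map₃]) (by rw [mapv, idealClass_span hl0]) odd₃
  obtain ⟨m, hm, hGm⟩ := QuadConj.exists_odd_sq_pow hτ₂ hτ₃ hσ hτ hP2 H₂ H₃
  exact nonempty_sylow_mulEquiv hm hGm hP2 hP hT cardL H

section SquareRoots

variable {k L : Type*} [Field k] [Field L] [Algebra k L]

lemma finrank_adjoin_of_sq_eq {x : L} {a : k} (hx : x ^ 2 = algebraMap k L a)
    (hne : ∀ r, algebraMap k L r ≠ x) : Module.finrank k k⟮x⟯ = 2 := by
  have hmonic : (Polynomial.X ^ 2 - Polynomial.C a : Polynomial k).Monic :=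
    Polynomial.monic_X_pow_sub_C a two_ne_zero
  have hroot : Polynomial.aeval x (Polynomial.X ^ 2 - Polynomial.C a : Polynomial k) = 0 := by
    simp [hx]
  have hintegral : IsIntegral k x := ⟨_, hmonic, by rwa [← Polynomial.aeval_def]⟩
  have hle : Module.finrank k k⟮x⟯ ≤ 2 := by
    rw [adjoin.finrank hintegral, ← Polynomial.natDegree_X_pow_sub_C (n := 2) (r := a)]
    exact Polynomial.natDegree_le_of_dvd (minpoly.dvd _ _ hroot) hmonic.ne_zero
  have hpos : 0 < Module.finrank k k⟮x⟯ := by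
    rw [adjoin.finrank hintegral]
    exact minpoly.natDegree_pos hintegral
  have h1 : Module.finrank k k⟮x⟯ ≠ 1 := fun h => by
    obtain ⟨r, hr⟩ := mem_bot.1 (finrank_adjoin_simple_eq_one_iff.1 h)
    exact hne r hr
  omega

variable {g e : L} {γ δ : k}

lemma ne_of_notMem_adjoin (he : e ∉ k⟮g⟯) (r : k) : algebraMap k L r ≠ e := by
  rintro rfl
  exact he (IntermediateField.algebraMap_mem _ r)

lemma mul_notMem_adjoin (hg0 : g ≠ 0) (he : e ∉ k⟮g⟯) : g * e ∉ k⟮g⟯ := fun h => he (by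
  have := mul_mem (inv_mem (mem_adjoin_simple_self k g)) h
  rwa [inv_mul_cancel_left₀ hg0] at this)

lemma finrank_of_adjoin_pair (hge : k⟮g, e⟯ = ⊤) (hδ : e ^ 2 = algebraMap k L δ)
    (he : e ∉ k⟮g⟯) : Module.finrank k⟮g⟯ L = 2 := by
  have h1 : Module.finrank k⟮g⟯ k⟮g⟯⟮e⟯ = 2 :=
    finrank_adjoin_of_sq_eq (a := algebraMap k k⟮g⟯ δ)
      (by rw [hδ, ← IsScalarTower.algebraMap_apply]) (fun r hr => he (hr ▸ r.2))
  have h2 : k⟮g⟯⟮e⟯ = ⊤ := by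
    rw [← restrictScalars_eq_top_iff (K := k), adjoin_simple_adjoin_simple, hge]
  rwa [h2, finrank_top'] at h1

lemma notMem_adjoin [FiniteDimensional k L] {x : L} (hx : Module.finrank k k⟮x⟯ = 2)
    (hg : Module.finrank k k⟮g⟯ = 2)
    (hxg : x ∉ k⟮g⟯) : g ∉ k⟮x⟯ := fun h => hxg (by
  have h1 := eq_of_le_of_finrank_eq (adjoin_simple_le_iff.2 h) (hg.trans hx.symm)
  rw [h1]
  exact mem_adjoin_simple_self k x)

end SquareRoots

lemma IntermediateField.exists_ringOfIntegers_of_sq_eq {k L : Type*} [Field k] [NumberField k]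
    [Field L] [NumberField L] [Algebra k L] (F : IntermediateField k L) {x : L} (hxF : x ∈ F)
    {b c : 𝓞 k} (hx : x ^ 2 = algebraMap (𝓞 k) L b * x + algebraMap (𝓞 k) L c) :
    ∃ y : 𝓞 F, ((y : F) : L) = x := by
  have h1 : IsIntegral (𝓞 k) x := by
    refine ⟨Polynomial.X ^ 2 + (-Polynomial.C b * Polynomial.X - Polynomial.C c),
      Polynomial.monic_X_pow_add ?_, ?_⟩
    · compute_degree!
    · simp only [Polynomial.eval₂_add, Polynomial.eval₂_sub, Polynomial.eval₂_mul,
        Polynomial.eval₂_neg, Polynomial.eval₂_pow, Polynomial.eval₂_X, Polynomial.eval₂_C]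
      linear_combination hx
  have h2 : IsIntegral ℤ (algebraMap F L ⟨x, hxF⟩) := isIntegral_trans (A := 𝓞 k) x h1
  exact ⟨⟨⟨x, hxF⟩, (isIntegral_algebraMap_iff (algebraMap F L).injective).1 h2⟩, rfl⟩

/-- The class group of `k(g, e)`, in terms of congruences in the base field. -/
theorem nonempty_sylow_mulEquiv_of_adjoin {k L : Type} [Field k] [NumberField k]
    [Field L] [NumberField L] [Algebra k L] [IsTotallyComplex k] [IsPrincipalIdealRing (𝓞 k)]
    {p q : ℕ} [Fact p.Prime] [Fact q.Prime] (hp2 : p ≠ 2) (hq2 : q ≠ 2) (hpq : p ≠ q)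
    (hpq' : ¬ IsSquare (p : ZMod q)) (h2p : ¬ IsSquare (2 : ZMod p)) (h2q : IsSquare (2 : ZMod q))
    {B : BaseData (𝓞 k) p q} {g e : L} [IsPrincipalIdealRing (𝓞 k⟮g⟯)]
    (C : CycData B (algebraMap (𝓞 k) (𝓞 k⟮g⟯))) {γ D : 𝓞 k}
    (hg : g ^ 2 = algebraMap (𝓞 k) L γ) (hgk : ∀ r, algebraMap k L r ≠ g)
    (he : e ^ 2 = algebraMap (𝓞 k) L D) (heK : e ∉ k⟮g⟯) (hge : k⟮g, e⟯ = ⊤)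
    (hD : D = p * q ∨ D = -(p * q)) {n : 𝓞 k} (hn : D = 1 + 4 * n)
    {w : 𝓞 k} (hγD : B.IsDisc (γ * D) w) (hw : w ∣ 2)
    (hθ : 2 ∣ B.θ ^ 2) {a b c : 𝓞 k} (ha : 2 * a = -(b * B.θ ^ 2))
    (hac : γ * D - a ^ 2 = c * B.θ ^ 3) (hc : IsCoprime B.θ c)
    {l : 𝓞 k⟮g⟯} (hl : Associated (algebraMap (𝓞 k) (𝓞 k⟮g⟯) B.θ) (l ^ 2))
    (H : Sylow 2 (ClassGroup (𝓞 L))) :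
    Nonempty (↥(H : Subgroup (ClassGroup (𝓞 L))) ≃* Multiplicative (ZMod 2 × ZMod 2)) := by
  have hg0 : g ≠ 0 := fun h => hgk 0 (by rw [map_zero, h])
  have hγ : γ ≠ 0 := by
    rintro rfl
    rw [map_zero] at hg
    exact hg0 (pow_eq_zero_iff two_ne_zero |>.1 hg)
  have hgeK := mul_notMem_adjoin hg0 heK
  have tL : ∀ r : 𝓞 k, algebraMap (𝓞 k) L r = algebraMap k L r := fun r =>
    IsScalarTower.algebraMap_apply _ _ _ r
  have heg : (g * e) ^ 2 = algebraMap (𝓞 k) L (γ * D) := by rw [mul_pow, hg, he, map_mul]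
  have dK := finrank_adjoin_of_sq_eq (hg.trans (tL _)) hgk
  have d₂ := finrank_adjoin_of_sq_eq (he.trans (tL _)) (ne_of_notMem_adjoin heK)
  have d₃ := finrank_adjoin_of_sq_eq (heg.trans (tL _)) (ne_of_notMem_adjoin hgeK)
  have dKL := finrank_of_adjoin_pair hge (he.trans (tL _)) heK
  have dL : Module.finrank k L = 4 := by
    rw [← Module.finrank_mul_finrank k k⟮g⟯ L, dK, dKL]
  have d₂L : Module.finrank k⟮e⟯ L = 2 := by
    have := Module.finrank_mul_finrank k k⟮e⟯ L
    rw [d₂, dL] at this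
    omega
  have d₃L : Module.finrank k⟮g * e⟯ L = 2 := by
    have := Module.finrank_mul_finrank k k⟮g * e⟯ L
    rw [d₃, dL] at this
    omega
  have hg₂ := notMem_adjoin d₂ dK heK
  have hg₃ := notMem_adjoin d₃ dK hgeK
  obtain ⟨g', hg'⟩ := k⟮g⟯.exists_ringOfIntegers_of_sq_eq (mem_adjoin_simple_self k g)
    (b := 0) (c := γ) (by rw [hg, map_zero, zero_mul, zero_add])
  obtain ⟨e', he'⟩ := k⟮e⟯.exists_ringOfIntegers_of_sq_eq (mem_adjoin_simple_self k e)
    (b := 0) (c := D) (by rw [he, map_zero, zero_mul, zero_add])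
  obtain ⟨h', hh'⟩ := k⟮g * e⟯.exists_ringOfIntegers_of_sq_eq (mem_adjoin_simple_self k _)
    (b := 0) (c := γ * D) (by rw [heg, map_zero, zero_mul, zero_add])
  have hz : ((1 + e) / 2 : L) ∈ k⟮e⟯ :=
    div_mem (add_mem (one_mem _) (mem_adjoin_simple_self k e)) (ofNat_mem _ 2)
  obtain ⟨z, hz⟩ := k⟮e⟯.exists_ringOfIntegers_of_sq_eq hz (b := 1) (c := n) (by
    have := he
    rw [hn, map_add, map_mul, map_one, map_ofNat] at this
    rw [map_one]
    linear_combination this / 4)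
  have hθ0 : algebraMap (𝓞 k) L B.θ ≠ 0 :=
    (map_ne_zero_iff _ (FaithfulSMul.algebraMap_injective (𝓞 k) L)).2 B.θ_ne_zero
  have tF : ∀ (F : IntermediateField k L) (r : 𝓞 k), algebraMap (𝓞 k) L r ∈ F := fun F r =>
    tL r ▸ IntermediateField.algebraMap_mem F _
  obtain ⟨v, hv⟩ := k⟮g * e⟯.exists_ringOfIntegers_of_sq_eq (b := B.θ * b) (c := B.θ * c)
    (div_mem (sub_mem (mem_adjoin_simple_self k _) (tF _ a)) (tF _ B.θ)) (by
    have h1 := congrArg (algebraMap (𝓞 k) L) ha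
    have h2 := congrArg (algebraMap (𝓞 k) L) hac
    simp only [map_mul, map_sub, map_pow, map_neg, map_ofNat] at h1 h2 heg ⊢
    field_simp
    linear_combination heg + h2 - (g * e - algebraMap (𝓞 k) L a) * h1)
  have inj : ∀ {F : IntermediateField k L} {x y : 𝓞 F}, ((x : F) : L) = ((y : F) : L) → x = y :=
    fun h => RingOfIntegers.coe_injective (Subtype.ext h)
  refine nonempty_sylow_mulEquiv_of_biquadratic dK d₂ d₃ dKL d₂L d₃L hp2 hq2 hpq hpq' h2p h2q C
    hγ (g := g') (e₂ := e') (e₃ := h') (z := z) (v := v) ?_ ?_ ?_ ?_ ?_ ?_ ?_ ?_ hD ?_ ?_ hγD hw hθ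
    (b := algebraMap _ _ b) (c := algebraMap _ _ c) ?_ (hc.map _) hl H
  · refine inj ?_
    change ((g' : k⟮g⟯) : L) ^ 2 = algebraMap (𝓞 k) L γ
    rw [hg', hg]
  · refine RingOfIntegers.coe_injective ?_
    exact hh'.trans (congrArg₂ (· * ·) hg' he').symm
  · intro r hr
    apply hgk r
    rw [← hg', ← hr]
    rfl
  · intro r hr
    apply hg₂
    have : ((r : k⟮e⟯) : L) = g := (congrArg (algebraMap (𝓞 L) L) hr).trans hg'
    exact Set.mem_of_eq_of_mem this.symm (r : k⟮e⟯).2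
  · intro r hr
    apply hg₃
    have : ((r : k⟮g * e⟯) : L) = g := (congrArg (algebraMap (𝓞 L) L) hr).trans hg'
    exact Set.mem_of_eq_of_mem this.symm (r : k⟮g * e⟯).2
  · intro r hr
    apply heK
    have : ((r : k⟮g⟯) : L) = e := (congrArg (algebraMap (𝓞 L) L) hr).trans he'
    exact Set.mem_of_eq_of_mem this.symm (r : k⟮g⟯).2
  · intro r hr
    apply ne_of_notMem_adjoin heK r
    rw [← he', ← hr]
    rfl
  · intro r hr
    apply ne_of_notMem_adjoin hgeK r
    rw [← hh', ← hr]
    rfl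
  · refine inj ?_
    change ((e' : k⟮e⟯) : L) ^ 2 = algebraMap (𝓞 k) L D
    rw [he', he]
  · refine inj ?_
    change 2 * ((z : k⟮e⟯) : L) = 1 + ((e' : k⟮e⟯) : L)
    rw [hz, he']
    ring
  · refine inj ?_
    have h1 := congrArg (algebraMap (𝓞 k) L) ha
    have h2 := congrArg (algebraMap (𝓞 k) L) hac
    change ((v : k⟮g * e⟯) : L) ^ 2 = algebraMap (𝓞 k) L B.θ *
      (algebraMap (𝓞 k) L b * ((v : k⟮g * e⟯) : L) + algebraMap (𝓞 k) L c)
    rw [hv]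
    simp only [map_mul, map_sub, map_pow, map_neg, map_ofNat] at h1 h2 heg ⊢
    field_simp
    linear_combination heg + h2 - (g * e - algebraMap (𝓞 k) L a) * h1

lemma CycData.sq_ne {R : Type*} [CommRing R] {p q : ℕ} {B : BaseData R p q} {O : Type} [CommRing O]
    {g : R →+* O} (C : CycData B g) [Fact p.Prime] [Fact q.Prime] [IsDomain O] [CharZero O]
    (hpq : p ≠ q) (hq2 : q ≠ 2) {D : O} (hD : D = p * q ∨ D = -(p * q)) (x : O) : x ^ 2 ≠ D := by
  rintro rfl
  obtain ⟨h1, h2, h3⟩ := (C.exists_eq_mul hpq hq2 hD).2 0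
  exact h3 (pow_dvd_pow_of_dvd (h1.dvd_of_dvd_pow h2) 2)

lemma Zeta8.associated {O : Type} [CommRing O] {ζ : O} (h : ζ ^ 4 = -1) :
    Associated (1 + ζ ^ 2) ((1 - ζ) ^ 2) := by
  have hu : IsUnit (ζ ^ 2 * (ζ + ζ ^ 2 + ζ ^ 3)) :=
    IsUnit.of_mul_eq_one (-ζ ^ 2 * (-ζ + ζ ^ 2 - ζ ^ 3)) (by
      linear_combination (ζ ^ 6 + ζ ^ 4 - 1) * h)
  have h1 : 1 + ζ ^ 2 = ζ ^ 2 * (ζ + ζ ^ 2 + ζ ^ 3) * (1 - ζ) ^ 2 := by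
    linear_combination (-ζ ^ 3 + ζ ^ 2 + 1) * h
  rw [h1]
  exact (associated_isUnit_mul_left_iff hu).2 (Associated.refl _)

lemma NumberField.isTotallyComplex_of_sq_eq {k : Type*} [Field k] [NumberField k] {t : k} {d : ℤ}
    (hd : d < 0) (ht : t ^ 2 = d) : IsTotallyComplex k := by
  refine ⟨fun v => ?_⟩
  by_contra hv
  have h := congrArg (InfinitePlace.embedding_of_isReal
    (InfinitePlace.not_isComplex_iff_isReal.1 hv)) ht
  rw [map_pow, map_intCast] at h
  have hd' : (d : ℝ) < 0 := by exact_mod_cast hd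
  nlinarith [sq_nonneg (InfinitePlace.embedding_of_isReal
    (InfinitePlace.not_isComplex_iff_isReal.1 hv) t)]

lemma NumberField.RingOfIntegers.ne_of_not_isSquare {k L A : Type*} [Field k] [NumberField k]
    [Field L] [Algebra k L] [CommRing A] {φ : 𝓞 k →+* A} {γ : 𝓞 k} {g : L}
    (hg : g ^ 2 = algebraMap k L γ) (hγ : ¬ IsSquare (φ γ)) (r : k) : algebraMap k L r ≠ g := by
  rintro rfl
  rw [← map_pow] at hg
  have h1 := (algebraMap k L).injective hg
  obtain ⟨r, rfl⟩ : ∃ y : 𝓞 k, (y : k) = r :=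
    ⟨⟨r, IsIntegral.of_pow two_pos (h1 ▸ γ.2)⟩, rfl⟩
  have h2 : r ^ 2 = γ := RingOfIntegers.coe_injective (by rw [map_pow, h1])
  exact hγ ⟨φ r, by rw [← h2, map_pow, sq]⟩

lemma NumberField.finrank_eq_mul {k K : Type*} [Field k] [NumberField k] [Field K] [NumberField K]
    [Algebra k K] : Module.finrank ℚ K = Module.finrank ℚ k * Module.finrank k K :=
  (Module.finrank_mul_finrank ℚ k K).symm

section Bases

variable {k L : Type} [Field k] [NumberField k] [Field L] [NumberField L] [Algebra k L]
  {p q : ℕ} [Fact p.Prime] [Fact q.Prime]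

lemma CycData.notMem_adjoin {B : BaseData (𝓞 k) p q} {g e : L}
    (C : CycData B (algebraMap (𝓞 k) (𝓞 k⟮g⟯))) (hpq : p ≠ q) (hq2 : q ≠ 2) {D : 𝓞 k}
    (hD : D = p * q ∨ D = -(p * q)) (he : e ^ 2 = algebraMap (𝓞 k) L D) : e ∉ k⟮g⟯ := by
  intro h
  obtain ⟨y, hy⟩ := k⟮g⟯.exists_ringOfIntegers_of_sq_eq h
    (b := 0) (c := D) (by rw [he, map_zero, zero_mul, zero_add])
  refine C.sq_ne hpq hq2 (D := algebraMap _ _ D) (by rcases hD with rfl | rfl <;> simp) y ?_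
  refine RingOfIntegers.coe_injective (Subtype.ext ?_)
  change ((y : k⟮g⟯) : L) ^ 2 = algebraMap (𝓞 k) L D
  rw [hy, he]

end Bases

lemma IntermediateField.ringOfIntegers_ext {k L : Type*} [Field k] [Field L] [Algebra k L]
    {K : IntermediateField k L}
    {x y : 𝓞 K}
    (h : ((x : K) : L) = ((y : K) : L)) : x = y :=
  RingOfIntegers.coe_injective (Subtype.ext h)

lemma ZMod.not_isSquare_neg {q : ℕ} [Fact q.Prime] (hq : ¬ IsSquare (-1 : ZMod q)) {a : ZMod q}
    (ha0 : a ≠ 0) (ha : IsSquare a) : ¬ IsSquare (-a) := fun h =>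
  hq (by simpa [neg_div, ha0] using h.div ha)

lemma ZMod.two_ne_zero_of_ne {p : ℕ} [Fact p.Prime] (hp2 : p ≠ 2) : (2 : ZMod p) ≠ 0 := by
  intro h
  have := (ZMod.natCast_eq_zero_iff 2 p).1 (by exact_mod_cast h)
  exact hp2 ((Nat.prime_dvd_prime_iff_eq Fact.out Nat.prime_two).1 this)

section Cases

variable {k L : Type} [Field k] [NumberField k] [Field L] [NumberField L] [Algebra k L]
  {p q : ℕ} [Fact p.Prime] [Fact q.Prime]

lemma BaseData.isDisc_neg_one {B : BaseData (𝓞 k) p q} {D : 𝓞 k} (hD : D = p * q) :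
    B.IsDisc (-1 * D) (-1) := by
  refine ⟨by rw [hD, B.mul_π], by simp, by simp, fun h => B.prime_q.not_isUnit ?_⟩
  exact isUnit_of_dvd_one (by simpa using h)

lemma BaseData.isDisc_neg_two (hp2 : p ≠ 2) (hq2 : q ≠ 2) {B : BaseData (𝓞 k) p q} {D : 𝓞 k}
    (hD : D = -(p * q)) : B.IsDisc (2 * D) (-2) := by
  have h2 := ZMod.two_ne_zero_of_ne hp2
  refine ⟨by rw [hD, B.mul_π]; ring, by rw [map_neg, map_ofNat]; exact neg_ne_zero.2 h2,
    by rw [map_neg, map_ofNat]; exact neg_ne_zero.2 h2,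
    fun h => B.prime_q.not_isUnit ?_⟩
  obtain ⟨m, hm⟩ := ((Fact.out : q.Prime).eq_two_or_odd').resolve_left hq2
  have h3 := (dvd_refl (q : 𝓞 k)).sub (((dvd_neg.1 h).mul_right (m : 𝓞 k)))
  nth_rw 2 [hm] at h3
  push_cast at h3
  rw [add_sub_cancel_left] at h3
  exact isUnit_of_dvd_one h3

lemma NumberField.exists_zeta8 {K : IntermediateField k L} (hK : Module.finrank ℚ K = 4) {z : L}
    (hzK : z ∈ K) (hz : z ^ 4 = -1) : ∃ ζ : 𝓞 K, ((ζ : K) : L) = z ∧ Zeta8 ζ := by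
  have h1 : (⟨z, hzK⟩ : K) ^ 4 = -1 := Subtype.ext hz
  have h2 : IsIntegral ℤ (⟨z, hzK⟩ : K) :=
    IsIntegral.of_pow (n := 4) (by norm_num) (by rw [h1]; exact isIntegral_one.neg)
  refine ⟨⟨_, h2⟩, rfl, Zeta8.of_ringOfIntegers hK (RingOfIntegers.coe_injective ?_)⟩
  exact h1.trans (by rw [map_neg, map_one])

theorem nonempty_sylow_mulEquiv_of_sq_eq_neg_one (hk : Module.finrank ℚ k = 2) {t : k}
    (ht : t ^ 2 = -1) {g e : L} (hg : g ^ 2 = 2) (he : e ^ 2 = -(p * q)) (hge : k⟮g, e⟯ = ⊤)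
    (hp2 : p ≠ 2) (hq2 : q ≠ 2) (hpq : p ≠ q) (hmod : p * q % 4 = 3)
    (hpq' : ¬ IsSquare (p : ZMod q)) (h2p : ¬ IsSquare (2 : ZMod p)) (h2q : IsSquare (2 : ZMod q))
    (hp : IsSquare (-1 : ZMod p)) (hq : ¬ IsSquare (-1 : ZMod q))
    (H : Sylow 2 (ClassGroup (𝓞 L))) :
    Nonempty (↥(H : Subgroup (ClassGroup (𝓞 L))) ≃* Multiplicative (ZMod 2 × ZMod 2)) := by
  have hq' := ZMod.not_isSquare_neg hq (ZMod.two_ne_zero_of_ne hq2) h2q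
  have hεp : ∀ φ : ℤ√(-1) →+* ZMod p, ¬ IsSquare (φ (-Zsqrtd.sqrtd)) := by
    rintro φ ⟨y, hy⟩
    have h1 : φ Zsqrtd.sqrtd ^ 2 = -1 := by
      rw [← map_pow, show (Zsqrtd.sqrtd ^ 2 : ℤ√(-1)) = -1 by ext <;> simp [sq], map_neg, map_one]
    rw [map_neg] at hy
    have hy4 : y ^ 4 = -1 := by
      linear_combination (φ Zsqrtd.sqrtd - y ^ 2) * hy + h1
    exact h2p ⟨y - y ^ 3, by linear_combination (2 - y ^ 2) * hy4⟩
  have hT := isTotallyComplex_of_sq_eq (k := k) (d := -1) (by norm_num) (by rw [ht]; norm_num)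
  obtain ⟨ψ, hψ⟩ := Zsqrtd.exists_ringEquiv_ringOfIntegers (d := -1) (Or.inl rfl) hk
    (t := t) (by rw [ht]; norm_num)
  have := Zsqrtd.isPrincipalIdealRing_of_small (d := -1) (by norm_num)
  have : IsPrincipalIdealRing (𝓞 k) := IsPrincipalIdealRing.of_surjective ψ ψ.surjective
  obtain ⟨B, hBθ, hBε, hBν⟩ := BaseData.exists_of_equiv (Or.inl rfl) ψ Fact.out hp2 Fact.out
    (by exact_mod_cast hp) (by exact_mod_cast hq) (θ := 1 + Zsqrtd.sqrtd) (ε := -Zsqrtd.sqrtd)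
    (by decide) (by decide) hεp
  obtain ⟨τ, hτ⟩ : ∃ τ, τ = ψ Zsqrtd.sqrtd := ⟨_, rfl⟩
  rw [← hτ] at hψ
  have hτ2 : τ ^ 2 = -1 :=
    RingOfIntegers.coe_injective (by
      rw [map_pow, map_neg, map_one, ← ht]; exact congrArg (· ^ 2) hψ)
  have hBθ' : B.θ = 1 + τ := by rw [hBθ, map_add, map_one, hτ]
  have hg' : g ^ 2 = algebraMap k L ((2 : 𝓞 k) : k) := by
    rw [hg]; exact (map_ofNat (algebraMap (𝓞 k) L) 2).symm
  have hgk : ∀ r, algebraMap k L r ≠ g := RingOfIntegers.ne_of_not_isSquare (γ := 2) (φ := B.φ₁)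
    hg' (by rwa [map_ofNat])
  have hK : Module.finrank ℚ k⟮g⟯ = 4 := by
    have h1 : Module.finrank k k⟮g⟯ = 2 := finrank_adjoin_of_sq_eq hg' hgk
    rw [finrank_eq_mul (k := k) (K := k⟮g⟯), h1, hk]
  have hg0 : g ≠ 0 := fun h => hgk 0 (by rw [h, map_zero])
  have htL : algebraMap k L t ^ 2 = -1 := by rw [← map_pow, ht, map_neg, map_one]
  have hz2 : ((1 + algebraMap k L t) / g) ^ 2 = algebraMap k L t := by
    rw [div_pow, hg, div_eq_iff two_ne_zero]
    linear_combination htL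
  obtain ⟨ζ, hζ, h8⟩ := exists_zeta8 hK (z := (1 + algebraMap k L t) / g)
    (div_mem (add_mem (one_mem _) (k⟮g⟯.algebraMap_mem t)) (mem_adjoin_simple_self k g))
    (by linear_combination ((1 + algebraMap k L t) / g) ^ 2 * hz2 + algebraMap k L t * hz2 + htL)
  have := Zeta8.isPrincipalIdealRing hK (z := (ζ : k⟮g⟯)) (by
    rw [← map_pow, h8.pow_four, map_neg, map_one])
  have hζτ : algebraMap (𝓞 k) (𝓞 k⟮g⟯) τ = ζ ^ 2 := by
    refine IntermediateField.ringOfIntegers_ext ?_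
    change algebraMap k L (τ : k) = ((ζ : k⟮g⟯) : L) ^ 2
    rw [hζ, hz2]
    exact congrArg _ hψ
  obtain ⟨C⟩ := h8.exists_cycData_neg_one (by rw [RingOfIntegers.rank, hK]) B
    (g := algebraMap (𝓞 k) (𝓞 k⟮g⟯)) ψ (by rw [← hτ, hζτ]) hBε hBν hp hp2 h2q hq'
  obtain ⟨n, hn⟩ : ∃ n : ℕ, p * q = 4 * n + 3 := ⟨p * q / 4, by omega⟩
  have hn' : (p : 𝓞 k) * q = 4 * n + 3 := by exact_mod_cast congrArg (Nat.cast (R := 𝓞 k)) hn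
  have he' : e ^ 2 = algebraMap (𝓞 k) L (-(p * q)) := by rw [he]; simp
  have hD : (-(p * q) : 𝓞 k) = p * q ∨ (-(p * q) : 𝓞 k) = -(p * q) := Or.inr rfl
  have hθζ : algebraMap (𝓞 k) (𝓞 k⟮g⟯) B.θ = 1 + ζ ^ 2 := by rw [hBθ', map_add, map_one, hζτ]
  refine nonempty_sylow_mulEquiv_of_adjoin hp2 hq2 hpq hpq' h2p h2q C (γ := 2) hg' hgk he'
    (C.notMem_adjoin hpq hq2 hD he') hge hD (n := -(n + 1)) ?_
    (BaseData.isDisc_neg_two hp2 hq2 rfl) (neg_dvd.2 dvd_rfl) ⟨τ, ?_⟩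
    (a := B.θ) (b := τ - 1) (c := -1 + 2 * B.θ * (n + 1)) ?_ ?_ ⟨2 * (n + 1), -1, by ring⟩
    (l := 1 - ζ) (by rw [hθζ]; exact Zeta8.associated h8.pow_four) H
  · linear_combination -hn'
  · rw [hBθ']; linear_combination hτ2
  · rw [hBθ']; linear_combination (τ + 1) * hτ2
  · rw [hBθ']; linear_combination -2 * hn' + (2 + τ - 2 * (n + 1) * (5 + 4 * τ + τ ^ 2)) * hτ2

theorem nonempty_sylow_mulEquiv_of_sq_eq_neg_two (hk : Module.finrank ℚ k = 2) {t : k}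
    (ht : t ^ 2 = -2) {g e : L} (hg : g ^ 2 = -1) (he : e ^ 2 = p * q) (hge : k⟮g, e⟯ = ⊤)
    (hp2 : p ≠ 2) (hq2 : q ≠ 2) (hpq : p ≠ q) (hmod : p * q % 4 = 1)
    (hpq' : ¬ IsSquare (p : ZMod q)) (h2p : ¬ IsSquare (2 : ZMod p)) (h2q : IsSquare (2 : ZMod q))
    (hp : ¬ IsSquare (-1 : ZMod p)) (hp' : IsSquare (-2 : ZMod p)) (hq : ¬ IsSquare (-1 : ZMod q))
    (H : Sylow 2 (ClassGroup (𝓞 L))) :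
    Nonempty (↥(H : Subgroup (ClassGroup (𝓞 L))) ≃* Multiplicative (ZMod 2 × ZMod 2)) := by
  have hq' := ZMod.not_isSquare_neg hq (ZMod.two_ne_zero_of_ne hq2) h2q
  have hT := isTotallyComplex_of_sq_eq (k := k) (d := -2) (by norm_num) (by rw [ht]; norm_num)
  obtain ⟨ψ, hψ⟩ := Zsqrtd.exists_ringEquiv_ringOfIntegers (d := -2) (Or.inr rfl) hk
    (t := t) (by rw [ht]; norm_num)
  have := Zsqrtd.isPrincipalIdealRing_of_small (d := -2) (by norm_num)
  have : IsPrincipalIdealRing (𝓞 k) := IsPrincipalIdealRing.of_surjective ψ ψ.surjective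
  obtain ⟨B, hBθ, hBε, hBν⟩ := BaseData.exists_of_equiv (Or.inr rfl) ψ Fact.out hp2 Fact.out
    (by exact_mod_cast hp') (by exact_mod_cast hq') (θ := Zsqrtd.sqrtd) (ε := -1)
    (by decide) (by decide) (fun φ => by rwa [map_neg, map_one])
  have hθ2 : B.θ ^ 2 = -2 := RingOfIntegers.coe_injective (by
    rw [map_pow, hBθ, map_neg, map_ofNat, ← ht]; exact congrArg (· ^ 2) hψ)
  have hg' : g ^ 2 = algebraMap k L ((-1 : 𝓞 k) : k) := by
    rw [hg]; exact (by rw [map_neg, map_one] : algebraMap (𝓞 k) L (-1) = -1).symm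
  have hgk : ∀ r, algebraMap k L r ≠ g := RingOfIntegers.ne_of_not_isSquare (γ := -1) (φ := B.φ₁)
    hg' (by rwa [map_neg, map_one])
  have hK : Module.finrank ℚ k⟮g⟯ = 4 := by
    have h1 : Module.finrank k k⟮g⟯ = 2 := finrank_adjoin_of_sq_eq hg' hgk
    rw [finrank_eq_mul (k := k) (K := k⟮g⟯), h1, hk]
  have htL : algebraMap k L t ^ 2 = -2 := by rw [← map_pow, ht, map_neg, map_ofNat]
  have ht0 : algebraMap k L t ≠ 0 := fun h => by simp [h] at htL
  have hz2 : ((g - 1) / algebraMap k L t) ^ 2 = g := by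
    rw [div_pow, htL, div_eq_iff (neg_ne_zero.2 two_ne_zero)]
    linear_combination hg
  obtain ⟨ζ, hζ, h8⟩ := exists_zeta8 hK (z := (g - 1) / algebraMap k L t)
    (div_mem (sub_mem (mem_adjoin_simple_self k g) (one_mem _)) (k⟮g⟯.algebraMap_mem t))
    (by linear_combination (((g - 1) / algebraMap k L t) ^ 2 + g) * hz2 + hg)
  have := Zeta8.isPrincipalIdealRing hK (z := (ζ : k⟮g⟯)) (by
    rw [← map_pow, h8.pow_four, map_neg, map_one])
  have hζθ : algebraMap (𝓞 k) (𝓞 k⟮g⟯) B.θ = ζ + ζ ^ 3 := by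
    refine IntermediateField.ringOfIntegers_ext ?_
    change algebraMap k L (B.θ : k) = ((ζ : k⟮g⟯) : L) + ((ζ : k⟮g⟯) : L) ^ 3
    rw [hζ, pow_succ, hz2, ← mul_right_inj' ht0]
    trans algebraMap k L t * algebraMap k L t
    · rw [hBθ]
      exact congrArg (fun x => algebraMap k L t * algebraMap k L x) hψ
    · field_simp
      linear_combination htL - hg
  obtain ⟨C⟩ := h8.exists_cycData_neg_two (by rw [RingOfIntegers.rank, hK]) B
    (g := algebraMap (𝓞 k) (𝓞 k⟮g⟯)) ψ (by rw [← hBθ, hζθ]) hBε hBν h2p h2q hq'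
  obtain ⟨n, hn⟩ : ∃ n : ℕ, p * q = 4 * n + 1 := ⟨p * q / 4, by omega⟩
  have hn' : (p : 𝓞 k) * q = 4 * n + 1 := by exact_mod_cast congrArg (Nat.cast (R := 𝓞 k)) hn
  have he' : e ^ 2 = algebraMap (𝓞 k) L (p * q) := by rw [he]; simp
  have hD : (p * q : 𝓞 k) = p * q ∨ (p * q : 𝓞 k) = -(p * q) := Or.inl rfl
  have hζ1 : IsUnit ζ :=
  IsUnit.of_mul_eq_one (-ζ ^ 3) (by linear_combination -h8.pow_four)
  have hl : Associated (algebraMap (𝓞 k) (𝓞 k⟮g⟯) B.θ) ((1 - ζ) ^ 2) := by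
    rw [hζθ, show ζ + ζ ^ 3 = ζ * (1 + ζ ^ 2) by ring]
    exact (associated_isUnit_mul_left_iff hζ1).2 (Zeta8.associated h8.pow_four)
  refine nonempty_sylow_mulEquiv_of_adjoin hp2 hq2 hpq hpq' h2p h2q C (γ := -1) hg' hgk he'
    (C.notMem_adjoin hpq hq2 hD he') hge hD (n := n) (by rw [hn', add_comm])
    (BaseData.isDisc_neg_one rfl) (neg_dvd.2 (one_dvd 2)) ⟨-1, by rw [hθ2]; ring⟩
    (a := 1 + B.θ) (b := 1 + B.θ) (c := 1 - B.θ * n) ?_ ?_ ⟨n, 1, by ring⟩ hl H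
  · linear_combination (1 + B.θ) * hθ2
  · linear_combination -hn' + (n * (B.θ ^ 2 - 2) - 1 - B.θ) * hθ2

end Cases

lemma finrank_rat_adjoin_of_sq_eq_neg {L : Type} [Field L] [NumberField L] {t : L} {d : ℚ}
    (hd : d < 0) (ht : t ^ 2 = algebraMap ℚ L d) : Module.finrank ℚ ℚ⟮t⟯ = 2 :=
  finrank_adjoin_of_sq_eq ht fun r hr => by
    rw [← hr, ← map_pow] at ht
    nlinarith [sq_nonneg r, (algebraMap ℚ L).injective ht]

lemma adjoin_pair_eq_top_of_subfield {L : Type} [Field L] [NumberField L] {t g e : L}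
    (h : ∀ F : Subfield L, t ∈ F → g ∈ F → e ∈ F → F = ⊤) : ℚ⟮t⟯⟮g, e⟯ = ⊤ := by
  refine IntermediateField.toSubfield_injective (h _ ?_ ?_ ?_)
  · exact ℚ⟮t⟯⟮g, e⟯.algebraMap_mem ⟨t, mem_adjoin_simple_self ℚ t⟩
  · exact IntermediateField.subset_adjoin _ _ (by simp)
  · exact IntermediateField.subset_adjoin _ _ (by simp)

theorem nonempty_sylow_mulEquiv_of_generators {L : Type} [Field L] [NumberField L] {p q : ℕ}
    (h : Cond1 p q ∨ Cond2 p q) {s r i : L} (hs : s ^ 2 = 2) (hr : r ^ 2 = p * q) (hi : i ^ 2 = -1)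
    (hgen : ∀ F : Subfield L, s ∈ F → r ∈ F → i ∈ F → F = ⊤) (H : Sylow 2 (ClassGroup (𝓞 L))) :
    Nonempty (↥(H : Subgroup (ClassGroup (𝓞 L))) ≃* Multiplicative (ZMod 2 × ZMod 2)) := by
  have hi0 : i ≠ 0 := by
    rintro rfl
    simp at hi
  have hs0 : s ≠ 0 := by
    rintro rfl
    simp at hs
  rcases h with ⟨hp, hq, hp4, hq4, h2p, h2q, hpq⟩ | ⟨hp, hq, hp4, hq4, h2p, h2q, hpq⟩
  all_goals
    have := Fact.mk hp
    have := Fact.mk hq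
    have hp2 : p ≠ 2 := by rintro rfl; omega
    have hq2 : q ≠ 2 := by rintro rfl; omega
    have hne : p ≠ q := by
      rintro rfl
      rw [h2p] at h2q
      norm_num at h2q
    have hpq' : ¬ IsSquare (p : ZMod q) := by
      exact_mod_cast ZMod.nonsquare_iff_jacobiSym_eq_neg_one.1 hpq
    have h2p' : ¬ IsSquare (2 : ZMod p) := by
      exact_mod_cast ZMod.nonsquare_iff_jacobiSym_eq_neg_one.1 h2p
    have h2q' : IsSquare (2 : ZMod q) := by
      exact_mod_cast ZMod.isSquare_of_jacobiSym_eq_one h2q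
    have hq' : ¬ IsSquare (-1 : ZMod q) := by
      rw [ZMod.exists_sq_eq_neg_one_iff]; omega
  · refine nonempty_sylow_mulEquiv_of_sq_eq_neg_one (k := ℚ⟮i⟯) (g := s) (e := i * r)
      (finrank_rat_adjoin_of_sq_eq_neg (d := -1) (by norm_num) (by rw [hi]; simp))
      (t := ⟨i, mem_adjoin_simple_self ℚ i⟩) (Subtype.ext hi) hs
      (by rw [mul_pow, hi, hr]; ring)
      (adjoin_pair_eq_top_of_subfield fun F h1 h2 h3 =>
        hgen F h2 (by simpa [hi0] using div_mem h3 h1) h1)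
      hp2 hq2 hne (by rw [Nat.mul_mod, hp4, hq4]) hpq' h2p' h2q'
      (by rw [ZMod.exists_sq_eq_neg_one_iff]; omega) hq' H
  · have hp' : ¬ IsSquare (-1 : ZMod p) := by
      rw [ZMod.exists_sq_eq_neg_one_iff]; omega
    refine nonempty_sylow_mulEquiv_of_sq_eq_neg_two (k := ℚ⟮s * i⟯) (g := i) (e := r)
      (finrank_rat_adjoin_of_sq_eq_neg (d := -2) (by norm_num) (by rw [mul_pow, hs, hi]; simp))
      (t := ⟨s * i, mem_adjoin_simple_self ℚ _⟩)
      (Subtype.ext ((mul_pow s i 2).trans (by rw [hs, hi]; norm_num; rfl))) hi hr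
      (adjoin_pair_eq_top_of_subfield fun F h1 h2 h3 =>
        hgen F (by simpa [hi0] using div_mem h1 h2) h3 h2)
      hp2 hq2 hne (by rw [Nat.mul_mod, hp4, hq4]) hpq' h2p' h2q' hp'
      (by simpa using ZMod.isSquare_mul_of_not hp' h2p') hq' H

theorem statement6 (p q : ℕ) (h : Cond1 p q ∨ Cond2 p q) [NumberField ↥(Lf p q)]
    (P : Sylow 2 (ClassGroup (𝓞 ↥(Lf p q)))) :
    Nonempty (↥(P : Subgroup (ClassGroup (𝓞 ↥(Lf p q)))) ≃*
      Multiplicative (ZMod 2 × ZMod 2)) := by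
  obtain ⟨hs, hr, hi⟩ : ((√2 : ℝ) : ℂ) ∈ Lf p q ∧ ((√(p * q) : ℝ) : ℂ) ∈ Lf p q ∧
      Complex.I ∈ Lf p q := by
    refine ⟨?_, ?_, ?_⟩ <;> exact subset_adjoin ℚ _ (by simp)
  refine nonempty_sylow_mulEquiv_of_generators h (s := ⟨_, hs⟩) (r := ⟨_, hr⟩) (i := ⟨_, hi⟩)
    (Subtype.ext ?_) (Subtype.ext ?_) (Subtype.ext Complex.I_sq) (fun F h1 h2 h3 => ?_) P
  · change ((√2 : ℝ) : ℂ) ^ 2 = 2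
    rw [← Complex.ofReal_pow, Real.sq_sqrt two_pos.le]
    simp
  · change ((√(p * q) : ℝ) : ℂ) ^ 2 = p * q
    rw [← Complex.ofReal_pow, Real.sq_sqrt (by positivity)]
    simp
  · have hle : Lf p q ≤ (F.map (algebraMap (Lf p q) ℂ)).toIntermediateField (K := ℚ)
        (fun x => ⟨x, SubfieldClass.ratCast_mem F x, by simp⟩) := by
      refine adjoin_le_iff.2 ?_
      rintro x (rfl | rfl | rfl)
      exacts [⟨_, h1, rfl⟩, ⟨_, h2, rfl⟩, ⟨_, h3, rfl⟩]
    refine _root_.eq_top_iff.2 fun x _ => ?_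
    obtain ⟨y, hy, hyx⟩ := hle x.2
    rwa [← show y = x from Subtype.ext hyx]
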